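/- There exists a constant N such that for every binary cubic form F(U,V) = aU³ + bU²V + cUV² + dV³ with integer coefficients which is irreducible over ℚ and whose discriminant D(F) = 18abcd − 4b³d + b²c² − 4ac³ − 27a²d² satisfies |D(F)| ≥ N, the number of pairs (u,v) ∈ ℤ² with F(u,v) = ±1, counted up to the identification of (u,v) with (−u,−v), is at most 7. -/

import Mathlib

/-- The value of the binary cubic form `aU³ + bU²V + cUV² + dV³` at a pair. -/
def cubicFormVal (a b c d : ℤ) (p : ℤ × ℤ) : ℤ :=
  a * p.1 ^ 3 + b * p.1 ^ 2 * p.2 + c * p.1 * p.2 ^ 2 + d * p.2 ^ 3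

/-- Solutions of the Thue equation `F(U,V) = ±1`. -/
abbrev CubicThueSol (a b c d : ℤ) : Type :=
  {p : ℤ × ℤ // cubicFormVal a b c d p = 1 ∨ cubicFormVal a b c d p = -1}

/-- Identification of a solution `(u,v)` with `(-u,-v)`. -/
def pmRelCubic (a b c d : ℤ) (p q : CubicThueSol a b c d) : Prop :=
  (p : ℤ × ℤ) = (q : ℤ × ℤ) ∨ (p : ℤ × ℤ) = -(q : ℤ × ℤ)

/-- The discriminant of the binary cubic form `aU³ + bU²V + cUV² + dV³`. -/
def cubicDisc (a b c d : ℤ) : ℤ :=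
  18 * a * b * c * d - 4 * b ^ 3 * d + b ^ 2 * c ^ 2 - 4 * a * c ^ 3 -
    27 * a ^ 2 * d ^ 2

namespace CubicThue

open Finset Polynomial

section DividedDifference

/-- The weight of the node `t` in the divided difference functional on the nodes `T`. -/
noncomputable def ddWeight (F : Type*) [Field F] (T : Finset ℕ) (t : ℕ) : F :=
  Lagrange.nodalWeight T (fun s : ℕ => (s : F)) t

variable {F : Type*} [Field F]

lemma ddWeight_eq_inv_prod (T : Finset ℕ) (t : ℕ) :
    ddWeight F T t = (∏ s ∈ T.erase t, ((t : F) - s))⁻¹ := by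
  simp [ddWeight, Lagrange.nodalWeight]

variable [CharZero F]

lemma prod_node_sub_ne_zero (T : Finset ℕ) (t : ℕ) :
    ∏ s ∈ T.erase t, ((t : F) - s) ≠ 0 := by
  rw [Finset.prod_ne_zero_iff]
  intro s hs
  rw [sub_ne_zero]
  exact_mod_cast (Finset.ne_of_mem_erase hs).symm

lemma ddWeight_ne_zero (T : Finset ℕ) (t : ℕ) : ddWeight F T t ≠ 0 := by
  rw [ddWeight_eq_inv_prod]
  exact inv_ne_zero (prod_node_sub_ne_zero T t)

lemma sub_mul_ddWeight {T : Finset ℕ} {s t : ℕ} (hs : s ∈ T) (hst : t ≠ s) :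
    ((t : F) - s) * ddWeight F T t = ddWeight F (T.erase s) t := by
  rw [ddWeight_eq_inv_prod, ddWeight_eq_inv_prod, Finset.erase_right_comm,
    ← Finset.mul_prod_erase (T.erase t) _ (Finset.mem_erase.2 ⟨hst.symm, hs⟩), mul_inv]
  have : (t : F) - s ≠ 0 := by rw [sub_ne_zero]; exact_mod_cast hst
  field_simp

lemma sum_eval_mul_ddWeight {T : Finset ℕ} {P : F[X]} (hP : P.natDegree + 1 < T.card) :
    ∑ t ∈ T, P.eval (t : F) * ddWeight F T t = 0 := by
  have hdeg : P.degree < (T.card - 1 : ℕ) :=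
    lt_of_le_of_lt P.degree_le_natDegree (by exact_mod_cast (by omega))
  have h := Lagrange.coeff_eq_sum (s := T) (v := fun s : ℕ => (s : F)) (P := P)
    (Nat.cast_injective.injOn) (hdeg.trans_le (by exact_mod_cast Nat.sub_le _ _))
  rw [coeff_eq_zero_of_degree_lt hdeg] at h
  simpa [ddWeight_eq_inv_prod, div_eq_mul_inv] using h.symm

lemma sum_ddWeight {T : Finset ℕ} (hT : 1 < T.card) : ∑ t ∈ T, ddWeight F T t = 0 := by
  simpa using sum_eval_mul_ddWeight (F := F) (T := T) (P := 1) (by simpa using hT)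

lemma sum_choose_mul_ddWeight {T : Finset ℕ} {j : ℕ} (hj : j + 1 < T.card) :
    ∑ t ∈ T, (t.choose j : F) * ddWeight F T t = 0 := by
  have h := sum_eval_mul_ddWeight (F := F) (T := T) (P := descPochhammer F j)
    (by rwa [descPochhammer_natDegree])
  have hfac : (j.factorial : F) ≠ 0 := by exact_mod_cast j.factorial_ne_zero
  rw [← mul_right_inj' hfac, mul_zero, ← h, Finset.mul_sum]
  refine Finset.sum_congr rfl fun t _ => ?_
  rw [descPochhammer_eval_eq_descFactorial, Nat.descFactorial_eq_factorial_mul_choose]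
  push_cast
  ring

lemma X_sub_one_pow_dvd_sum_ddWeight (T : Finset ℕ) :
    (X - C 1 : F[X]) ^ (T.card - 1) ∣ ∑ t ∈ T, C (ddWeight F T t) * X ^ t := by
  rw [X_sub_C_pow_dvd_iff, X_pow_dvd_iff]
  intro j hj
  have h : (∑ t ∈ T, C (ddWeight F T t) * X ^ t : F[X]).comp (X + C 1) =
      ∑ t ∈ T, C (ddWeight F T t) * (X + 1) ^ t := by
    simp [Polynomial.sum_comp]
  rw [h, Polynomial.finsetSum_coeff, ← sum_choose_mul_ddWeight (F := F) (T := T) (j := j)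
    (by omega)]
  refine Finset.sum_congr rfl fun t _ => ?_
  rw [coeff_C_mul, coeff_X_add_one_pow, mul_comm]

/-- The divided difference of `t ↦ exp (t x)` on real nodes. -/
noncomputable def ddExpReal (T : Finset ℕ) (x : ℝ) : ℝ :=
  ∑ t ∈ T, ddWeight ℝ T t * Real.exp (t * x)

/-- The divided difference of `t ↦ exp (t x)` for complex `x`. -/
noncomputable def ddExp (T : Finset ℕ) (x : ℂ) : ℂ :=
  ∑ t ∈ T, ddWeight ℂ T t * Complex.exp (t * x)

lemma ddExpReal_zero {T : Finset ℕ} (hT : 1 < T.card) : ddExpReal T 0 = 0 := by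
  simpa [ddExpReal] using sum_ddWeight (F := ℝ) hT

lemma hasDerivAt_exp_mul_ddExpReal {T : Finset ℕ} {s : ℕ} (hs : s ∈ T) (x y : ℝ) :
    HasDerivAt (fun u => Real.exp (s * (x - u)) * ddExpReal T u)
      (Real.exp (s * (x - y)) * ddExpReal (T.erase s) y) y := by
  have h : ∀ u, Real.exp (s * (x - u)) * ddExpReal T u =
      ∑ t ∈ T, ddWeight ℝ T t * Real.exp (s * x + (t - s) * u) := by
    intro u
    rw [ddExpReal, Finset.mul_sum]
    refine Finset.sum_congr rfl fun t _ => ?_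
    rw [mul_left_comm, ← Real.exp_add]
    ring_nf
  simp_rw [h]
  have hd : HasDerivAt (fun u => ∑ t ∈ T, ddWeight ℝ T t * Real.exp (s * x + (t - s) * u))
      (∑ t ∈ T, ddWeight ℝ T t * (Real.exp (s * x + (t - s) * y) * (t - s))) y := by
    refine HasDerivAt.fun_sum fun t _ => HasDerivAt.const_mul _ (HasDerivAt.exp ?_)
    simpa using ((hasDerivAt_id y).const_mul ((t : ℝ) - s)).const_add (s * x)
  convert hd using 1
  rw [← Finset.sum_erase_add _ _ hs, ddExpReal, Finset.mul_sum]
  simp only [sub_self, mul_zero, add_zero]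
  refine Finset.sum_congr rfl fun t ht => ?_
  rw [← sub_mul_ddWeight hs (Finset.ne_of_mem_erase ht), mul_left_comm, ← Real.exp_add]
  ring_nf

lemma pow_div_factorial_le_ddExpReal {T : Finset ℕ} {x : ℝ} (hx : 0 ≤ x) (hT : T.Nonempty) :
    x ^ (T.card - 1) / (T.card - 1).factorial ≤ ddExpReal T x := by
  obtain ⟨n, hn⟩ : ∃ n, T.card = n + 1 := ⟨T.card - 1, by have := hT.card_pos; omega⟩
  rw [hn, Nat.add_sub_cancel]
  clear hT
  induction n generalizing T x with
  | zero =>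
    obtain ⟨t, rfl⟩ := Finset.card_eq_one.1 (by simpa using hn)
    simp only [ddExpReal, ddWeight_eq_inv_prod, Finset.sum_singleton]
    simp
    positivity
  | succ n ih =>
    obtain ⟨s, hs⟩ : T.Nonempty := Finset.card_pos.1 (by omega)
    have hcard : (T.erase s).card = n + 1 := by rw [Finset.card_erase_of_mem hs]; omega
    have hmono : MonotoneOn (fun u => Real.exp (s * (x - u)) * ddExpReal T u -
        u ^ (n + 1) / (n + 1).factorial) (Set.Icc 0 x) := by
      have hder : ∀ y : ℝ, HasDerivAt (fun u => Real.exp (s * (x - u)) * ddExpReal T u -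
          u ^ (n + 1) / (n + 1).factorial)
          (Real.exp (s * (x - y)) * ddExpReal (T.erase s) y - y ^ n / n.factorial) y := by
        intro y
        refine (hasDerivAt_exp_mul_ddExpReal hs x y).sub ?_
        refine ((hasDerivAt_pow (n + 1) y).div_const ((n + 1).factorial : ℝ)).congr_deriv ?_
        rw [Nat.factorial_succ]
        push_cast
        have : (n.factorial : ℝ) ≠ 0 := by positivity
        field_simp
      refine monotoneOn_of_deriv_nonneg (convex_Icc 0 x)
        (fun y _ => (hder y).continuousAt.continuousWithinAt)
        (fun y _ => (hder y).differentiableAt.differentiableWithinAt) fun y hy => ?_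
      rw [interior_Icc] at hy
      rw [(hder y).deriv, sub_nonneg]
      refine (ih hy.1.le hcard).trans (le_mul_of_one_le_left ?_ ?_)
      · exact le_trans (by have := hy.1; positivity) (ih hy.1.le hcard)
      · exact Real.one_le_exp (mul_nonneg (Nat.cast_nonneg s) (by linarith [hy.2]))
    have h := hmono (Set.left_mem_Icc.2 hx) (Set.right_mem_Icc.2 hx) hx
    simp only [sub_self, mul_zero, Real.exp_zero, one_mul,
      ddExpReal_zero (T := T) (by omega)] at h
    simpa using h

lemma norm_ddExp_le {T : Finset ℕ} {H : ℕ} (hH : ∀ t ∈ T, t ≤ H) (hT : T.Nonempty) (x : ℂ) :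
    ‖ddExp T x‖ ≤ ‖x‖ ^ (T.card - 1) / (T.card - 1).factorial * Real.exp (H * ‖x‖) := by
  obtain ⟨n, hn⟩ : ∃ n, T.card = n + 1 := ⟨T.card - 1, by have := hT.card_pos; omega⟩
  rw [hn, Nat.add_sub_cancel]
  clear hT
  induction n generalizing T x with
  | zero =>
    obtain ⟨t, rfl⟩ := Finset.card_eq_one.1 (by simpa using hn)
    simp only [ddExp, ddWeight_eq_inv_prod, Finset.sum_singleton]
    simp only [Finset.erase_singleton, Finset.prod_empty, inv_one, one_mul, pow_zero,
      Nat.factorial_zero, Nat.cast_one, div_one]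
    refine (Complex.norm_exp_le_exp_norm _).trans (Real.exp_le_exp.2 ?_)
    rw [norm_mul, Complex.norm_natCast]
    exact mul_le_mul_of_nonneg_right (by exact_mod_cast hH t (by simp)) (norm_nonneg _)
  | succ n ih =>
    obtain ⟨s, hs⟩ : T.Nonempty := Finset.card_pos.1 (by omega)
    have hcard : (T.erase s).card = n + 1 := by rw [Finset.card_erase_of_mem hs]; omega
    set f : ℝ → ℂ := fun u => ∑ t ∈ T, ddWeight ℂ T t * Complex.exp (s * x + (t - s) * x * u)
    set f' : ℝ → ℂ := fun u => x * (Complex.exp ((1 - u) * (s * x)) * ddExp (T.erase s) (u * x))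
    have hder : ∀ y : ℝ, HasDerivAt f (f' y) y := by
      intro y
      have hd : HasDerivAt f (∑ t ∈ T, ddWeight ℂ T t *
          (Complex.exp (s * x + (t - s) * x * y) * ((t - s) * x))) y := by
        refine HasDerivAt.fun_sum fun t _ => HasDerivAt.const_mul _ (HasDerivAt.cexp ?_)
        simpa using ((Complex.ofRealCLM.hasDerivAt (x := y)).const_mul
          (((t : ℂ) - s) * x)).const_add (s * x)
      convert hd using 1
      rw [← Finset.sum_erase_add _ _ hs]
      simp only [f', ddExp, Finset.mul_sum, sub_self, zero_mul, mul_zero, add_zero]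
      refine Finset.sum_congr rfl fun t ht => ?_
      rw [← sub_mul_ddWeight hs (Finset.ne_of_mem_erase ht)]
      rw [mul_left_comm (Complex.exp _), ← Complex.exp_add]
      ring_nf
    have hf1 : f 1 = ddExp T x := by
      simp only [f, ddExp]
      refine Finset.sum_congr rfl fun t _ => ?_
      push_cast
      ring_nf
    have hf0 : f 0 = 0 := by
      simp only [f, Complex.ofReal_zero, mul_zero, add_zero]
      rw [← Finset.sum_mul, sum_ddWeight (by omega), zero_mul]
    have hB : ∀ y : ℝ, HasDerivAt
        (fun u : ℝ => ‖x‖ ^ (n + 1) / (n + 1).factorial * Real.exp (H * ‖x‖) * u ^ (n + 1))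
        (‖x‖ ^ (n + 1) / n.factorial * Real.exp (H * ‖x‖) * y ^ n) y := by
      intro y
      refine ((hasDerivAt_pow (n + 1) y).const_mul
        (‖x‖ ^ (n + 1) / (n + 1).factorial * Real.exp (H * ‖x‖))).congr_deriv ?_
      rw [Nat.factorial_succ]
      push_cast
      have : (n.factorial : ℝ) ≠ 0 := by positivity
      field_simp
    have hsH : (s : ℝ) ≤ H := by exact_mod_cast hH s hs
    have key := image_norm_le_of_norm_deriv_right_le_deriv_boundary (f := f) (f' := f')
      (a := 0) (b := 1) (fun y _ => (hder y).continuousAt.continuousWithinAt)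
      (fun y _ => (hder y).hasDerivWithinAt) (by simp [hf0]) hB (fun y hy => by
        have h1 := ih (fun t ht => hH t (Finset.mem_of_mem_erase ht)) (y * x) hcard
        have hy0 : 0 ≤ y := hy.1
        have hy1 : y ≤ 1 := hy.2.le
        have h2 : ‖Complex.exp ((1 - y) * (s * x))‖ ≤ Real.exp ((1 - y) * (H * ‖x‖)) := by
          refine (Complex.norm_exp_le_exp_norm _).trans (Real.exp_le_exp.2 ?_)
          have h3 : ‖(1 - y : ℂ)‖ = 1 - y := by
            rw [← Complex.ofReal_one, ← Complex.ofReal_sub, Complex.norm_real, Real.norm_eq_abs,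
              abs_of_nonneg (by linarith)]
          rw [norm_mul, norm_mul, h3, Complex.norm_natCast]
          gcongr
        rw [norm_mul, Complex.norm_real, Real.norm_eq_abs, abs_of_nonneg hy0] at h1
        simp only [f', norm_mul]
        calc ‖x‖ * (‖Complex.exp ((1 - y) * (s * x))‖ * ‖ddExp (T.erase s) (y * x)‖)
            ≤ ‖x‖ * (Real.exp ((1 - y) * (H * ‖x‖)) *
              ((y * ‖x‖) ^ n / n.factorial * Real.exp (H * (y * ‖x‖)))) := by gcongr
          _ = ‖x‖ ^ (n + 1) / n.factorial * Real.exp (H * ‖x‖) * y ^ n := by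
            have : Real.exp (H * ‖x‖) =
                Real.exp ((1 - y) * (H * ‖x‖)) * Real.exp (H * (y * ‖x‖)) := by
              rw [← Real.exp_add]; ring_nf
            rw [this]; ring)
    have h := key (Set.right_mem_Icc.2 zero_le_one)
    rw [hf1] at h
    simpa using h

end DividedDifference

end CubicThue

namespace CubicThue

open Finset Polynomial

section IntegerWeights

lemma factorial_mul_ddWeight {F : Type*} [Field F] [CharZero F] {T : Finset ℕ} {H t : ℕ}
    (hT : T ⊆ range (H + 1)) (ht : t ∈ T) :
    (H.factorial : F) * ddWeight F T t =
      ((((-1) ^ (H - t) * H.choose t * ∏ s ∈ range (H + 1) \ T, ((t : ℤ) - s) : ℤ)) : F) := by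
  have htH : t ≤ H := Nat.lt_succ_iff.1 (Finset.mem_range.1 (hT ht))
  have hfull : ∏ s ∈ (range (H + 1)).erase t, ((t : ℤ) - s) =
      (-1) ^ (H - t) * t.factorial * (H - t).factorial := by
    have hsplit : (range (H + 1)).erase t =
        range t ∪ (range (H - t)).image (fun i => t + 1 + i) := by
      ext s
      simp only [Finset.mem_erase, Finset.mem_range, Finset.mem_union, Finset.mem_image]
      constructor
      · rintro ⟨h1, h2⟩
        by_cases h : s < t
        · exact Or.inl h
        · exact Or.inr ⟨s - t - 1, by omega, by omega⟩
      · rintro (h | ⟨i, hi, rfl⟩) <;> omega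
    have hdisj : Disjoint (range t) ((range (H - t)).image (fun i => t + 1 + i)) := by
      rw [Finset.disjoint_left]
      intro s hs hs'
      obtain ⟨i, -, rfl⟩ := Finset.mem_image.1 hs'
      have := Finset.mem_range.1 hs
      omega
    rw [hsplit, Finset.prod_union hdisj, Finset.prod_image (by intro i _ j _ h; simpa using h),
      ← Finset.prod_range_reflect]
    have h1 : ∏ j ∈ range t, ((t : ℤ) - ((t - 1 - j : ℕ) : ℤ)) = t.factorial := by
      rw [← Finset.prod_range_add_one_eq_factorial]
      push_cast
      refine Finset.prod_congr rfl fun j hj => ?_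
      have := Finset.mem_range.1 hj
      omega
    have h2 : ∏ j ∈ range (H - t), ((t : ℤ) - ((t + 1 + j : ℕ) : ℤ)) =
        (-1) ^ (H - t) * (H - t).factorial := by
      rw [← Finset.prod_range_add_one_eq_factorial, ← Finset.card_range (H - t),
        ← Finset.prod_const, Finset.card_range]
      push_cast
      rw [← Finset.prod_mul_distrib]
      refine Finset.prod_congr rfl fun j _ => ?_
      ring
    rw [h1, h2]
    ring
  have hprod : (∏ s ∈ T.erase t, ((t : ℤ) - s)) * ∏ s ∈ range (H + 1) \ T, ((t : ℤ) - s) =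
      (-1) ^ (H - t) * t.factorial * (H - t).factorial := by
    rw [← hfull, ← Finset.prod_union]
    · congr 1
      ext s
      have := @hT s
      by_cases h : s = t
      · subst h; simp [ht]
      · simp only [Finset.mem_union, Finset.mem_erase, Finset.mem_sdiff]; tauto
    · rw [Finset.disjoint_left]
      intro s hs hs'
      exact (Finset.mem_sdiff.1 hs').2 (Finset.mem_of_mem_erase hs)
  have hfac : (H.factorial : ℤ) = H.choose t * t.factorial * (H - t).factorial := by
    exact_mod_cast (Nat.choose_mul_factorial_mul_factorial htH).symm
  have hne : ∏ s ∈ T.erase t, ((t : F) - s) ≠ 0 := prod_node_sub_ne_zero T t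
  rw [ddWeight_eq_inv_prod, ← div_eq_mul_inv, div_eq_iff hne]
  have key : (H.factorial : ℤ) = ((-1) ^ (H - t) * H.choose t *
      ∏ s ∈ range (H + 1) \ T, ((t : ℤ) - s)) * ∏ s ∈ T.erase t, ((t : ℤ) - s) := by
    have hsq : ((-1 : ℤ) ^ (H - t)) * (-1) ^ (H - t) = 1 := by
      rw [← mul_pow]; simp
    calc (H.factorial : ℤ) = H.choose t * t.factorial * (H - t).factorial := hfac
      _ = ((-1 : ℤ) ^ (H - t) * (-1) ^ (H - t)) *
          (H.choose t * t.factorial * (H - t).factorial) := by rw [hsq, one_mul]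
      _ = (-1) ^ (H - t) * H.choose t * ((-1) ^ (H - t) * t.factorial * (H - t).factorial) := by
        ring
      _ = _ := by rw [← hprod]; ring
  have := congrArg (Int.cast : ℤ → F) key
  push_cast at this ⊢
  exact this

lemma prod_abs_add_le (z : ℤ) (k : ℕ) :
    ∏ i ∈ range k, (|z| + i) ≤ k.factorial * 2 ^ (z.natAbs + k) := by
  have h : ∏ i ∈ range k, (|z| + (i : ℤ)) = ((z.natAbs.ascFactorial k : ℕ) : ℤ) := by
    rw [Nat.ascFactorial_eq_prod_range]
    push_cast
    rfl
  rw [h, Nat.ascFactorial_eq_factorial_mul_choose']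
  have h2 : (z.natAbs + k - 1).choose k ≤ 2 ^ (z.natAbs + k) :=
    (Nat.choose_le_two_pow _ _).trans (Nat.pow_le_pow_right (by norm_num) (by omega))
  exact_mod_cast Nat.mul_le_mul_left _ h2

lemma exists_prod_sub_eq_factorial_mul (z : ℤ) (k : ℕ) :
    ∃ C : ℤ, ∏ i ∈ range k, (z - i) = k.factorial * C ∧ |C| ≤ 2 ^ (z.natAbs + k) := by
  have hdvd : (k.factorial : ℤ) ∣ ∏ i ∈ range k, (z - i) := by
    have h := Nat.factorial_coe_dvd_prod k (z - (k - 1))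
    rw [← Finset.prod_range_reflect] at h
    convert h using 1
    refine Finset.prod_congr rfl fun i hi => ?_
    have := Finset.mem_range.1 hi
    omega
  obtain ⟨C, hC⟩ := hdvd
  refine ⟨C, hC, ?_⟩
  have hpos : (0 : ℤ) < k.factorial := by exact_mod_cast k.factorial_pos
  have h1 : (k.factorial : ℤ) * |C| ≤ k.factorial * 2 ^ (z.natAbs + k) := by
    rw [← abs_of_pos hpos, ← abs_mul, ← hC, abs_of_pos hpos, Finset.abs_prod]
    refine le_trans (Finset.prod_le_prod (fun _ _ => abs_nonneg _) fun i _ => ?_)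
      (prod_abs_add_le z k)
    calc |z - i| ≤ |z| + |(i : ℤ)| := abs_sub _ _
      _ = |z| + i := by simp
  exact le_of_mul_le_mul_left h1 hpos

lemma factorial_dvd_three_pow_mul_prod (c : ℤ) (k : ℕ) :
    (k.factorial : ℤ) ∣ 3 ^ k * ∏ i ∈ range k, (c - 3 * i) := by
  set m := ordCompl[3] k.factorial with hm
  have hsplit : 3 ^ (k.factorial.factorization 3) * m = k.factorial :=
    Nat.ordProj_mul_ordCompl_eq_self _ _
  have hcop : Nat.Coprime 3 m := Nat.coprime_ordCompl (by norm_num) k.factorial_ne_zero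
  have hpow : k.factorial.factorization 3 ≤ k := by
    have : Fact (Nat.Prime 3) := ⟨by norm_num⟩
    have h := sub_one_mul_padicValNat_factorial (p := 3) k
    rw [Nat.factorization_def _ (by norm_num)]
    omega
  have hm_dvd : (m : ℤ) ∣ ∏ i ∈ range k, (c - 3 * i) := by
    obtain ⟨u, hu⟩ : ∃ u : ℤ, (m : ℤ) ∣ 3 * u - 1 := by
      have h := Nat.isCoprime_iff_coprime.2 hcop
      obtain ⟨a, b, hab⟩ := h
      exact ⟨a, -b, by push_cast at hab; linarith⟩
    have hucop : IsCoprime (m : ℤ) u := by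
      obtain ⟨v, hv⟩ := hu
      exact ⟨-v, 3, by linarith⟩
    have h1 : (m : ℤ) ∣ u ^ k * ∏ i ∈ range k, (c - 3 * i) := by
      obtain ⟨C, hC, -⟩ := exists_prod_sub_eq_factorial_mul (c * u) k
      have h2 : (m : ℤ) ∣ ∏ i ∈ range k, (c * u - i) :=
        Dvd.dvd.trans ⟨3 ^ (k.factorial.factorization 3), by
          rw [mul_comm]; exact_mod_cast hsplit.symm⟩ ⟨C, hC⟩
      have h3 : (u ^ k * ∏ i ∈ range k, (c - 3 * i)) ≡ ∏ i ∈ range k, (c * u - i) [ZMOD m] := by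
        have : u ^ k * ∏ i ∈ range k, (c - 3 * i) = ∏ i ∈ range k, (u * (c - 3 * i)) := by
          rw [Finset.prod_mul_distrib, Finset.prod_const, Finset.card_range]
        rw [this]
        refine Int.ModEq.prod fun i _ => ?_
        refine (Int.modEq_iff_dvd.2 ?_)
        obtain ⟨v, hv⟩ := hu
        exact ⟨v * i, by linear_combination (i : ℤ) * hv⟩
      exact (Int.modEq_zero_iff_dvd.1 (h3.trans (Int.modEq_zero_iff_dvd.2 h2)))
    exact (hucop.pow_right).dvd_of_dvd_mul_left h1
  have h3 : ((3 : ℤ) ^ (k.factorial.factorization 3)) ∣ 3 ^ k := pow_dvd_pow _ hpow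
  have := mul_dvd_mul h3 hm_dvd
  rwa [show (3 : ℤ) ^ (k.factorial.factorization 3) * m = k.factorial by exact_mod_cast hsplit]
    at this

lemma exists_three_pow_mul_prod_eq (z : ℤ) (k : ℕ) :
    ∃ C : ℤ, 3 ^ k * ∏ i ∈ range k, (z - 3 * i) = k.factorial * C ∧
      |C| ≤ 9 ^ k * 2 ^ (z.natAbs + k) := by
  obtain ⟨C, hC⟩ := factorial_dvd_three_pow_mul_prod z k
  refine ⟨C, hC, ?_⟩
  have hpos : (0 : ℤ) < k.factorial := by exact_mod_cast k.factorial_pos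
  have h1 : (k.factorial : ℤ) * |C| ≤ k.factorial * (9 ^ k * 2 ^ (z.natAbs + k)) := by
    rw [← abs_of_pos hpos, ← abs_mul, ← hC, abs_of_pos hpos, abs_mul, Finset.abs_prod]
    have h2 : ∏ i ∈ range k, |z - 3 * (i : ℤ)| ≤ 3 ^ k * ∏ i ∈ range k, (|z| + (i : ℤ)) := by
      rw [← Finset.card_range k, ← Finset.prod_const, Finset.card_range,
        ← Finset.prod_mul_distrib]
      refine Finset.prod_le_prod (fun _ _ => abs_nonneg _) fun i _ => ?_
      calc |z - 3 * i| ≤ |z| + |3 * (i : ℤ)| := abs_sub _ _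
        _ = |z| + 3 * i := by rw [abs_of_nonneg (show (0 : ℤ) ≤ 3 * i by positivity)]
        _ ≤ 3 * (|z| + i) := by linarith [abs_nonneg z]
    have h3 := prod_abs_add_le z k
    calc |(3 : ℤ) ^ k| * ∏ i ∈ range k, |z - 3 * (i : ℤ)|
        ≤ 3 ^ k * (3 ^ k * (k.factorial * 2 ^ (z.natAbs + k))) := by
          rw [abs_of_pos (by positivity)]
          gcongr
          exact h2.trans (by gcongr)
      _ = k.factorial * (9 ^ k * 2 ^ (z.natAbs + k)) := by
          rw [show (9 : ℤ) = 3 * 3 by norm_num, mul_pow]; ring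
  exact le_of_mul_le_mul_left h1 hpos

/-- Integrality of the weights for an interval with an arithmetic progression of difference
three removed. -/
lemma exists_int_eq_ddWeight_of_sdiff_progression {F : Type*} [Field F] [CharZero F]
    {T : Finset ℕ} {H a k t : ℕ} (hT : T ⊆ range (H + 1))
    (hcompl : range (H + 1) \ T = (range k).image (fun i => a + 3 * i)) (ha : a ≤ H)
    (ht : t ∈ T) :
    ∃ C : ℤ, (C : F) = (H.factorial * 3 ^ k / k.factorial : F) * ddWeight F T t ∧
      |C| ≤ 2 ^ H * (9 ^ k * 2 ^ (H + k)) := by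
  have htH : t ≤ H := Nat.lt_succ_iff.1 (Finset.mem_range.1 (hT ht))
  obtain ⟨C, hC, hCle⟩ := exists_three_pow_mul_prod_eq ((t : ℤ) - a) k
  have hprod : ∏ s ∈ range (H + 1) \ T, ((t : ℤ) - s) =
      ∏ i ∈ range k, ((t : ℤ) - a - 3 * i) := by
    rw [hcompl, Finset.prod_image (by intro i _ j _ h; simpa using h)]
    refine Finset.prod_congr rfl fun i _ => ?_
    push_cast
    ring
  refine ⟨(-1) ^ (H - t) * H.choose t * C, ?_, ?_⟩
  · have hk : (k.factorial : F) ≠ 0 := by exact_mod_cast k.factorial_ne_zero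
    have h := factorial_mul_ddWeight (F := F) hT ht
    rw [hprod] at h
    have hC' := congrArg (Int.cast : ℤ → F) hC
    have : (H.factorial * 3 ^ k / k.factorial : F) * ddWeight F T t =
        3 ^ k / k.factorial * (H.factorial * ddWeight F T t) := by ring
    rw [this, h]
    push_cast at hC' ⊢
    field_simp
    linear_combination (-1 : F) * H.choose t * hC'
  · rw [abs_mul, abs_mul, abs_pow, abs_neg, abs_one, one_pow, one_mul, Nat.abs_cast]
    have h1 : ((H.choose t : ℕ) : ℤ) ≤ 2 ^ H := by exact_mod_cast Nat.choose_le_two_pow H t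
    have h2 : ((t : ℤ) - a).natAbs ≤ H := by omega
    have h3 : |C| ≤ 9 ^ k * 2 ^ (H + k) :=
      hCle.trans (mul_le_mul_of_nonneg_left
        (pow_le_pow_right₀ (by norm_num) (by omega)) (by positivity))
    exact mul_le_mul h1 h3 (abs_nonneg _) (by positivity)

/-- Blocks of `R` consecutive integers at distance `n`. -/
def blockNodes (n R k : ℕ) : Finset ℕ := (range (n * k + R)).filter fun t => t % n < R

lemma sdiff_blockNodes {n R k : ℕ} (hR : R ≤ n) :
    range (n * k + R) \ blockNodes n R k =
      (range k ×ˢ range (n - R)).image (fun x => n * x.1 + R + x.2) := by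
  ext s
  simp only [blockNodes, Finset.mem_sdiff, Finset.mem_filter, Finset.mem_range, not_and, not_lt,
    Finset.mem_image, Finset.mem_product, Prod.exists]
  constructor
  · rintro ⟨h1, h2⟩
    have h3 := h2 h1
    rcases Nat.eq_zero_or_pos n with rfl | hn
    · simp at h1 h3; omega
    have h4 := Nat.div_add_mod s n
    have h5 := Nat.mod_lt s hn
    refine ⟨s / n, s % n - R, ⟨?_, by omega⟩, by omega⟩
    by_contra! hk
    have := Nat.mul_le_mul_left n hk
    omega
  · rintro ⟨l, j, ⟨hl, hj⟩, rfl⟩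
    have h1 : n * (l + 1) ≤ n * k := Nat.mul_le_mul_left n hl
    refine ⟨by rw [mul_add] at h1; omega, fun _ => ?_⟩
    rw [add_assoc, Nat.mul_add_mod, Nat.mod_eq_of_lt (by omega)]
    omega

lemma injOn_block {n R k : ℕ} :
    Set.InjOn (fun x : ℕ × ℕ => n * x.1 + R + x.2) (range k ×ˢ range (n - R) : Finset (ℕ × ℕ)) := by
  rintro ⟨l, j⟩ h ⟨l', j'⟩ h' heq
  simp only [Finset.coe_product, Set.mem_prod, Finset.mem_coe, Finset.mem_range] at h h' heq
  have hj : j < n := by omega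
  have hj' : j' < n := by omega
  have heq' : n * l + j = n * l' + j' := by omega
  have h1 := congrArg (· / n) heq'
  simp only [Nat.mul_add_div (show 0 < n by omega), Nat.div_eq_of_lt hj,
    Nat.div_eq_of_lt hj', add_zero] at h1
  subst h1
  simp only [Prod.mk.injEq, true_and]
  omega

lemma card_blockNodes {n R k : ℕ} (hR : R ≤ n) : (blockNodes n R k).card = R * (k + 1) := by
  have h1 : (range (n * k + R) \ blockNodes n R k).card = k * (n - R) := by
    rw [sdiff_blockNodes hR, Finset.card_image_of_injOn injOn_block]; simp
  rw [Finset.card_sdiff_of_subset (show blockNodes n R k ⊆ _ from Finset.filter_subset _ _),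
    Finset.card_range] at h1
  have h2 : (blockNodes n R k).card ≤ n * k + R := by
    simpa [blockNodes] using
      Finset.card_le_card (Finset.filter_subset (fun t => t % n < R) (range (n * k + R)))
  obtain ⟨m, rfl⟩ := Nat.exists_eq_add_of_le hR
  simp only [Nat.add_sub_cancel_left] at h1
  have : (R + m) * k + R = R * (k + 1) + k * m := by ring
  omega

lemma exists_int_eq_ddWeight_blockNodes {n R k t : ℕ} (hR0 : 0 < R) (hR : R ≤ n)
    (ht : t ∈ blockNodes n R k) :
    ∃ C : ℤ, (C : ℝ) = ((n * k + R - 1).factorial / (n - R).factorial ^ k : ℝ) *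
        ddWeight ℝ (blockNodes n R k) t ∧ |C| ≤ 2 ^ ((n * k + n) * (2 * k + 1)) := by
  have hsucc : n * k + R - 1 + 1 = n * k + R := by omega
  set H := n * k + R - 1 with hH
  have hT : blockNodes n R k ⊆ range (H + 1) := by
    rw [hsucc]; exact Finset.filter_subset _ _
  have htH : t ≤ H := Nat.lt_succ_iff.1 (Finset.mem_range.1 (hT ht))
  choose B hB hBle using fun l : ℕ =>
    exists_prod_sub_eq_factorial_mul ((t : ℤ) - (n * l + R)) (n - R)
  have hprod : ∏ s ∈ range (H + 1) \ blockNodes n R k, ((t : ℤ) - s) =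
      (n - R).factorial ^ k * ∏ l ∈ range k, B l := by
    rw [hsucc, sdiff_blockNodes hR, Finset.prod_image injOn_block, Finset.prod_product]
    have : ∀ l ∈ range k, ∏ y ∈ range (n - R), ((t : ℤ) - ((n * l + R + y : ℕ) : ℤ)) =
        (n - R).factorial * B l := by
      intro l _
      rw [← hB l]
      refine Finset.prod_congr rfl fun i _ => ?_
      push_cast
      ring
    rw [Finset.prod_congr rfl this, Finset.prod_mul_distrib, Finset.prod_const, Finset.card_range]
  refine ⟨(-1) ^ (H - t) * H.choose t * ∏ l ∈ range k, B l, ?_, ?_⟩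
  · have hk : (((n - R).factorial : ℝ)) ^ k ≠ 0 := by positivity
    have h := factorial_mul_ddWeight (F := ℝ) hT ht
    rw [hprod] at h
    rw [div_mul_eq_mul_div, h]
    push_cast
    field_simp
  · rw [abs_mul, abs_mul, abs_pow, abs_neg, abs_one, one_pow, one_mul, Nat.abs_cast,
      Finset.abs_prod]
    have h1 : ((H.choose t : ℕ) : ℤ) ≤ 2 ^ H := by exact_mod_cast Nat.choose_le_two_pow H t
    have h2 : ∏ l ∈ range k, |B l| ≤ ∏ _l ∈ range k, (2 : ℤ) ^ (2 * (n * k + n)) := by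
      refine Finset.prod_le_prod (fun _ _ => abs_nonneg _) fun l hl => (hBle l).trans ?_
      refine pow_le_pow_right₀ (by norm_num) ?_
      have h3 : n * (l + 1) ≤ n * k := Nat.mul_le_mul_left n (Finset.mem_range.1 hl)
      have h4 : n * (l + 1) = n * l + n := by ring
      have h5 : ((n * l : ℕ) : ℤ) = (n : ℤ) * l := by push_cast; ring
      rw [← h5]
      omega
    rw [Finset.prod_const, Finset.card_range, ← pow_mul] at h2
    calc ((H.choose t : ℕ) : ℤ) * ∏ l ∈ range k, |B l|
        ≤ 2 ^ H * 2 ^ (2 * (n * k + n) * k) :=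
          mul_le_mul h1 h2 (Finset.prod_nonneg fun _ _ => abs_nonneg _) (by positivity)
      _ ≤ 2 ^ (n * k + n) * 2 ^ (2 * (n * k + n) * k) := by
          gcongr
          · norm_num
          · omega
      _ = 2 ^ ((n * k + n) * (2 * k + 1)) := by rw [← pow_add]; ring_nf

lemma factorial_pow_mul_factorial_le (G N k : ℕ) :
    G.factorial ^ k * N.factorial ≤ (N + k * G).factorial := by
  induction k with
  | zero => simp
  | succ k ih =>
    calc G.factorial ^ (k + 1) * N.factorial = G.factorial * (G.factorial ^ k * N.factorial) := by
          ring
      _ ≤ G.factorial * (N + k * G).factorial := Nat.mul_le_mul_left _ ih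
      _ ≤ (G + (N + k * G)).factorial :=
          Nat.le_of_dvd (Nat.factorial_pos _) (Nat.factorial_mul_factorial_dvd_factorial_add _ _)
      _ = (N + (k + 1) * G).factorial := by congr 1; ring

lemma factorial_add_mul_le (G N k : ℕ) :
    (N + k * G).factorial ≤ 2 ^ ((N + k * G) * k) * (G.factorial ^ k * N.factorial) := by
  induction k with
  | zero => simp
  | succ k ih =>
    have h1 : (N + (k + 1) * G).factorial =
        (N + (k + 1) * G).choose G * G.factorial * (N + k * G).factorial := by
      have := Nat.choose_mul_factorial_mul_factorial (n := N + (k + 1) * G) (k := G)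
        (by nlinarith)
      rw [← this]
      congr 2
      have : N + (k + 1) * G = N + k * G + G := by ring
      omega
    rw [h1]
    calc (N + (k + 1) * G).choose G * G.factorial * (N + k * G).factorial
        ≤ 2 ^ (N + (k + 1) * G) * G.factorial *
          (2 ^ ((N + k * G) * k) * (G.factorial ^ k * N.factorial)) := by
          gcongr
          exact Nat.choose_le_two_pow _ _
      _ ≤ 2 ^ (N + (k + 1) * G) * G.factorial *
          (2 ^ ((N + (k + 1) * G) * k) * (G.factorial ^ k * N.factorial)) := by
          gcongr
          · norm_num
          · omega
      _ = 2 ^ ((N + (k + 1) * G) * (k + 1)) * (G.factorial ^ (k + 1) * N.factorial) := by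
          rw [mul_add_one (N + (k + 1) * G), pow_add]; ring

end IntegerWeights

end CubicThue

namespace CubicThue

section CloseSolutions

lemma cube_mul_hessian_eq (b c d x y : ℤ) :
    4 * ((b ^ 2 - 3 * c) * x + (b ^ 3 - 4 * b * c + 9 * d) * y) ^ 3 -
      9 * ((b ^ 2 - 3 * c) * x + (b ^ 3 - 4 * b * c + 9 * d) * y) * cubicDisc 1 b c d * y ^ 2 -
      27 * cubicDisc 1 b c d * cubicFormVal 1 b c d (x, y) =
    (2 * b ^ 3 - 9 * b * c + 27 * d) * ((2 * b ^ 3 - 9 * b * c + 27 * d) *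
      (cubicFormVal 1 b c d (x, y) -
        ((b ^ 2 - 3 * c) * x + (b ^ 3 - 4 * b * c + 9 * d) * y) * y ^ 2)
      + 4 * ((b ^ 2 - 3 * c) * x + (b ^ 3 - 4 * b * c + 9 * d) * y) ^ 2 * y
      - 4 * y ^ 3 * cubicDisc 1 b c d) := by
  simp only [cubicDisc, cubicFormVal]
  ring

variable {b c d x y : ℤ} {α p q : ℝ}

lemma cubicDisc_eq_mul_sq (hb : (b : ℝ) = p - α) (hc : (c : ℝ) = q - p * α)
    (hd : (d : ℝ) = -q * α) :
    (cubicDisc 1 b c d : ℝ) = (p ^ 2 - 4 * q) * (α ^ 2 + p * α + q) ^ 2 := by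
  simp only [cubicDisc]
  push_cast
  rw [hb, hc, hd]
  ring

lemma lt_two_of_bounds {a A B w Y : ℝ} (ha : 1000 ≤ a) (hA : 0 < A)
    (h1 : -0.001 ≤ A - a ^ 2) (h2 : A - a ^ 2 ≤ 0.001)
    (h3 : (1 - 0.03) * B ^ 2 ≤ 0.55 * (2 * a ^ 4 + 1)) (h4 : w * B ^ 2 ≤ 1.1 * A)
    (h5 : 0.8 * a ^ 2 ≤ B) (h6 : Y * A ≤ B + a * w) : Y < 2 := by
  have ha3 : (0 : ℝ) < a ^ 3 := by positivity
  have ha4 : 1000 * a ^ 3 ≤ a ^ 4 := by nlinarith only [ha, ha3]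
  have ha2 : 1000 * a ≤ a ^ 2 := by nlinarith only [ha]
  have ha23 : 1000 * a ^ 2 ≤ a ^ 3 := by nlinarith only [ha, ha2, sq_nonneg a]
  have hB2 : 0.64 * a ^ 4 ≤ B ^ 2 := by
    calc 0.64 * a ^ 4 = (0.8 * a ^ 2) ^ 2 := by ring
      _ ≤ B ^ 2 := by gcongr
  have hBup : B ≤ 1.1 * a ^ 2 := by
    by_contra! hcon
    have h5 : (1.1 * a ^ 2) ^ 2 < B ^ 2 := by gcongr
    linarith [show (1.1 * a ^ 2) ^ 2 = 1.21 * a ^ 4 by ring]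
  have haw : a * w ≤ 1 := by
    have h7 : a * w * B ^ 2 ≤ 1 * B ^ 2 := by
      calc a * w * B ^ 2 = a * (w * B ^ 2) := by ring
        _ ≤ a * (1.1 * A) := by gcongr
        _ ≤ a * (1.1 * (a ^ 2 + 0.001)) := by gcongr; linarith
        _ = 1.1 * a ^ 3 + 0.0011 * a := by ring
        _ ≤ 1 * B ^ 2 := by linarith
    exact le_of_mul_le_mul_right h7 (by linarith)
  by_contra! hY
  have h8 : 2 * A ≤ Y * A := by gcongr
  linarith

set_option maxHeartbeats 1000000 in
lemma not_solution_of_abs_le_pow_five (hb : (b : ℝ) = p - α) (hc : (c : ℝ) = q - p * α)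
    (hd : (d : ℝ) = -q * α) (hD : 1000 ≤ |(cubicDisc 1 b c d : ℝ)|)
    (hF : |cubicFormVal 1 b c d (x, y)| = 1)
    (h1 : ((p + 2 * α) / 2) ^ 2 ≤ 1.1 * |α ^ 2 + p * α + q|)
    (h2 : |x - α * y| * (((p + 2 * α) * x + (2 * q + p * α) * y) / 2) ^ 2 ≤
      1.1 * |α ^ 2 + p * α + q|)
    (hlow : |(cubicDisc 1 b c d : ℝ)| ^ 7 ≤ |(p + 2 * α) / 2|)
    (hgap : 0.8 * ((p + 2 * α) / 2) ^ 2 ≤ |((p + 2 * α) * x + (2 * q + p * α) * y) / 2|)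
    (hup : 100 * |(cubicDisc 1 b c d : ℝ)| * |((p + 2 * α) * x + (2 * q + p * α) * y) / 2| ≤
      |(p + 2 * α) / 2| ^ 5) : False := by
  have hDeq := cubicDisc_eq_mul_sq hb hc hd
  set E : ℝ := p ^ 2 - 4 * q with hE
  set Q : ℝ := α ^ 2 + p * α + q with hQ
  set m₁ : ℝ := (p + 2 * α) / 2 with hm₁
  set m₂ : ℝ := ((p + 2 * α) * x + (2 * q + p * α) * y) / 2 with hm₂
  set u : ℝ := x - α * y with hu
  set e : ℤ := (b ^ 2 - 3 * c) * x + (b ^ 3 - 4 * b * c + 9 * d) * y with he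
  set X : ℝ := |(cubicDisc 1 b c d : ℝ)| with hX
  have hXeq : X = |E| * |Q| ^ 2 := by rw [hX, hDeq, abs_mul, abs_pow]
  have hQe : Q * e = 2 * E * m₁ * m₂ + (u / 2) * (2 * m₁ ^ 4 - 3 * E * m₁ ^ 2 - 3 / 8 * E ^ 2) := by
    rw [he]; push_cast; rw [hb, hc, hd, hE, hQ, hm₁, hm₂, hu]; ring
  have hQm : Q = m₁ ^ 2 - E / 4 := by rw [hQ, hm₁, hE]; ring
  have hyQ : y * Q = m₂ - m₁ * u := by rw [hQ, hm₁, hm₂, hu]; ring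
  have hG : ((2 * b ^ 3 - 9 * b * c + 27 * d : ℤ) : ℝ) = -(2 * m₁ ^ 3 - 9 / 2 * E * m₁) := by
    push_cast; rw [hb, hc, hd, hm₁, hE]; ring
  set a := |m₁| with ha
  set B := |m₂| with hB
  set w := |u| with hw
  set A := |Q| with hA
  have ha2 : m₁ ^ 2 = a ^ 2 := (sq_abs m₁).symm
  have hB2 : m₂ ^ 2 = B ^ 2 := (sq_abs m₂).symm
  rw [ha2] at h1 hgap
  rw [hB2] at h2
  have hX1 : X ≤ X ^ 7 := le_self_pow₀ (by linarith) (by norm_num)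
  have haX : X ≤ a := hX1.trans hlow
  have ha1000 : 1000 ≤ a := hD.trans haX
  have hw0 : 0 ≤ w := abs_nonneg _
  have hB0 : 0 ≤ B := abs_nonneg _
  have hE0 : 0 ≤ |E| := abs_nonneg _
  have ha2X : X * 1000 ≤ a ^ 2 := by nlinarith only [haX, ha1000, hD]
  have hBpos : 0.8 * a ^ 2 ≤ B := hgap
  have hApos : 0 < A := by nlinarith only [h1, ha1000]
  -- the quadratic field discriminant is tiny
  have hEa : |E| * a ^ 4 ≤ 1.21 * X := by
    rw [hXeq]
    have : a ^ 4 ≤ 1.21 * A ^ 2 := by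
      calc a ^ 4 = (a ^ 2) ^ 2 := by ring
        _ ≤ (1.1 * A) ^ 2 := by gcongr
        _ = 1.21 * A ^ 2 := by ring
    calc |E| * a ^ 4 ≤ |E| * (1.21 * A ^ 2) := by gcongr
      _ = 1.21 * (|E| * A ^ 2) := by ring
  have hEa2 : |E| * a ^ 2 ≤ 0.002 := by
    have : |E| * a ^ 2 * (a ^ 2) ≤ 0.002 * a ^ 2 := by nlinarith only [hEa, ha2X]
    exact le_of_mul_le_mul_right this (by positivity)
  have hEsmall : |E| ≤ 0.001 := by nlinarith only [hEa2, hE0, ha1000]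
  have hAm : |A - a ^ 2| ≤ 0.001 := by
    rw [hA, ← abs_of_nonneg (sq_nonneg a), ← ha2]
    refine (abs_abs_sub_abs_le _ _).trans ?_
    rw [hQm, sub_sub_cancel_left, abs_neg, abs_div]
    norm_num
    linarith
  have hAlow : a ^ 2 - 0.001 ≤ A := by linarith [(abs_le.1 hAm).1]
  -- bounds for `e`
  have hAe : A * |(e : ℝ)| ≤ 2 * |E| * a * B + w / 2 * (2 * a ^ 4 + 1) := by
    rw [hA, ← abs_mul, hQe]
    refine (abs_add_le _ _).trans (add_le_add ?_ ?_)
    · rw [abs_mul, abs_mul, abs_mul, abs_two]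
    · rw [abs_mul, abs_div, abs_two]
      refine mul_le_mul_of_nonneg_left ?_ (by positivity)
      have e1 : m₁ ^ 4 = a ^ 4 := by rw [show m₁ ^ 4 = (m₁ ^ 2) ^ 2 by ring, ha2]; ring
      rw [e1, ha2]
      have hEl := neg_abs_le E
      have hEu := le_abs_self E
      have hE2 : E ^ 2 ≤ 0.001 := by rw [← sq_abs]; nlinarith only [hEsmall, hE0]
      have hEaa : |E * a ^ 2| ≤ 0.002 := by
        rw [abs_mul, abs_of_nonneg (sq_nonneg a)]; exact hEa2
      obtain ⟨h3, h4⟩ := abs_le.1 hEaa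
      rw [abs_le]
      have h5 := pow_pos (show (0 : ℝ) < a by linarith) 4
      have h6 := sq_nonneg E
      constructor <;> linarith
  have hfirst : 2 * |E| * a * B ≤ 0.03 * A := by
    have h3 : 2 * |E| * a * B * (100 * a ^ 3) ≤ 0.03 * A * (100 * a ^ 3) := by
      calc 2 * |E| * a * B * (100 * a ^ 3) = 200 * (|E| * a ^ 4) * B := by ring
        _ ≤ 200 * (1.21 * X) * B := by gcongr
        _ = 2.42 * (100 * X * B) := by ring
        _ ≤ 2.42 * a ^ 5 := by gcongr
        _ = 2.42 * a ^ 2 * a ^ 3 := by ring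
        _ ≤ 2.42 * (1.1 * A) * a ^ 3 := by gcongr
        _ ≤ 0.03 * A * (100 * a ^ 3) := by
          have h4 := pow_pos (show (0 : ℝ) < a by linarith) 3
          nlinarith only [h4, hApos, mul_pos hApos h4]
    exact le_of_mul_le_mul_right h3 (by positivity)
  have heB : (|(e : ℝ)| - 0.03) * B ^ 2 ≤ 0.55 * (2 * a ^ 4 + 1) := by
    have h3 : A * ((|(e : ℝ)| - 0.03) * B ^ 2) ≤ A * (0.55 * (2 * a ^ 4 + 1)) := by
      calc A * ((|(e : ℝ)| - 0.03) * B ^ 2) = (A * |(e : ℝ)| - 0.03 * A) * B ^ 2 := by ring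
        _ ≤ (w / 2 * (2 * a ^ 4 + 1)) * B ^ 2 := by gcongr; linarith
        _ = (w * B ^ 2) * (1 / 2 * (2 * a ^ 4 + 1)) := by ring
        _ ≤ (1.1 * A) * (1 / 2 * (2 * a ^ 4 + 1)) := by gcongr
        _ = A * (0.55 * (2 * a ^ 4 + 1)) := by ring
    exact le_of_mul_le_mul_left h3 hApos
  have ha4 : (1000 : ℝ) ≤ a ^ 4 := by
    calc (1000 : ℝ) ≤ a := ha1000
      _ ≤ a ^ 4 := le_self_pow₀ (by linarith) (by norm_num)
  have hB2low : 0.64 * a ^ 4 ≤ B ^ 2 := by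
    calc 0.64 * a ^ 4 = (0.8 * a ^ 2) ^ 2 := by ring
      _ ≤ B ^ 2 := by gcongr
  have he1 : |e| ≤ 1 := by
    by_contra! h
    have h3 : (2 : ℝ) ≤ |(e : ℝ)| := by exact_mod_cast h
    nlinarith only [h3, heB, hB2low, ha4]
  have hGlow : a ^ 3 ≤ |((2 * b ^ 3 - 9 * b * c + 27 * d : ℤ) : ℝ)| := by
    rw [hG, abs_neg]
    have h3 : |2 * m₁ ^ 3| = 2 * a ^ 3 := by rw [abs_mul, abs_pow, abs_two]
    have h4 : |9 / 2 * E * m₁| = 9 / 2 * |E| * a := by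
      rw [abs_mul, abs_mul, abs_of_pos (by norm_num : (0 : ℝ) < 9 / 2)]
    have h5 := abs_sub_abs_le_abs_sub (2 * m₁ ^ 3) (9 / 2 * E * m₁)
    rw [h3, h4] at h5
    have h6 : |E| * a ≤ |E| * a ^ 2 := by
      gcongr
      exact le_self_pow₀ (by linarith) (by norm_num)
    have h7 : (1 : ℝ) ≤ a ^ 3 := one_le_pow₀ (by linarith)
    linarith
  have hXG : 36 * X + 4 < |((2 * b ^ 3 - 9 * b * c + 27 * d : ℤ) : ℝ)| := by
    refine lt_of_lt_of_le ?_ hGlow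
    nlinarith only [ha2X, haX, ha1000, hD]
  have hdvd : (2 * b ^ 3 - 9 * b * c + 27 * d) ∣
      4 * e ^ 3 - 9 * e * cubicDisc 1 b c d * y ^ 2 -
        27 * cubicDisc 1 b c d * cubicFormVal 1 b c d (x, y) :=
    Dvd.intro _ (cube_mul_hessian_eq b c d x y).symm
  have hlt : ∀ z : ℤ, (2 * b ^ 3 - 9 * b * c + 27 * d) ∣ z → |(z : ℝ)| ≤ 36 * X + 4 → z = 0 := by
    intro z hz hzle
    refine Int.eq_zero_of_abs_lt_dvd ((abs_dvd _ _).2 hz) ?_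
    have : |(z : ℝ)| < |((2 * b ^ 3 - 9 * b * c + 27 * d : ℤ) : ℝ)| := hzle.trans_lt hXG
    exact_mod_cast this
  have hFD : |27 * (cubicDisc 1 b c d : ℝ) * (cubicFormVal 1 b c d (x, y) : ℝ)| = 27 * X := by
    have : |(cubicFormVal 1 b c d (x, y) : ℝ)| = 1 := by exact_mod_cast hF
    rw [abs_mul, this, abs_mul, mul_one, abs_of_pos (by norm_num : (0 : ℝ) < 27)]
  have hDne : cubicDisc 1 b c d ≠ 0 := by
    intro h
    rw [h] at hX
    simp at hX
    linarith
  have hFne : cubicFormVal 1 b c d (x, y) ≠ 0 := by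
    intro h
    rw [h] at hF
    simp at hF
  rcases eq_or_ne e 0 with h0 | h0
  · have h3 := hlt _ hdvd (by
      rw [h0]
      push_cast
      rw [zero_mul, zero_mul, sub_zero, zero_sub, abs_neg, hFD]
      linarith)
    rw [h0] at h3
    have : cubicDisc 1 b c d * cubicFormVal 1 b c d (x, y) = 0 := by linarith
    rcases mul_eq_zero.1 this with h | h
    · exact hDne h
    · exact hFne h
  · have hepos : 1 ≤ |e| := Int.one_le_abs h0
    have heabs : |e| = 1 := le_antisymm he1 hepos
    have heabs' : |(e : ℝ)| = 1 := by exact_mod_cast heabs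
    have hy1 : |y| ≤ 1 := by
      by_contra! h
      have h3 : (2 : ℝ) ≤ |(y : ℝ)| := by exact_mod_cast h
      have h4 : |(y : ℝ)| * A ≤ B + a * w := by
        rw [hA, ← abs_mul, hyQ, ← abs_mul]
        exact abs_sub _ _
      rw [heabs'] at heB
      exact absurd h3 (not_le.2 (lt_two_of_bounds ha1000 hApos (abs_le.1 hAm).1
        (abs_le.1 hAm).2 heB h2 hBpos h4))
    have hysq : (y : ℝ) ^ 2 ≤ 1 := by
      rw [sq_le_one_iff_abs_le_one]
      exact_mod_cast hy1
    have h3 := hlt _ hdvd (by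
      push_cast
      refine (abs_sub _ _).trans ?_
      rw [hFD]
      have h4 : |4 * (e : ℝ) ^ 3 - 9 * e * (cubicDisc 1 b c d : ℝ) * y ^ 2| ≤ 4 + 9 * X := by
        refine (abs_sub _ _).trans (add_le_add ?_ ?_)
        · rw [abs_mul, abs_pow, heabs']; norm_num
        · rw [abs_mul, abs_mul, abs_mul, heabs', abs_of_nonneg (sq_nonneg (y : ℝ))]
          rw [mul_one, abs_of_pos (by norm_num : (0 : ℝ) < 9)]
          exact mul_le_of_le_one_right (by positivity) hysq
      linarith)
    have h9 : (9 : ℤ) ∣ 4 * e ^ 3 :=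
      ⟨e * cubicDisc 1 b c d * y ^ 2 +
        3 * cubicDisc 1 b c d * cubicFormVal 1 b c d (x, y), by linarith⟩
    rcases (abs_eq zero_le_one).1 heabs with h | h <;> rw [h] at h9 <;> omega

end CloseSolutions

end CubicThue

namespace CubicThue
open Finset Polynomial

section Pade

/-- The integers in `[0, 3 * r + δ]` congruent to `0` or `δ` modulo `3`. -/
def padeNodes (δ r : ℕ) : Finset ℕ :=
  (range (3 * r + δ + 1)).filter (fun t => t % 3 = 0 ∨ t % 3 = δ)

variable {δ r : ℕ}

lemma padeNodes_succ (hδ : δ = 1 ∨ δ = 2) :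
    padeNodes δ (r + 1) = insert (3 * (r + 1)) (insert (3 * (r + 1) + δ) (padeNodes δ r)) := by
  ext t
  simp only [padeNodes, mem_filter, mem_range, mem_insert]
  omega

lemma sum_padeNodes {M : Type*} [AddCommMonoid M] (hδ : δ = 1 ∨ δ = 2) (f : ℕ → M) :
    ∑ t ∈ padeNodes δ r, f t = ∑ j ∈ range (r + 1), (f (3 * j) + f (3 * j + δ)) := by
  induction r with
  | zero =>
    rcases hδ with rfl | rfl
    · rw [show padeNodes 1 0 = {0, 1} by decide]; simp
    · rw [show padeNodes 2 0 = {0, 2} by decide]; simp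
  | succ r ih =>
    rw [padeNodes_succ hδ, sum_insert, sum_insert, ih, sum_range_succ _ (r + 1), ← add_assoc,
      add_comm]
    · simp only [padeNodes, mem_filter, mem_range]
      omega
    · simp only [padeNodes, mem_filter, mem_range, mem_insert]
      omega

lemma card_padeNodes (hδ : δ = 1 ∨ δ = 2) : (padeNodes δ r).card = 2 * r + 2 := by
  rw [card_eq_sum_ones, sum_padeNodes hδ]
  simp
  ring

lemma range_sdiff_padeNodes (hδ : δ = 1 ∨ δ = 2) :
    range (3 * r + δ + 1) \ padeNodes δ r =
      (range (r + δ - 1)).image (fun i => (3 - δ) + 3 * i) := by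
  ext t
  simp only [padeNodes, mem_sdiff, mem_filter, mem_range, mem_image]
  constructor
  · intro h
    exact ⟨t / 3, by omega, by omega⟩
  · rintro ⟨i, hi, rfl⟩
    omega

lemma exists_int_eq_ddWeight_padeNodes (hδ : δ = 1 ∨ δ = 2) (hr : 1 ≤ r) {t : ℕ}
    (ht : t ∈ padeNodes δ r) :
    ∃ C : ℤ, (C : ℂ) = ((3 * r + δ).factorial * 3 ^ (r + δ - 1) / (r + δ - 1).factorial : ℂ) *
      ddWeight ℂ (padeNodes δ r) t ∧
      |C| ≤ 2 ^ (3 * r + δ) * (9 ^ (r + δ - 1) * 2 ^ (3 * r + δ + (r + δ - 1))) :=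
  exists_int_eq_ddWeight_of_sdiff_progression (filter_subset _ _) (range_sdiff_padeNodes hδ)
    (by omega) ht

lemma ddWeight_reflect {F : Type*} [Field F] {T : Finset ℕ} {n t : ℕ}
    (hT : ∀ s ∈ T, s ≤ n ∧ n - s ∈ T) (ht : t ∈ T) :
    ddWeight F T (n - t) = (-1) ^ (T.card - 1) * ddWeight F T t := by
  rw [ddWeight_eq_inv_prod, ddWeight_eq_inv_prod]
  have h : ∏ s ∈ T.erase (n - t), (((n - t : ℕ) : F) - s) =
      ∏ s ∈ T.erase t, (-1) * ((t : F) - s) := by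
    refine prod_nbij' (fun s => n - s) (fun s => n - s) ?_ ?_ ?_ ?_ ?_
    · intro s hs
      rw [mem_erase] at hs ⊢
      have := (hT s hs.2).1; have := (hT t ht).1
      exact ⟨by omega, (hT s hs.2).2⟩
    · intro s hs
      rw [mem_erase] at hs ⊢
      have := (hT s hs.2).1; have := (hT t ht).1
      exact ⟨by omega, (hT s hs.2).2⟩
    · intro s hs
      have := (hT s (mem_of_mem_erase hs)).1
      omega
    · intro s hs
      have := (hT s (mem_of_mem_erase hs)).1
      omega
    · intro s hs
      rw [Nat.cast_sub (hT t ht).1, Nat.cast_sub (hT s (mem_of_mem_erase hs)).1]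
      ring
  rw [h, prod_mul_distrib, prod_const, card_erase_of_mem ht, mul_inv, ← inv_pow]
  norm_num

lemma ddWeight_padeNodes_reflect (hδ : δ = 1 ∨ δ = 2) {j : ℕ} (hj : j ≤ r) :
    ddWeight ℂ (padeNodes δ r) (3 * (r - j) + δ) = -ddWeight ℂ (padeNodes δ r) (3 * j) := by
  have h := ddWeight_reflect (F := ℂ) (T := padeNodes δ r) (n := 3 * r + δ) (t := 3 * j)
    (by
      simp only [padeNodes, mem_filter, mem_range]
      omega)
    (by
      simp only [padeNodes, mem_filter, mem_range]
      omega)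
  rw [card_padeNodes hδ, show 2 * r + 2 - 1 = 2 * r + 1 by omega, pow_succ, pow_mul] at h
  rw [show 3 * (r - j) + δ = 3 * r + δ - 3 * j by omega, h]
  norm_num

/-- The linear combination of `μ` and `ν` whose coefficients are the Padé numerator and denominator
of the cube root, homogenised in `(ξ, η)`. -/
noncomputable def padeForm (δ r : ℕ) (μ ν ξ η : ℂ) : ℂ :=
  μ * ∑ j ∈ range (r + 1),
      ddWeight ℂ (padeNodes δ r) (3 * j) * (ξ ^ (3 * (r - j) + δ) * η ^ (3 * j)) +
    ν * ∑ j ∈ range (r + 1),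
      ddWeight ℂ (padeNodes δ r) (3 * j + δ) * (ξ ^ (3 * (r - j)) * η ^ (3 * j + δ))

lemma padeForm_eq_sum_sub (hδ : δ = 1 ∨ δ = 2) (μ ν ξ η : ℂ) :
    padeForm δ r μ ν ξ η = ∑ j ∈ range (r + 1), ddWeight ℂ (padeNodes δ r) (3 * j) *
      ((μ * ξ ^ δ) * (ξ ^ 3) ^ (r - j) * (η ^ 3) ^ j -
        (ν * η ^ δ) * (η ^ 3) ^ (r - j) * (ξ ^ 3) ^ j) := by
  have h : ∑ j ∈ range (r + 1),
      ddWeight ℂ (padeNodes δ r) (3 * j + δ) * (ξ ^ (3 * (r - j)) * η ^ (3 * j + δ)) =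
      ∑ j ∈ range (r + 1),
        -ddWeight ℂ (padeNodes δ r) (3 * j) * (ξ ^ (3 * j) * η ^ (3 * (r - j) + δ)) := by
    rw [← sum_range_reflect]
    refine sum_congr rfl fun j hj => ?_
    have hj' : j ≤ r := by rw [mem_range] at hj; omega
    rw [show r + 1 - 1 - j = r - j by omega, ddWeight_padeNodes_reflect hδ hj',
      show r - (r - j) = j by omega]
  rw [padeForm, h, mul_sum, mul_sum, ← sum_add_distrib]
  refine sum_congr rfl fun j _ => ?_
  rw [← pow_mul, ← pow_mul, ← pow_mul, ← pow_mul, pow_add, pow_add]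
  ring

end Pade

end CubicThue

namespace CubicThue
open Finset Polynomial

section PadeProperties

/-- `z` and `z'` are conjugate elements `(a ± k w) / 2` of the quadratic order of discriminant `D`,
where `w` is a square root of `-3 D`. -/
def IsConjPair (D : ℤ) (w z z' : ℂ) : Prop :=
  ∃ a k : ℤ, z = (a + k * w) / 2 ∧ z' = (a - k * w) / 2 ∧ (2 : ℤ) ∣ a - k * D

variable {D : ℤ} {w : ℂ}

lemma IsConjPair.symm {z z' : ℂ} (h : IsConjPair D w z z') : IsConjPair D w z' z := by
  obtain ⟨a, k, rfl, rfl, h⟩ := h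
  refine ⟨a, -k, ?_, ?_, ?_⟩
  · push_cast; ring
  · push_cast; ring
  · rw [show a - -k * D = a - k * D + 2 * (k * D) by ring]
    exact dvd_add h (dvd_mul_right _ _)

lemma IsConjPair.one : IsConjPair D w 1 1 := ⟨2, 0, by norm_num, by norm_num, by norm_num⟩

lemma IsConjPair.mul (hw : w ^ 2 = -3 * D) (hD : (4 : ℤ) ∣ D * (D - 1)) {y y' z z' : ℂ}
    (hy : IsConjPair D w y y') (hz : IsConjPair D w z z') :
    IsConjPair D w (y * z) (y' * z') := by
  obtain ⟨a, k, rfl, rfl, e, he⟩ := hy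
  obtain ⟨b, l, rfl, rfl, f, hf⟩ := hz
  obtain ⟨g, hg⟩ := hD
  have ha : a = k * D + 2 * e := by linarith
  have hb : b = l * D + 2 * f := by linarith
  have hg' : (D : ℂ) * (D - 1) = 4 * g := by exact_mod_cast hg
  refine ⟨2 * (k * l * g) - D * k * l + f * k * D + e * l * D + 2 * e * f,
    k * l * D + e * l + f * k, ?_, ?_, k * l * g + e * f - k * l * (2 * g + D), ?_⟩
  · rw [ha, hb]; push_cast
    linear_combination (k * l / 4 : ℂ) * hw + (k * l / 4 : ℂ) * hg'
  · rw [ha, hb]; push_cast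
    linear_combination (k * l / 4 : ℂ) * hw + (k * l / 4 : ℂ) * hg'
  · linear_combination (-k * l) * hg

lemma IsConjPair.pow (hw : w ^ 2 = -3 * D) (hD : (4 : ℤ) ∣ D * (D - 1)) {z z' : ℂ}
    (hz : IsConjPair D w z z') (n : ℕ) : IsConjPair D w (z ^ n) (z' ^ n) := by
  induction n with
  | zero => simpa using IsConjPair.one
  | succ n ih => rw [pow_succ, pow_succ]; exact ih.mul hw hD hz

lemma IsConjPair.exists_sub_eq {z z' : ℂ} (h : IsConjPair D w z z') :
    ∃ k : ℤ, z - z' = k * w := by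
  obtain ⟨a, k, rfl, rfl, -⟩ := h
  exact ⟨k, by ring⟩

variable {δ r : ℕ} {μ ν ξ η : ℂ}

lemma norm_le_norm_padeForm (hδ : δ = 1 ∨ δ = 2) (hr : 1 ≤ r) (hw : w ^ 2 = -3 * D)
    (hD : (4 : ℤ) ∣ D * (D - 1)) (h3 : IsConjPair D w (ξ ^ 3) (η ^ 3))
    (hμν : IsConjPair D w (μ * ξ ^ δ) (ν * η ^ δ)) (h0 : padeForm δ r μ ν ξ η ≠ 0) :
    ‖w‖ ≤ ((3 * r + δ).factorial * 3 ^ (r + δ - 1) / (r + δ - 1).factorial : ℝ) *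
      ‖padeForm δ r μ ν ξ η‖ := by
  set M : ℝ := (3 * r + δ).factorial * 3 ^ (r + δ - 1) / (r + δ - 1).factorial with hM
  have hMpos : 0 < M := by positivity
  have hint : ∀ j ∈ range (r + 1), ∃ k : ℤ,
      (M : ℂ) * (ddWeight ℂ (padeNodes δ r) (3 * j) *
      ((μ * ξ ^ δ) * (ξ ^ 3) ^ (r - j) * (η ^ 3) ^ j -
        (ν * η ^ δ) * (η ^ 3) ^ (r - j) * (ξ ^ 3) ^ j)) = k * w := by
    intro j hj
    obtain ⟨C, hC, -⟩ := exists_int_eq_ddWeight_padeNodes hδ hr (t := 3 * j) (by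
      simp only [padeNodes, mem_filter, mem_range] at hj ⊢
      omega)
    obtain ⟨k, hk⟩ := ((hμν.mul hw hD (h3.pow hw hD (r - j))).mul hw hD
      (h3.symm.pow hw hD j)).exists_sub_eq
    refine ⟨C * k, ?_⟩
    rw [hk, hM]
    push_cast
    rw [hC]
    ring
  choose! k hk using hint
  have hsum : (M : ℂ) * padeForm δ r μ ν ξ η = ((∑ j ∈ range (r + 1), k j : ℤ) : ℂ) * w := by
    rw [padeForm_eq_sum_sub hδ, mul_sum, sum_congr rfl hk]
    push_cast
    rw [sum_mul]
  have hne : (∑ j ∈ range (r + 1), k j : ℤ) ≠ 0 := by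
    intro h
    rw [h, Int.cast_zero, zero_mul, mul_eq_zero] at hsum
    exact hsum.elim (by exact_mod_cast hMpos.ne') h0
  have hnorm := congrArg norm hsum
  rw [norm_mul, norm_mul, Complex.norm_real, Real.norm_of_nonneg hMpos.le] at hnorm
  rw [hnorm]
  refine le_mul_of_one_le_left (norm_nonneg _) ?_
  rw [Complex.norm_intCast]
  exact_mod_cast Int.one_le_abs hne

/-- The coefficient polynomials of the Padé form. -/
noncomputable def padePoly (δ r i : ℕ) : ℂ[X] :=
  ∑ j ∈ range (r + 1), C (ddWeight ℂ (padeNodes δ r) (3 * j + i)) * X ^ j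

lemma natDegree_padePoly_le (δ r i : ℕ) : (padePoly δ r i).natDegree ≤ r :=
  natDegree_sum_le_of_forall_le _ _ fun j hj =>
    (natDegree_C_mul_X_pow_le _ _).trans (by rw [mem_range] at hj; omega)

lemma coeff_zero_padePoly (δ r i : ℕ) :
    (padePoly δ r i).coeff 0 = ddWeight ℂ (padeNodes δ r) i := by
  rw [padePoly, finsetSum_coeff, sum_range_succ']
  simp

lemma X_sub_one_pow_dvd_padePoly (hδ : δ = 1 ∨ δ = 2) :
    (X - C 1 : ℂ[X]) ^ (2 * r + 1) ∣
      expand ℂ 3 (padePoly δ r 0) + X ^ δ * expand ℂ 3 (padePoly δ r δ) := by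
  have h := X_sub_one_pow_dvd_sum_ddWeight (F := ℂ) (padeNodes δ r)
  rw [card_padeNodes hδ, sum_padeNodes hδ, sum_add_distrib] at h
  have h0 : expand ℂ 3 (padePoly δ r 0) =
      ∑ j ∈ range (r + 1), C (ddWeight ℂ (padeNodes δ r) (3 * j)) * X ^ (3 * j) := by
    rw [padePoly, map_sum]
    refine sum_congr rfl fun j _ => ?_
    simp [pow_mul]
  have h1 : X ^ δ * expand ℂ 3 (padePoly δ r δ) =
      ∑ j ∈ range (r + 1), C (ddWeight ℂ (padeNodes δ r) (3 * j + δ)) * X ^ (3 * j + δ) := by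
    rw [padePoly, map_sum, mul_sum]
    refine sum_congr rfl fun j _ => ?_
    simp [pow_mul, pow_add]
    ring
  rw [h0, h1]
  exact h

lemma padeForm_eq_eval (hξ : ξ ≠ 0) :
    padeForm δ r μ ν ξ η = ξ ^ (3 * r + δ) *
      (μ * (padePoly δ r 0).eval ((η / ξ) ^ 3) +
        ν * (η / ξ) ^ δ * (padePoly δ r δ).eval ((η / ξ) ^ 3)) := by
  have h0 : ∑ j ∈ range (r + 1),
      ddWeight ℂ (padeNodes δ r) (3 * j) * (ξ ^ (3 * (r - j) + δ) * η ^ (3 * j)) =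
      ξ ^ (3 * r + δ) * (padePoly δ r 0).eval ((η / ξ) ^ 3) := by
    rw [padePoly, eval_finsetSum, mul_sum]
    refine sum_congr rfl fun j hj => ?_
    rw [mem_range] at hj
    rw [show 3 * r + δ = 3 * (r - j) + δ + 3 * j by omega, pow_add ξ _ (3 * j)]
    simp only [eval_mul, eval_C, eval_pow, eval_X, add_zero, ← pow_mul, div_pow]
    field_simp
  have h1 : ∑ j ∈ range (r + 1),
      ddWeight ℂ (padeNodes δ r) (3 * j + δ) * (ξ ^ (3 * (r - j)) * η ^ (3 * j + δ)) =
      ξ ^ (3 * r + δ) * ((η / ξ) ^ δ * (padePoly δ r δ).eval ((η / ξ) ^ 3)) := by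
    rw [padePoly, eval_finsetSum, mul_sum, mul_sum]
    refine sum_congr rfl fun j hj => ?_
    rw [mem_range] at hj
    rw [show 3 * r + δ = 3 * (r - j) + (3 * j + δ) by omega, pow_add ξ _ (3 * j + δ),
      pow_add ξ, pow_add η]
    simp only [eval_mul, eval_C, eval_pow, eval_X, ← pow_mul, div_pow]
    field_simp
  rw [padeForm, h0, h1]
  ring

/-- A polynomial `w` of degree at most `m` with `(X - 1)^m ∣ w(X³)` has no root besides `1`. -/
lemma eq_one_of_dvd_expand {P : ℂ[X]} {m : ℕ} (hP : P ≠ 0) (hdeg : P.natDegree ≤ m)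
    (hdvd : (X - C 1 : ℂ[X]) ^ m ∣ expand ℂ 3 P) {z : ℂ} (hz : P.eval z = 0) : z = 1 := by
  have hmul : (X - C 1 : ℂ[X]) ^ m ∣ P := by
    obtain ⟨G, hG, hG1⟩ := exists_eq_pow_rootMultiplicity_mul_and_not_dvd P hP 1
    set l := rootMultiplicity 1 P
    suffices m ≤ l by
      rw [hG]; exact dvd_mul_of_dvd_left (pow_dvd_pow _ this) _
    by_contra! hlt
    have h1 : expand ℂ 3 P = (X - C 1) ^ l * ((X ^ 2 + X + 1) ^ l * expand ℂ 3 G) := by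
      conv_lhs => rw [hG]
      rw [map_mul, map_pow, map_sub, expand_X, expand_C, ← mul_assoc, ← mul_pow]
      congr 2
      rw [C_1]; ring
    rw [h1] at hdvd
    have h2 : (X - C 1 : ℂ[X]) ^ l * (X - C 1) ∣
        (X - C 1) ^ l * ((X ^ 2 + X + 1) ^ l * expand ℂ 3 G) := by
      rw [← pow_succ]; exact (pow_dvd_pow _ hlt).trans hdvd
    have h3 := (mul_dvd_mul_iff_left (pow_ne_zero l (X_sub_C_ne_zero (1 : ℂ)))).1 h2
    rw [dvd_iff_isRoot, IsRoot.def] at h3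
    rw [dvd_iff_isRoot, IsRoot.def] at hG1
    simp only [eval_mul, eval_pow, eval_add, eval_X, eval_one, expand_eval, one_pow] at h3
    norm_num at h3
    exact hG1 h3
  obtain ⟨G, rfl⟩ := hmul
  have hG : G ≠ 0 := right_ne_zero_of_mul hP
  rw [natDegree_mul (pow_ne_zero _ (X_sub_C_ne_zero _)) hG, natDegree_pow, natDegree_X_sub_C,
    mul_one] at hdeg
  obtain ⟨c, rfl⟩ := natDegree_eq_zero.1 (show G.natDegree = 0 by omega)
  rw [eval_mul, eval_pow, eval_sub, eval_X, eval_C, eval_C] at hz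
  rcases mul_eq_zero.1 hz with h | h
  · exact sub_eq_zero.1 (eq_zero_of_pow_eq_zero h)
  · exact absurd (by rw [h, C_0]) hG

lemma padeForm_ne_zero_or_ne_zero (hξ : ξ ≠ 0) (hμν : μ ≠ 0) (h3 : ξ ^ 3 ≠ η ^ 3) :
    padeForm 1 r μ ν ξ η ≠ 0 ∨ padeForm 2 r ν μ ξ η ≠ 0 := by
  by_contra! h
  obtain ⟨h1, h2⟩ := h
  rw [padeForm_eq_eval hξ] at h1 h2
  have hne : ∀ n, ξ ^ n ≠ 0 := fun n => pow_ne_zero n hξ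
  replace h1 := (mul_eq_zero.1 h1).resolve_left (hne _)
  replace h2 := (mul_eq_zero.1 h2).resolve_left (hne _)
  set z := (η / ξ) ^ 3 with hz
  set W : ℂ[X] := padePoly 1 r 0 * padePoly 2 r 0 - X * padePoly 1 r 1 * padePoly 2 r 2 with hW
  have hWz : W.eval z = 0 := by
    have : μ * W.eval z = 0 := by
      rw [hW]
      simp only [eval_sub, eval_mul, eval_X]
      linear_combination (padePoly 2 r 0).eval z * h1 - (η / ξ) * (padePoly 1 r 1).eval z * h2 + 
        μ * (padePoly 1 r 1).eval z * (padePoly 2 r 2).eval z * hz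
    exact (mul_eq_zero.1 this).resolve_left hμν
  have hW0 : W ≠ 0 := by
    intro h
    have : W.coeff 0 = 0 := by rw [h, coeff_zero]
    rw [hW, coeff_sub, mul_assoc, mul_coeff_zero, coeff_zero_padePoly, coeff_zero_padePoly,
      coeff_X_mul_zero, sub_zero] at this
    exact mul_ne_zero (ddWeight_ne_zero _ _) (ddWeight_ne_zero _ _) this
  have hdeg : W.natDegree ≤ 2 * r + 1 := by
    have h1 := natDegree_mul_le_of_le (natDegree_padePoly_le 1 r 0) (natDegree_padePoly_le 2 r 0)
    have h2 := natDegree_mul_le_of_le (natDegree_mul_le_of_le (natDegree_X_le (R := ℂ))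
      (natDegree_padePoly_le 1 r 1)) (natDegree_padePoly_le 2 r 2)
    exact (natDegree_sub_le_of_le h1 h2).trans (by omega)
  have hdvd : (X - C 1 : ℂ[X]) ^ (2 * r + 1) ∣ expand ℂ 3 W := by
    have d1 := X_sub_one_pow_dvd_padePoly (δ := 1) (r := r) (Or.inl rfl)
    have d2 := X_sub_one_pow_dvd_padePoly (δ := 2) (r := r) (Or.inr rfl)
    have : expand ℂ 3 W =
        (expand ℂ 3 (padePoly 1 r 0) + X ^ 1 * expand ℂ 3 (padePoly 1 r 1)) *
          expand ℂ 3 (padePoly 2 r 0) -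
        (expand ℂ 3 (padePoly 2 r 0) + X ^ 2 * expand ℂ 3 (padePoly 2 r 2)) *
          (X * expand ℂ 3 (padePoly 1 r 1)) := by
      rw [hW, map_sub, map_mul, map_mul, map_mul, expand_X]
      ring
    rw [this]
    exact dvd_sub (dvd_mul_of_dvd_left d1 _) (dvd_mul_of_dvd_left d2 _)
  have := eq_one_of_dvd_expand hW0 hdeg hdvd hWz
  rw [hz, div_pow, div_eq_one_iff_eq (hne 3)] at this
  exact h3 this.symm

end PadeProperties

end CubicThue

namespace CubicThue
open Finset Polynomial

section PadeBound

variable {δ r : ℕ} {μ ν ξ η x : ℂ}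

lemma padeForm_eq_ddExp (hδ : δ = 1 ∨ δ = 2) (hη : η = ξ * Complex.exp x) :
    padeForm δ r μ ν ξ η = ξ ^ (3 * r + δ) * (ν * ddExp (padeNodes δ r) x +
      (μ - ν) * ∑ j ∈ range (r + 1),
        ddWeight ℂ (padeNodes δ r) (3 * j) * Complex.exp ((3 * j : ℕ) * x)) := by
  have h0 : ∑ j ∈ range (r + 1),
      ddWeight ℂ (padeNodes δ r) (3 * j) * (ξ ^ (3 * (r - j) + δ) * η ^ (3 * j)) =
      ξ ^ (3 * r + δ) * ∑ j ∈ range (r + 1),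
        ddWeight ℂ (padeNodes δ r) (3 * j) * Complex.exp ((3 * j : ℕ) * x) := by
    rw [mul_sum]
    refine sum_congr rfl fun j hj => ?_
    rw [mem_range] at hj
    rw [show 3 * r + δ = 3 * (r - j) + δ + 3 * j by omega, pow_add ξ _ (3 * j), hη, mul_pow,
      Complex.exp_nat_mul]
    ring
  have h1 : ∑ j ∈ range (r + 1),
      ddWeight ℂ (padeNodes δ r) (3 * j + δ) * (ξ ^ (3 * (r - j)) * η ^ (3 * j + δ)) =
      ξ ^ (3 * r + δ) * ∑ j ∈ range (r + 1),
        ddWeight ℂ (padeNodes δ r) (3 * j + δ) * Complex.exp ((3 * j + δ : ℕ) * x) := by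
    rw [mul_sum]
    refine sum_congr rfl fun j hj => ?_
    rw [mem_range] at hj
    rw [show 3 * r + δ = 3 * (r - j) + (3 * j + δ) by omega, pow_add ξ _ (3 * j + δ), hη, mul_pow,
      Complex.exp_nat_mul]
    ring
  rw [padeForm, h0, h1, ddExp, sum_padeNodes hδ, sum_add_distrib]
  ring

lemma norm_exp_nat_mul_le {n N : ℕ} (hx : ‖x‖ ≤ 1) (hn : n ≤ N) :
    ‖Complex.exp (n * x)‖ ≤ 4 ^ N := by
  rw [Complex.exp_nat_mul, norm_pow]
  have h4 : ‖Complex.exp x‖ ≤ 4 :=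
    (Complex.norm_exp_le_exp_norm x).trans ((Real.exp_le_exp.2 hx).trans
      (by linarith [Real.exp_one_lt_three]))
  calc ‖Complex.exp x‖ ^ n ≤ 4 ^ n := by gcongr
    _ ≤ 4 ^ N := pow_le_pow_right₀ (by norm_num) hn

lemma norm_padeForm_le (hδ : δ = 1 ∨ δ = 2) (hr : 2 ≤ r) (hη : η = ξ * Complex.exp x)
    (hx : ‖x‖ ≤ 1) :
    ((3 * r + δ).factorial * 3 ^ (r + δ - 1) / (r + δ - 1).factorial : ℝ) *
      ‖padeForm δ r μ ν ξ η‖ ≤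
    2 ^ (27 * r) * ‖ξ‖ ^ (3 * r + δ) * (‖ν‖ * ‖x‖ ^ (2 * r + 1) + ‖μ - ν‖) := by
  set M : ℝ := (3 * r + δ).factorial * 3 ^ (r + δ - 1) / (r + δ - 1).factorial with hM
  have hMpos : 0 < M := by positivity
  have hexp : Real.exp ((3 * r + δ : ℕ) * ‖x‖) ≤ 4 ^ (4 * r) := by
    have h4 : Real.exp ‖x‖ ≤ 4 :=
      (Real.exp_le_exp.2 hx).trans (by linarith [Real.exp_one_lt_three])
    rw [Real.exp_nat_mul]
    calc Real.exp ‖x‖ ^ (3 * r + δ) ≤ 4 ^ (3 * r + δ) := by gcongr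
      _ ≤ 4 ^ (4 * r) := pow_le_pow_right₀ (by norm_num) (by omega)
  have h1 : M * ‖ddExp (padeNodes δ r) x‖ ≤ 2 ^ (27 * r) * ‖x‖ ^ (2 * r + 1) := by
    have hdd := norm_ddExp_le (T := padeNodes δ r) (H := 3 * r + δ)
      (by simp only [padeNodes, mem_filter, mem_range]; omega)
      (card_pos.1 (by rw [card_padeNodes hδ]; omega)) x
    rw [card_padeNodes hδ, show 2 * r + 2 - 1 = 2 * r + 1 by omega] at hdd
    have hchoose : M / (2 * r + 1).factorial =
        (3 * r + δ).choose (r + δ - 1) * 3 ^ (r + δ - 1) := by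
      rw [hM, Nat.cast_choose ℝ (by omega), show 3 * r + δ - (r + δ - 1) = 2 * r + 1 by omega]
      field_simp
    have hle : M / (2 * r + 1).factorial ≤ 2 ^ (4 * r) * 4 ^ (2 * r) := by
      rw [hchoose]
      gcongr ?_ * ?_
      · calc ((3 * r + δ).choose (r + δ - 1) : ℝ) ≤ 2 ^ (3 * r + δ) := by
              exact_mod_cast Nat.choose_le_two_pow _ _
          _ ≤ 2 ^ (4 * r) := pow_le_pow_right₀ (by norm_num) (by omega)
      · calc (3 : ℝ) ^ (r + δ - 1) ≤ 4 ^ (r + δ - 1) := by gcongr; norm_num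
          _ ≤ 4 ^ (2 * r) := pow_le_pow_right₀ (by norm_num) (by omega)
    calc M * ‖ddExp (padeNodes δ r) x‖
        ≤ M * (‖x‖ ^ (2 * r + 1) / (2 * r + 1).factorial * Real.exp ((3 * r + δ : ℕ) * ‖x‖)) := by
          gcongr
      _ = M / (2 * r + 1).factorial * Real.exp ((3 * r + δ : ℕ) * ‖x‖) * ‖x‖ ^ (2 * r + 1) := by
          ring
      _ ≤ (2 ^ (4 * r) * 4 ^ (2 * r)) * 4 ^ (4 * r) * ‖x‖ ^ (2 * r + 1) := by gcongr
      _ = 2 ^ (16 * r) * ‖x‖ ^ (2 * r + 1) := by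
          rw [show (4 : ℝ) = 2 ^ 2 by norm_num, ← pow_mul, ← pow_mul, ← pow_add, ← pow_add]
          congr 2; ring
      _ ≤ 2 ^ (27 * r) * ‖x‖ ^ (2 * r + 1) := by
          gcongr
          · norm_num
          · norm_num
  have h2 : M * ‖∑ j ∈ range (r + 1),
      ddWeight ℂ (padeNodes δ r) (3 * j) * Complex.exp ((3 * j : ℕ) * x)‖ ≤ 2 ^ (27 * r) := by
    have hterm : ∀ j ∈ range (r + 1),
        M * ‖ddWeight ℂ (padeNodes δ r) (3 * j) * Complex.exp ((3 * j : ℕ) * x)‖ ≤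
          2 ^ (26 * r) := by
      intro j hj
      rw [mem_range] at hj
      obtain ⟨c, hc, hcle⟩ := exists_int_eq_ddWeight_padeNodes (r := r) hδ (by omega)
        (t := 3 * j) (by
        simp only [padeNodes, mem_filter, mem_range]
        omega)
      have hcn : M * ‖ddWeight ℂ (padeNodes δ r) (3 * j)‖ = |(c : ℝ)| := by
        have hMc : (M : ℂ) = (3 * r + δ).factorial * 3 ^ (r + δ - 1) / (r + δ - 1).factorial := by
          rw [hM]; push_cast; rfl
        rw [← Complex.norm_intCast, hc, ← hMc, norm_mul, Complex.norm_real,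
          Real.norm_of_nonneg hMpos.le]
      have hcle' : |(c : ℝ)| ≤
          2 ^ (3 * r + δ) * (9 ^ (r + δ - 1) * 2 ^ (3 * r + δ + (r + δ - 1))) := by
        exact_mod_cast hcle
      rw [norm_mul, ← mul_assoc, hcn]
      calc |(c : ℝ)| * ‖Complex.exp ((3 * j : ℕ) * x)‖
          ≤ (2 ^ (3 * r + δ) * (9 ^ (r + δ - 1) * 2 ^ (3 * r + δ + (r + δ - 1)))) *
            4 ^ (4 * r) := by
            gcongr
            exact norm_exp_nat_mul_le hx (by omega)
        _ ≤ (2 ^ (4 * r) * ((2 ^ 4) ^ (2 * r) * 2 ^ (6 * r))) * (2 ^ 2) ^ (4 * r) := by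
            gcongr ?_ * (?_ * ?_) * ?_
            · exact pow_le_pow_right₀ (by norm_num) (by omega)
            · calc (9 : ℝ) ^ (r + δ - 1) ≤ (2 ^ 4) ^ (r + δ - 1) := by gcongr; norm_num
                _ ≤ (2 ^ 4) ^ (2 * r) := pow_le_pow_right₀ (by norm_num) (by omega)
            · exact pow_le_pow_right₀ (by norm_num) (by omega)
            · norm_num
        _ = 2 ^ (26 * r) := by
            rw [← pow_mul, ← pow_mul, ← pow_add, ← pow_add, ← pow_add]
            congr 1; ring
    calc M * ‖∑ j ∈ range (r + 1),
          ddWeight ℂ (padeNodes δ r) (3 * j) * Complex.exp ((3 * j : ℕ) * x)‖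
        ≤ M * ∑ j ∈ range (r + 1),
          ‖ddWeight ℂ (padeNodes δ r) (3 * j) * Complex.exp ((3 * j : ℕ) * x)‖ := by
          gcongr; exact norm_sum_le _ _
      _ ≤ ∑ j ∈ range (r + 1), (2 : ℝ) ^ (26 * r) := by
          rw [mul_sum]; exact sum_le_sum hterm
      _ = (r + 1 : ℕ) * 2 ^ (26 * r) := by simp
      _ ≤ 2 ^ r * 2 ^ (26 * r) := by
          gcongr
          exact_mod_cast (Nat.lt_two_pow_self (n := r))
      _ = 2 ^ (27 * r) := by rw [← pow_add]; congr 1; ring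
  rw [padeForm_eq_ddExp hδ hη, norm_mul, norm_pow]
  set A := ∑ j ∈ range (r + 1),
      ddWeight ℂ (padeNodes δ r) (3 * j) * Complex.exp ((3 * j : ℕ) * x)
  calc M * (‖ξ‖ ^ (3 * r + δ) * ‖ν * ddExp (padeNodes δ r) x + (μ - ν) * A‖)
      ≤ M * (‖ξ‖ ^ (3 * r + δ) * (‖ν‖ * ‖ddExp (padeNodes δ r) x‖ + ‖μ - ν‖ * ‖A‖)) := by
        gcongr
        exact (norm_add_le _ _).trans (by rw [norm_mul, norm_mul])
    _ = ‖ξ‖ ^ (3 * r + δ) * (‖ν‖ * (M * ‖ddExp (padeNodes δ r) x‖) + ‖μ - ν‖ * (M * ‖A‖)) := by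
        ring
    _ ≤ ‖ξ‖ ^ (3 * r + δ) * (‖ν‖ * (2 ^ (27 * r) * ‖x‖ ^ (2 * r + 1)) +
          ‖μ - ν‖ * 2 ^ (27 * r)) := by gcongr
    _ = _ := by ring

end PadeBound

end CubicThue

namespace CubicThue
open Finset Polynomial

section VeryLargeSolutions

lemma two_pow_mul_add_lt_one {a B X : ℝ} {r : ℕ} (hX : Real.exp 1000 ≤ X) (ha : X ^ 7 ≤ a)
    (hB : 0 < B) (hr : 2 ≤ r) (hup : B ^ 5 ≤ a ^ (14 * r + 5)) (hlow : a ^ 24 ≤ B ^ 5)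
    (hmin : 3 ≤ r → a ^ (14 * (r - 1) + 5) ≤ B ^ 5) :
    2 ^ (40 * r) * (B * X ^ r / a ^ (3 * r + 1)) < 1 / 2 ∧
      2 ^ (40 * r) * (a ^ (3 * r + 2) / B ^ 2) < 1 / 2 := by
  have hX0 : 0 < X := (Real.exp_pos _).trans_le hX
  have ha0 : 0 < a := (pow_pos hX0 7).trans_le ha
  have hLx : 1000 ≤ Real.log X := by rwa [Real.le_log_iff_exp_le hX0]
  have hLa : 7 * Real.log X ≤ Real.log a := by
    have := Real.log_le_log (pow_pos hX0 7) ha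
    rwa [Real.log_pow] at this
  have hup' : 5 * Real.log B ≤ (14 * r + 5) * Real.log a := by
    have := Real.log_le_log (pow_pos hB 5) hup
    rw [Real.log_pow, Real.log_pow] at this
    exact_mod_cast this
  have hlow' : 24 * Real.log a ≤ 5 * Real.log B := by
    have := Real.log_le_log (pow_pos ha0 24) hlow
    rw [Real.log_pow, Real.log_pow] at this
    exact_mod_cast this
  have hmin' : 3 ≤ r → (14 * r - 9) * Real.log a ≤ 5 * Real.log B := by
    intro h
    have := Real.log_le_log (pow_pos ha0 _) (hmin h)
    rw [Real.log_pow, Real.log_pow] at this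
    push_cast [Nat.cast_sub (show 1 ≤ r by omega)] at this
    linarith
  have hexp : Real.exp (-1) < 1 / 2 := by
    rw [Real.exp_neg, ← one_div]
    exact one_div_lt_one_div_of_lt (by norm_num) (by linarith [Real.exp_one_gt_d9])
  have hlog2 : Real.log 2 ≤ 0.7 := by linarith [Real.log_two_lt_d9]
  have key : ∀ z : ℝ, 0 < z → Real.log z < -1 → z < 1 / 2 := fun z hz h =>
    ((Real.log_lt_iff_lt_exp hz).1 h).trans hexp
  have hr' : (2 : ℝ) ≤ r := by exact_mod_cast hr
  set L := Real.log a
  set P := r * L with hP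
  have hP1 : 28 * r ≤ 0.004 * P := by rw [hP]; nlinarith only [hr', hLx, hLa]
  have hP2 : r * Real.log X ≤ P / 7 := by rw [hP]; nlinarith only [hr', hLa]
  have hP3 : 2 * L ≤ P := by rw [hP]; nlinarith only [hr', hLa, hLx]
  have hP4 : 40 * r * Real.log 2 ≤ 28 * r := by nlinarith only [hlog2, hr']
  constructor
  · refine key _ (by positivity) ?_
    rw [Real.log_mul (by positivity) (by positivity), Real.log_div (by positivity) (by positivity),
      Real.log_mul (by positivity) (by positivity), Real.log_pow, Real.log_pow, Real.log_pow]
    push_cast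
    have e1 : (14 * r + 5) * L = 14 * P + 5 * L := by rw [hP]; ring
    have e2 : (3 * (r : ℝ) + 1) * L = 3 * P + L := by rw [hP]; ring
    rw [e1] at hup'
    rw [e2]
    linarith
  · refine key _ (by positivity) ?_
    rw [Real.log_mul (by positivity) (by positivity), Real.log_div (by positivity) (by positivity),
      Real.log_pow, Real.log_pow, Real.log_pow]
    push_cast
    have e2 : (3 * (r : ℝ) + 2) * L = 3 * P + 2 * L := by rw [hP]; ring
    rw [e2]
    rcases Nat.lt_or_ge r 3 with h | h
    · have : (r : ℝ) = 2 := by exact_mod_cast (show r = 2 by omega)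
      have hP5 : P = 2 * L := by rw [hP, this]
      linarith
    · have h3 := hmin' h
      have e3 : (14 * r - 9) * L = 14 * P - 9 * L := by rw [hP]; ring
      have hP5 : 3 * L ≤ P := by
        rw [hP]
        have : (3 : ℝ) ≤ r := by exact_mod_cast h
        nlinarith only [this, hLa, hLx]
      linarith

lemma exists_pade_index {a B : ℝ} (ha : 1 < a) :
    ∃ r : ℕ, 2 ≤ r ∧ B ^ 5 ≤ a ^ (14 * r + 5) ∧ (3 ≤ r → a ^ (14 * (r - 1) + 5) ≤ B ^ 5) := by
  classical
  have hex : ∃ r : ℕ, 2 ≤ r ∧ B ^ 5 ≤ a ^ (14 * r + 5) := by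
    obtain ⟨n, hn⟩ := pow_unbounded_of_one_lt (B ^ 5) ha
    exact ⟨n + 2, by omega, hn.le.trans (pow_le_pow_right₀ ha.le (by omega))⟩
  refine ⟨Nat.find hex, (Nat.find_spec hex).1, (Nat.find_spec hex).2, fun h => ?_⟩
  have := Nat.find_min hex (m := Nat.find hex - 1) (by omega)
  push Not at this
  exact (this (by omega)).le

variable {b c d x y : ℤ}

lemma four_dvd_cubicDisc_mul (b c d : ℤ) :
    (4 : ℤ) ∣ cubicDisc 1 b c d * (cubicDisc 1 b c d - 1) := by
  have h : cubicDisc 1 b c d =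
      (b * c + d) ^ 2 + 4 * (4 * b * c * d - 7 * d ^ 2 - b ^ 3 * d - c ^ 3) := by
    rw [cubicDisc]; ring
  rw [h]
  generalize 4 * b * c * d - 7 * d ^ 2 - b ^ 3 * d - c ^ 3 = k
  rcases Int.even_or_odd' (b * c + d) with ⟨s, hs | hs⟩ <;> rw [hs]
  · exact ⟨(s ^ 2 + k) * ((2 * s) ^ 2 + 4 * k - 1), by ring⟩
  · exact ⟨((2 * s + 1) ^ 2 + 4 * k) * (s ^ 2 + s + k), by ring⟩

lemma two_dvd_hessian_coeff (b c d x y : ℤ) :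
    (2 : ℤ) ∣ (2 * (b ^ 2 - 3 * c) * x + (b * c - 9 * d) * y) - y * cubicDisc 1 b c d := by
  rw [← Nat.cast_two, ← ZMod.intCast_zmod_eq_zero_iff_dvd, cubicDisc]
  push_cast
  generalize (b : ZMod 2) = b
  generalize (c : ZMod 2) = c
  generalize (d : ZMod 2) = d
  generalize (x : ZMod 2) = x
  generalize (y : ZMod 2) = y
  revert b c d x y
  decide

lemma two_dvd_jacobian_coeff (b c d x y : ℤ) :
    (2 : ℤ) ∣ (-(2 * b ^ 3 - 9 * b * c + 27 * d) * x - (b ^ 2 * c - 6 * c ^ 2 + 9 * b * d) * y) -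
      (3 * x + b * y) * cubicDisc 1 b c d := by
  rw [← Nat.cast_two, ← ZMod.intCast_zmod_eq_zero_iff_dvd, cubicDisc]
  push_cast
  generalize (b : ZMod 2) = b
  generalize (c : ZMod 2) = c
  generalize (d : ZMod 2) = d
  generalize (x : ZMod 2) = x
  generalize (y : ZMod 2) = y
  revert b c d x y
  decide

lemma padeForm_eq_zero_of_bounds {a B S : ℝ} {D : ℤ} {w μ ν ξ η z : ℂ} {δ r : ℕ}
    (hδ : δ = 1 ∨ δ = 2) (hr : 2 ≤ r) (ha : 1 ≤ a) (hB : 0 < B) (hS : 1 ≤ S)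
    (hw : w ^ 2 = -3 * D) (hwS : S ≤ ‖w‖) (h3 : IsConjPair D w (ξ ^ 3) (η ^ 3))
    (hD : (4 : ℤ) ∣ D * (D - 1))
    (hμν : IsConjPair D w (μ * ξ ^ δ) (ν * η ^ δ)) (hη : η = ξ * Complex.exp z)
    (hz : ‖z‖ ≤ 4 * S / a ^ 3) (hz1 : ‖z‖ ≤ 1) (hξ : ‖ξ‖ ≤ 2 * a) (hν : ‖ν‖ ≤ 2 * B)
    (hdiff : ‖μ - ν‖ ≤ 2 * S / B ^ 2)
    (hsmall1 : 2 ^ (40 * r) * (B * (S ^ 2) ^ r / a ^ (3 * r + 1)) < 1 / 2)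
    (hsmall2 : 2 ^ (40 * r) * (a ^ (3 * r + 2) / B ^ 2) < 1 / 2) :
    padeForm δ r μ ν ξ η = 0 := by
  by_contra h0
  have h := hwS.trans ((norm_le_norm_padeForm hδ (by omega) hw hD h3 hμν h0).trans
    (norm_padeForm_le hδ hr hη hz1))
  have ha0 : 0 < a := by linarith
  have hpow : ‖ξ‖ ^ (3 * r + δ) ≤ 2 ^ (4 * r) * a ^ (3 * r + 2) := by
    calc ‖ξ‖ ^ (3 * r + δ) ≤ (2 * a) ^ (3 * r + δ) := by gcongr
      _ ≤ (2 * a) ^ (3 * r + 2) := pow_le_pow_right₀ (by linarith) (by omega)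
      _ = 2 ^ (3 * r + 2) * a ^ (3 * r + 2) := mul_pow _ _ _
      _ ≤ 2 ^ (4 * r) * a ^ (3 * r + 2) := by
        gcongr
        · norm_num
        · omega
  have hzp : ‖z‖ ^ (2 * r + 1) ≤ 2 ^ (4 * r + 2) * S ^ (2 * r + 1) / a ^ (6 * r + 3) := by
    calc ‖z‖ ^ (2 * r + 1) ≤ (4 * S / a ^ 3) ^ (2 * r + 1) := by gcongr
      _ = 2 ^ (4 * r + 2) * S ^ (2 * r + 1) / a ^ (6 * r + 3) := by
        rw [div_pow, mul_pow, show (4 : ℝ) = 2 ^ 2 by norm_num, ← pow_mul, ← pow_mul]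
        congr 2 <;> ring
  have hupper : 2 ^ (27 * r) * ‖ξ‖ ^ (3 * r + δ) * (‖ν‖ * ‖z‖ ^ (2 * r + 1) + ‖μ - ν‖) ≤
      2 ^ (27 * r) * (2 ^ (4 * r) * a ^ (3 * r + 2)) *
        (2 * B * (2 ^ (4 * r + 2) * S ^ (2 * r + 1) / a ^ (6 * r + 3)) + 2 * S / B ^ 2) := by
    gcongr
  have hfirst : 2 ^ (27 * r) * (2 ^ (4 * r) * a ^ (3 * r + 2)) *
      (2 * B * (2 ^ (4 * r + 2) * S ^ (2 * r + 1) / a ^ (6 * r + 3))) =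
      S * (2 ^ (35 * r + 3) * (B * (S ^ 2) ^ r / a ^ (3 * r + 1))) := by
    rw [show 6 * r + 3 = (3 * r + 2) + (3 * r + 1) by ring, pow_add a,
      show 35 * r + 3 = 27 * r + 4 * r + (4 * r + 2) + 1 by ring, pow_add _ _ 1, pow_add (2 : ℝ),
      pow_add (2 : ℝ), pow_succ S, pow_mul S]
    field_simp
    ring
  have hsecond : 2 ^ (27 * r) * (2 ^ (4 * r) * a ^ (3 * r + 2)) * (2 * S / B ^ 2) =
      S * (2 ^ (31 * r + 1) * (a ^ (3 * r + 2) / B ^ 2)) := by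
    rw [show 31 * r + 1 = 27 * r + 4 * r + 1 by ring, pow_add _ _ 1, pow_add (2 : ℝ)]
    field_simp
    ring
  rw [mul_add (2 ^ (27 * r) * (2 ^ (4 * r) * a ^ (3 * r + 2))), hfirst, hsecond,
    ← mul_add] at hupper
  have hs1 : (2 : ℝ) ^ (35 * r + 3) * (B * (S ^ 2) ^ r / a ^ (3 * r + 1)) ≤
      2 ^ (40 * r) * (B * (S ^ 2) ^ r / a ^ (3 * r + 1)) := by
    gcongr
    · norm_num
    · omega
  have hs2 : (2 : ℝ) ^ (31 * r + 1) * (a ^ (3 * r + 2) / B ^ 2) ≤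
      2 ^ (40 * r) * (a ^ (3 * r + 2) / B ^ 2) := by
    gcongr
    · norm_num
    · omega
  have hlt : S * (2 ^ (35 * r + 3) * (B * (S ^ 2) ^ r / a ^ (3 * r + 1)) +
      2 ^ (31 * r + 1) * (a ^ (3 * r + 2) / B ^ 2)) < S * 1 := by
    gcongr
    linarith
  linarith [h.trans hupper]

end VeryLargeSolutions

end CubicThue

namespace CubicThue
open Finset Polynomial

section CloseSolutionsContradiction

variable {b c d x y : ℤ} {α p q : ℝ} {θ : ℂ}

lemma isConjPair_cube (hb : (b : ℝ) = p - α) (hc : (c : ℝ) = q - p * α) (hd : (d : ℝ) = -q * α)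
    (hθ : θ ^ 2 = -3 * (p ^ 2 - 4 * q)) :
    IsConjPair (cubicDisc 1 b c d) (θ * (α ^ 2 + p * α + q))
      (((p + 2 * α) / 2 + θ / 2) ^ 3) (((p + 2 * α) / 2 - θ / 2) ^ 3) := by
  have hb' : (b : ℂ) = p - α := by exact_mod_cast congrArg ((↑) : ℝ → ℂ) hb
  have hc' : (c : ℂ) = q - p * α := by exact_mod_cast congrArg ((↑) : ℝ → ℂ) hc
  have hd' : (d : ℂ) = -q * α := by exact_mod_cast congrArg ((↑) : ℝ → ℂ) hd
  refine ⟨-(2 * b ^ 3 - 9 * b * c + 27 * d), 3, ?_, ?_, ?_⟩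
  · push_cast
    rw [hb', hc', hd']
    linear_combination (3 * ((p + 2 * α) / 2) / 4 + θ / 8) * hθ
  · push_cast
    rw [hb', hc', hd']
    linear_combination (3 * ((p + 2 * α) / 2) / 4 - θ / 8) * hθ
  · simpa using two_dvd_jacobian_coeff b c d 1 0

lemma isConjPair_mul (hb : (b : ℝ) = p - α) (hc : (c : ℝ) = q - p * α) (hd : (d : ℝ) = -q * α)
    (hθ : θ ^ 2 = -3 * (p ^ 2 - 4 * q)) :
    IsConjPair (cubicDisc 1 b c d) (θ * (α ^ 2 + p * α + q))
      ((((p + 2 * α) * x + (2 * q + p * α) * y) / 2 - θ * (x - α * y) / 2) *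
        ((p + 2 * α) / 2 + θ / 2))
      ((((p + 2 * α) * x + (2 * q + p * α) * y) / 2 + θ * (x - α * y) / 2) *
        ((p + 2 * α) / 2 - θ / 2)) := by
  have hb' : (b : ℂ) = p - α := by exact_mod_cast congrArg ((↑) : ℝ → ℂ) hb
  have hc' : (c : ℂ) = q - p * α := by exact_mod_cast congrArg ((↑) : ℝ → ℂ) hc
  have hd' : (d : ℂ) = -q * α := by exact_mod_cast congrArg ((↑) : ℝ → ℂ) hd
  refine ⟨2 * (b ^ 2 - 3 * c) * x + (b * c - 9 * d) * y, y, ?_, ?_,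
    two_dvd_hessian_coeff b c d x y⟩
  · push_cast
    rw [hb', hc', hd']
    linear_combination -(x - α * y) / 4 * hθ
  · push_cast
    rw [hb', hc', hd']
    linear_combination -(x - α * y) / 4 * hθ

lemma isConjPair_mul_sq (hb : (b : ℝ) = p - α) (hc : (c : ℝ) = q - p * α) (hd : (d : ℝ) = -q * α)
    (hθ : θ ^ 2 = -3 * (p ^ 2 - 4 * q)) :
    IsConjPair (cubicDisc 1 b c d) (θ * (α ^ 2 + p * α + q))
      ((((p + 2 * α) * x + (2 * q + p * α) * y) / 2 + θ * (x - α * y) / 2) *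
        ((p + 2 * α) / 2 + θ / 2) ^ 2)
      ((((p + 2 * α) * x + (2 * q + p * α) * y) / 2 - θ * (x - α * y) / 2) *
        ((p + 2 * α) / 2 - θ / 2) ^ 2) := by
  have hb' : (b : ℂ) = p - α := by exact_mod_cast congrArg ((↑) : ℝ → ℂ) hb
  have hc' : (c : ℂ) = q - p * α := by exact_mod_cast congrArg ((↑) : ℝ → ℂ) hc
  have hd' : (d : ℂ) = -q * α := by exact_mod_cast congrArg ((↑) : ℝ → ℂ) hd
  refine ⟨-(2 * b ^ 3 - 9 * b * c + 27 * d) * x - (b ^ 2 * c - 6 * c ^ 2 + 9 * b * d) * y,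
    3 * x + b * y, ?_, ?_, two_dvd_jacobian_coeff b c d x y⟩
  · push_cast
    rw [hb', hc', hd']
    linear_combination (((p + 2 * α) * x + (2 * q + p * α) * y) / 2 / 4 +
      (x - α * y) * ((p + 2 * α) / 2) / 2 + θ * (x - α * y) / 8) * hθ
  · push_cast
    rw [hb', hc', hd']
    linear_combination (((p + 2 * α) * x + (2 * q + p * α) * y) / 2 / 4 +
      (x - α * y) * ((p + 2 * α) / 2) / 2 - θ * (x - α * y) / 8) * hθ

/-- Size information on the logarithm of `η / ξ` when `ξ - η = θ` is small. -/
lemma exists_exp_eq_of_norm_le {m a S : ℝ} {θ : ℂ} (ha : |m| = a) (ha1 : 1000 ≤ a) (hS : S ≤ a)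
    (hθ : ‖θ‖ * a ^ 2 ≤ 2 * S) :
    (0.9 * a ≤ ‖(m : ℂ) + θ / 2‖ ∧ ‖(m : ℂ) + θ / 2‖ ≤ 2 * a) ∧
    ∃ z : ℂ, (m : ℂ) - θ / 2 = (m + θ / 2) * Complex.exp z ∧ ‖z‖ ≤ 4 * S / a ^ 3 ∧ ‖z‖ ≤ 1 := by
  have ht : ‖θ‖ * a ≤ 2 := by
    have : ‖θ‖ * a * a ≤ 2 * a := by linarith
    exact le_of_mul_le_mul_right this (by linarith)
  have ht1 : ‖θ‖ ≤ 0.1 := by nlinarith only [ht, ha1, norm_nonneg θ]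
  have hθ2 : ‖θ / 2‖ = ‖θ‖ / 2 := by rw [norm_div]; norm_num
  have hm : ‖(m : ℂ)‖ = a := by rw [Complex.norm_real, Real.norm_eq_abs, ha]
  have hlow : 0.9 * a ≤ ‖(m : ℂ) + θ / 2‖ := by
    have := norm_sub_norm_le (m : ℂ) (-(θ / 2))
    rw [sub_neg_eq_add, norm_neg, hm, hθ2] at this
    linarith
  have hup : ‖(m : ℂ) + θ / 2‖ ≤ 2 * a := by
    have := norm_add_le (m : ℂ) (θ / 2)
    rw [hm, hθ2] at this
    linarith
  refine ⟨⟨hlow, hup⟩, Complex.log (1 + -θ / (m + θ / 2)), ?_⟩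
  set ξ : ℂ := m + θ / 2 with hξ
  have hξ0 : ξ ≠ 0 := by
    rw [← norm_pos_iff]; linarith
  have hnorm : ‖-θ / ξ‖ ≤ ‖θ‖ / (0.9 * a) := by
    rw [norm_div, norm_neg]
    gcongr
  have hnorm' : ‖-θ / ξ‖ ≤ 2 * S / a ^ 2 / (0.9 * a) := by
    refine hnorm.trans ?_
    gcongr
    rwa [le_div_iff₀ (by positivity)]
  have hhalf : ‖-θ / ξ‖ ≤ 1 / 2 := by
    refine hnorm.trans ?_
    rw [div_le_iff₀ (by positivity)]
    linarith
  have hlog := Complex.norm_log_one_add_half_le_self hhalf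
  refine ⟨?_, ?_, ?_⟩
  · have hne : 1 + -θ / ξ ≠ 0 := by
      intro h
      have h1 : -θ / ξ = -1 := by linear_combination h
      rw [h1, norm_neg, norm_one] at hhalf
      norm_num at hhalf
    rw [Complex.exp_log hne]
    field_simp
    rw [hξ]; ring
  · refine hlog.trans ?_
    have hS0 : 0 ≤ S := by have := norm_nonneg θ; nlinarith only [hθ, this, sq_nonneg a]
    calc 3 / 2 * ‖-θ / ξ‖ ≤ 3 / 2 * (2 * S / a ^ 2 / (0.9 * a)) := by gcongr
      _ = (10 / 3) * (S / a ^ 3) := by field_simp; ring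
      _ ≤ 4 * (S / a ^ 3) := by gcongr; norm_num
      _ = 4 * S / a ^ 3 := by ring
  · linarith

set_option maxHeartbeats 1000000 in
/-- Two distinct solutions cannot approximate the same real root if the smaller one is already very
large compared with the discriminant. -/
lemma not_solution_of_pow_seven_le (hb : (b : ℝ) = p - α) (hc : (c : ℝ) = q - p * α)
    (hd : (d : ℝ) = -q * α) (hD : Real.exp 1000 ≤ |(cubicDisc 1 b c d : ℝ)|)
    (hF : |cubicFormVal 1 b c d (x, y)| = 1)
    (h1 : ((p + 2 * α) / 2) ^ 2 ≤ 1.1 * |α ^ 2 + p * α + q|)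
    (h2 : |x - α * y| * (((p + 2 * α) * x + (2 * q + p * α) * y) / 2) ^ 2 ≤
      1.1 * |α ^ 2 + p * α + q|)
    (hlow : |(cubicDisc 1 b c d : ℝ)| ^ 7 ≤ |(p + 2 * α) / 2|)
    (hgap : 0.8 * ((p + 2 * α) / 2) ^ 2 ≤ |((p + 2 * α) * x + (2 * q + p * α) * y) / 2|) :
    False := by
  have hD6 : (1000000 : ℝ) ≤ |(cubicDisc 1 b c d : ℝ)| := by
    refine le_trans ?_ hD
    have h3 : (2 : ℝ) ≤ Real.exp 1 := by linarith [Real.exp_one_gt_d9]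
    have h4 : Real.exp 1000 = Real.exp 1 ^ 1000 := by rw [← Real.exp_nat_mul]; norm_num
    rw [h4]
    calc (1000000 : ℝ) ≤ 2 ^ 20 := by norm_num
      _ ≤ 2 ^ 1000 := pow_le_pow_right₀ (by norm_num) (by norm_num)
      _ ≤ Real.exp 1 ^ 1000 := by gcongr
  by_cases hup : 100 * |(cubicDisc 1 b c d : ℝ)| *
      |((p + 2 * α) * x + (2 * q + p * α) * y) / 2| ≤ |(p + 2 * α) / 2| ^ 5
  · exact not_solution_of_abs_le_pow_five hb hc hd (by linarith) hF h1 h2 hlow hgap hup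
  push Not at hup
  have hDeq := cubicDisc_eq_mul_sq hb hc hd
  obtain ⟨θ, hθ⟩ := IsAlgClosed.exists_pow_nat_eq (-3 * ((p : ℂ) ^ 2 - 4 * q)) (n := 2)
    (by norm_num)
  have hcube := isConjPair_cube hb hc hd hθ
  have hmul := isConjPair_mul (x := x) (y := y) hb hc hd hθ
  have hmulsq := isConjPair_mul_sq (x := x) (y := y) hb hc hd hθ
  have hfour := four_dvd_cubicDisc_mul b c d
  set X : ℝ := |(cubicDisc 1 b c d : ℝ)| with hX
  obtain ⟨S, hS0, hSX⟩ : ∃ S : ℝ, 0 ≤ S ∧ S ^ 2 = X :=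
    ⟨√X, Real.sqrt_nonneg _, Real.sq_sqrt (by linarith)⟩
  have hS1 : 1 ≤ S := by nlinarith only [hSX, hD6, hS0]
  have hSleX : S ≤ X := by nlinarith only [hSX, hS1]
  set w : ℂ := θ * (α ^ 2 + p * α + q) with hw
  have hw2 : w ^ 2 = -3 * (cubicDisc 1 b c d : ℤ) := by
    have : ((cubicDisc 1 b c d : ℤ) : ℂ) = (p ^ 2 - 4 * q) * (α ^ 2 + p * α + q) ^ 2 := by
      exact_mod_cast congrArg ((↑) : ℝ → ℂ) hDeq
    rw [this, hw, mul_pow, hθ]; ring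
  have hwn : ‖w‖ ^ 2 = 3 * X := by
    rw [← norm_pow, hw2, norm_mul, Complex.norm_intCast]
    norm_num [hX]
  have hwS : S ≤ ‖w‖ := by nlinarith only [hwn, hSX, norm_nonneg w, hS0]
  have hwS' : ‖w‖ ≤ 1.8 * S := by nlinarith only [hwn, hSX, norm_nonneg w, hS0]
  have hwQ : ‖w‖ = ‖θ‖ * |α ^ 2 + p * α + q| := by
    rw [hw, norm_mul, ← Real.norm_eq_abs, ← Complex.norm_real]
    push_cast
    rfl
  have hξ : ((p : ℂ) + 2 * α) / 2 = (((p + 2 * α) / 2 : ℝ) : ℂ) := by push_cast; rfl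
  have hμ : ((p + 2 * α) * x + (2 * q + p * α) * y : ℂ) / 2 =
      ((((p + 2 * α) * x + (2 * q + p * α) * y) / 2 : ℝ) : ℂ) := by push_cast; rfl
  have hu : θ * ((x : ℂ) - α * y) = θ * ((x - α * y : ℝ) : ℂ) := by push_cast; rfl
  have hdiff : (((p : ℂ) + 2 * α) / 2 + θ / 2) ^ 3 - ((p + 2 * α) / 2 - θ / 2) ^ 3 = 3 * w := by
    rw [hw]
    linear_combination (θ / 4) * hθ
  rw [hξ] at hcube hmul hmulsq hdiff
  rw [hμ, hu] at hmul hmulsq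
  generalize hm₁ : (p + 2 * α) / 2 = m₁ at *
  generalize hm₂ : ((p + 2 * α) * x + (2 * q + p * α) * y) / 2 = m₂ at *
  generalize (x - α * y : ℝ) = u at *
  generalize hA : |α ^ 2 + p * α + q| = A at *
  generalize ha : |m₁| = a at *
  generalize hB : |m₂| = B at *
  rw [← sq_abs, ha] at h1 hgap
  rw [← sq_abs m₂, hB] at h2
  have hX17 : X ≤ X ^ 7 := le_self_pow₀ (by linarith) (by norm_num)
  have haX : X ≤ a := hX17.trans hlow
  have ha6 : 1000000 ≤ a := hD6.trans haX
  have hApos : 0 < A := by nlinarith only [h1, ha6]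
  have hBlow : a ≤ B := by nlinarith only [hgap, ha6]
  have hBpos : 0 < B := by linarith
  have hθa : ‖θ‖ * a ^ 2 ≤ 2 * S := by
    have : ‖θ‖ * a ^ 2 ≤ ‖θ‖ * (1.1 * A) := by gcongr
    linarith
  have hθu : ‖θ‖ * |u| ≤ 2 * S / B ^ 2 := by
    rw [le_div_iff₀ (by positivity)]
    have : ‖θ‖ * |u| * B ^ 2 ≤ ‖θ‖ * (1.1 * A) := by rw [mul_assoc]; gcongr
    linarith
  have hθu1 : ‖θ‖ * |u| ≤ 1 := by
    refine hθu.trans ?_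
    rw [div_le_one (by positivity)]
    nlinarith only [hBlow, ha6, hSleX, haX]
  have hB5 : a ^ 24 ≤ B ^ 5 := by
    have h3 : (a ^ 5) ^ 5 ≤ (100 * X * B) ^ 5 := by
      have : 0 ≤ a := by linarith
      gcongr
    have h4 : (100 : ℝ) ^ 5 * X ^ 5 ≤ a := by
      refine le_trans ?_ hlow
      calc (100 : ℝ) ^ 5 * X ^ 5 ≤ X ^ 2 * X ^ 5 := by gcongr; nlinarith only [hD6]
        _ = X ^ 7 := by ring
    have h5 : a * a ^ 24 ≤ a * B ^ 5 := by
      calc a * a ^ 24 = (a ^ 5) ^ 5 := by ring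
        _ ≤ (100 * X * B) ^ 5 := h3
        _ = (100 ^ 5 * X ^ 5) * B ^ 5 := by ring
        _ ≤ a * B ^ 5 := by gcongr
    exact le_of_mul_le_mul_left h5 (by linarith)
  obtain ⟨⟨hξlow, hξup⟩, z, hz, hzS, hz1⟩ :=
    exists_exp_eq_of_norm_le (m := m₁) (θ := θ) ha (by linarith) (hSleX.trans haX) hθa
  obtain ⟨r, hr, hr1, hr2⟩ := exists_pade_index (a := a) (B := B) (by linarith)
  obtain ⟨hs1, hs2⟩ := two_pow_mul_add_lt_one hD hlow hBpos hr hr1 hB5 hr2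
  rw [← hSX] at hs1
  have hm₂n : ‖(m₂ : ℂ)‖ = B := by rw [Complex.norm_real, Real.norm_eq_abs, hB]
  have hun : ‖θ * (u : ℂ) / 2‖ = ‖θ‖ * |u| / 2 := by
    rw [norm_div, norm_mul, Complex.norm_real, Real.norm_eq_abs]; norm_num
  have hplus : ‖(m₂ : ℂ) + θ * u / 2‖ ≤ 2 * B := by
    have := norm_add_le (m₂ : ℂ) (θ * u / 2)
    linarith
  have hminus : ‖(m₂ : ℂ) - θ * u / 2‖ ≤ 2 * B := by
    have := norm_sub_le (m₂ : ℂ) (θ * u / 2)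
    linarith
  have hne : (m₂ : ℂ) - θ * u / 2 ≠ 0 := by
    have := norm_sub_norm_le (m₂ : ℂ) (θ * u / 2)
    rw [← norm_pos_iff]
    linarith
  have hd1 : ‖((m₂ : ℂ) - θ * u / 2) - (m₂ + θ * u / 2)‖ ≤ 2 * S / B ^ 2 := by
    rw [show ((m₂ : ℂ) - θ * u / 2) - (m₂ + θ * u / 2) = -(θ * u) by ring, norm_neg, norm_mul,
      Complex.norm_real, Real.norm_eq_abs]
    exact hθu
  have hd2 : ‖((m₂ : ℂ) + θ * u / 2) - (m₂ - θ * u / 2)‖ ≤ 2 * S / B ^ 2 := by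
    rwa [norm_sub_rev]
  have hzero1 := padeForm_eq_zero_of_bounds (δ := 1) (Or.inl rfl) hr (by linarith) hBpos hS1 hw2
    hwS hcube hfour (by rw [pow_one, pow_one]; exact hmul) hz hzS hz1 hξup hplus hd1 hs1 hs2
  have hzero2 := padeForm_eq_zero_of_bounds (δ := 2) (Or.inr rfl) hr (by linarith) hBpos hS1 hw2
    hwS hcube hfour hmulsq hz hzS hz1 hξup hminus hd2 hs1 hs2
  have hξ0 : (m₁ : ℂ) + θ / 2 ≠ 0 := by
    rw [← norm_pos_iff]; linarith
  have hcubene : ((m₁ : ℂ) + θ / 2) ^ 3 ≠ (m₁ - θ / 2) ^ 3 := by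
    rw [← sub_ne_zero, hdiff]
    exact mul_ne_zero three_ne_zero (norm_pos_iff.mp (by linarith))
  rcases padeForm_ne_zero_or_ne_zero (r := r) hξ0 hne hcubene with h | h
  · exact h hzero1
  · exact h hzero2

end CloseSolutionsContradiction

end CubicThue

namespace CubicThue
open Finset

section Integrality

open MvPolynomial Equiv

/-- The elementary symmetric functions of `α 0, α 1, α 2` are integers. -/
def HasIntegralEsymm (α : Fin 3 → ℝ) : Prop :=
  ∃ b c d : ℤ, α 0 + α 1 + α 2 = b ∧ α 0 * α 1 + α 0 * α 2 + α 1 * α 2 = c ∧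
    α 0 * α 1 * α 2 = d

variable {α : Fin 3 → ℝ}

lemma HasIntegralEsymm.exists_int_eq_aeval (hα : HasIntegralEsymm α)
    {P : MvPolynomial (Fin 3) ℤ} (hP : P.IsSymmetric) : ∃ z : ℤ, aeval α P = z := by
  obtain ⟨p, hp⟩ := esymmAlgHom_surjective (σ := Fin 3) ℤ (n := 3) (by simp) ⟨P, hP⟩
  have hp' : P = aeval (fun i : Fin 3 ↦ esymm (Fin 3) ℤ (i + 1)) p := by
    rw [← esymmAlgHom_apply, hp]
  obtain ⟨b, c, d, hb, hc, hd⟩ := hα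
  have h1 : powersetCard 1 (univ : Finset (Fin 3)) = {{0}, {1}, {2}} := by decide
  have h2 : powersetCard 2 (univ : Finset (Fin 3)) = {{0, 1}, {0, 2}, {1, 2}} := by decide
  have h3 : powersetCard 3 (univ : Finset (Fin 3)) = {{0, 1, 2}} := by decide
  have he : (fun i : Fin 3 ↦ aeval α (esymm (Fin 3) ℤ (i + 1))) =
      fun i ↦ (algebraMap ℤ ℝ) (![b, c, d] i) := by
    funext i
    rw [esymm, map_sum]
    simp only [map_prod, aeval_X]
    fin_cases i
    · simp [h1, ← hb, add_assoc]
    · simp [h2, ← hc, add_assoc]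
      rw [Finset.sum_insert (by decide), Finset.sum_insert (by decide)]
      simp
    · simp [h3, ← hd, mul_assoc]
  refine ⟨aeval ![b, c, d] p, ?_⟩
  rw [hp', ← AlgHom.comp_apply, comp_aeval, he]
  exact aeval_algebraMap_apply ℝ ![b, c, d] p

lemma HasIntegralEsymm.one_le_abs_aeval_mul_pow (hα : HasIntegralEsymm α)
    {P : MvPolynomial (Fin 3) ℤ} {B : ℝ} (hB : 1 ≤ B) (hP : aeval α P ≠ 0)
    (hPB : ∀ σ : Perm (Fin 3), |aeval (α ∘ σ) P| ≤ B) : 1 ≤ |aeval α P| * B ^ 5 := by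
  classical
  set f : Perm (Fin 3) → MvPolynomial (Fin 3) ℤ := fun σ ↦ rename σ P with hf
  set S : Finset (Perm (Fin 3)) := univ.filter fun σ ↦ aeval (α ∘ σ) P ≠ 0 with hS
  have hsymm : (aeval f (esymm (Perm (Fin 3)) ℤ S.card)).IsSymmetric := by
    intro τ
    have h1 : rename τ (aeval f (esymm (Perm (Fin 3)) ℤ S.card)) =
        aeval f (rename (Equiv.mulLeft τ) (esymm (Perm (Fin 3)) ℤ S.card)) := by
      rw [← AlgHom.comp_apply, comp_aeval, aeval_rename]
      congr 2
      funext σ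
      simp [hf, rename_rename]
    rw [h1, esymm_isSymmetric]
  obtain ⟨z, hz⟩ := hα.exists_int_eq_aeval hsymm
  have hval : aeval α (aeval f (esymm (Perm (Fin 3)) ℤ S.card)) = ∏ σ ∈ S, aeval (α ∘ σ) P := by
    rw [esymm]
    simp only [map_sum, map_prod, aeval_X, hf, aeval_rename]
    refine Finset.sum_eq_single_of_mem S (by simp [mem_powersetCard]) ?_
    intro T hT hTS
    rw [mem_powersetCard] at hT
    obtain ⟨σ, hσT, hσS⟩ : ∃ σ ∈ T, σ ∉ S := by
      by_contra! h
      exact hTS (Finset.eq_of_subset_of_card_le h hT.2.ge)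
    refine Finset.prod_eq_zero hσT ?_
    simpa [hS] using hσS
  have hz1 : (1 : ℝ) ≤ |(z : ℝ)| := by
    have : (z : ℝ) ≠ 0 := by
      rw [← hz, hval, Finset.prod_ne_zero_iff]
      simp [hS]
    exact_mod_cast Int.one_le_abs (by exact_mod_cast this)
  have h1S : (1 : Perm (Fin 3)) ∈ S := by simpa [hS] using hP
  refine hz1.trans ?_
  rw [← hz, hval, ← Finset.mul_prod_erase S _ h1S, abs_mul, Finset.abs_prod]
  have hcard : (S.erase 1).card ≤ 5 := by
    rw [card_erase_of_mem h1S]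
    have : S.card ≤ 6 := (card_le_univ S).trans (by simp [Fintype.card_perm, Nat.factorial])
    omega
  have h2 : ∏ σ ∈ S.erase 1, |aeval (α ∘ σ) P| ≤ B ^ 5 := by
    refine (Finset.prod_le_prod (fun σ _ ↦ abs_nonneg _) fun σ _ ↦ hPB σ).trans ?_
    rw [prod_const]
    exact pow_le_pow_right₀ hB hcard
  exact mul_le_mul_of_nonneg_left h2 (abs_nonneg _)

end Integrality

end CubicThue

namespace CubicThue
open Finset

section IndependentUnits

variable {α : Fin 3 → ℝ} {x y z w ν : ℤ} {A B s ε δ : ℝ}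

lemma HasIntegralEsymm.exists_int_eq_sum_aeval (hα : HasIntegralEsymm α) (Q : Polynomial ℤ) :
    ∃ z : ℤ, ∑ i, Polynomial.aeval (α i) Q = z := by
  have hsymm : (∑ i, Polynomial.aeval (MvPolynomial.X i : MvPolynomial (Fin 3) ℤ)
      Q).IsSymmetric := by
    intro τ
    rw [map_sum]
    simp_rw [← Polynomial.aeval_algHom_apply, MvPolynomial.rename_X]
    exact Equiv.sum_comp τ fun i ↦ Polynomial.aeval (MvPolynomial.X i : MvPolynomial (Fin 3) ℤ) Q
  obtain ⟨z, hz⟩ := hα.exists_int_eq_aeval hsymm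
  refine ⟨z, ?_⟩
  rw [← hz, map_sum]
  simp_rw [← Polynomial.aeval_algHom_apply, MvPolynomial.aeval_X]

lemma HasIntegralEsymm.exists_polynomial_mul_eq (hα : HasIntegralEsymm α) (x y : ℤ) :
    ∃ Q : Polynomial ℤ, ∀ i, Polynomial.aeval (α i) Q * (x - α i * y) = ∏ j, (x - α j * y) := by
  obtain ⟨b, c, d, hb, hc, hd⟩ := hα
  refine ⟨(x : Polynomial ℤ) ^ 2 + (Polynomial.X - (b : Polynomial ℤ)) * (x : Polynomial ℤ) *
    (y : Polynomial ℤ) + ((c : Polynomial ℤ) - (b : Polynomial ℤ) * Polynomial.X +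
    Polynomial.X ^ 2) * (y : Polynomial ℤ) ^ 2, fun i ↦ ?_⟩
  simp only [map_add, map_mul, map_sub, map_pow, Polynomial.aeval_X, map_intCast,
    Fin.prod_univ_three, ← hb, ← hc]
  fin_cases i <;> simp only [Fin.zero_eta, Fin.mk_one, Fin.reduceFinMk] <;> ring

/-- The logarithms of the absolute values of the conjugates of a unit whose conjugates at the last
two places are close to each other. -/
noncomputable def logVec (A ε : ℝ) : Fin 3 → ℝ := ![-2 * A, A + ε / 2, A - ε / 2]

lemma logVec_linear (r t : ℝ) (i : Fin 3) :
    logVec (r * A + t * B) (r * ε + t * δ) i = r * logVec A ε i + t * logVec B δ i := by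
  fin_cases i <;> simp [logVec] <;> ring

lemma abs_logVec_le (A ε : ℝ) (i : Fin 3) : |logVec A ε i| ≤ 2 * |A| + |ε| / 2 := by
  have h1 := neg_abs_le A
  have h2 := le_abs_self A
  have h3 := neg_abs_le ε
  have h4 := le_abs_self ε
  rw [abs_le]
  fin_cases i <;> simp [logVec] <;> constructor <;> linarith

lemma logVec_sub_logVec_le (A ε : ℝ) (i j : Fin 3) :
    logVec A ε i - logVec A ε j ≤ 3 * |A| + |ε| := by
  have h1 := neg_abs_le A
  have h2 := le_abs_self A
  have h3 := neg_abs_le ε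
  have h4 := le_abs_self ε
  fin_cases i <;> fin_cases j <;> simp [logVec] <;> linarith

lemma sum_logVec (A ε : ℝ) : ∑ i, logVec A ε i = 0 := by
  simp [Fin.sum_univ_three, logVec]; ring

/-- A unit all of whose conjugates have absolute value close to `1` is trivial. -/
lemma logVec_eq_zero_of_sum_exp_eq_intCast {n : ℤ}
    (h : ∑ i, Real.exp (2 * logVec A ε i) = n) (hA : |A| ≤ 1 / 100) (hε : |ε| ≤ 1 / 100) (i) :
    logVec A ε i = 0 := by
  by_contra hi
  have hlow : (3 : ℝ) < n := by
    rw [← h]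
    calc (3 : ℝ) = ∑ i, (2 * logVec A ε i + 1) := by
          rw [sum_add_distrib, ← mul_sum, sum_logVec]; simp
      _ < ∑ i, Real.exp (2 * logVec A ε i) :=
          sum_lt_sum (fun j _ ↦ Real.add_one_le_exp _)
            ⟨i, mem_univ i, Real.add_one_lt_exp (by simpa using hi)⟩
  have hup : (n : ℝ) < 4 := by
    rw [← h]
    have hb : ∀ i, Real.exp (2 * logVec A ε i) ≤ 1.2 := by
      intro i
      have h1 := (abs_le.mp (abs_logVec_le A ε i)).2
      have h2 := Real.exp_bound_div_one_sub_of_interval (x := 0.1) (by norm_num) (by norm_num)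
      have h3 : Real.exp (2 * logVec A ε i) ≤ Real.exp 0.1 := Real.exp_le_exp.mpr (by linarith)
      norm_num at h2 ⊢
      linarith
    rw [Fin.sum_univ_three]
    linarith [hb 0, hb 1, hb 2]
  have h1 : (3 : ℤ) < n := by exact_mod_cast hlow
  have h2 : n < (4 : ℤ) := by exact_mod_cast hup
  omega

/-- The units attached to two solutions close to the same root generate a lattice whose covolume
is not too small. -/
lemma HasIntegralEsymm.one_le_mul_of_close (hα : HasIntegralEsymm α)
    (hν : ∏ i, (x - α i * y) = ν) (hν1 : |ν| = 1)
    (hu : ∀ i, |x - α i * y| = Real.exp (logVec A ε i))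
    (hv : ∀ i, |z - α i * w| = Real.exp (logVec B δ i))
    (hA : 1 ≤ A) (hB : 2 * A ≤ B) (hs : 0 < s) (hε : |ε| ≤ 1.1 * s) (hε' : 0.7 * s ≤ |ε|)
    (hδ : |δ| ≤ 1.1 * s) : 1 ≤ 10 ^ 5 * B * s := by
  by_contra! hsmall
  have hA0 : 0 < A := by linarith
  obtain ⟨k, j, hj0, hjn, hkj⟩ := Real.exists_int_int_abs_mul_sub_le (B / A) (n := ⌈100 * A⌉₊)
    (Nat.ceil_pos.mpr (by linarith))
  have hn1 : 100 * A ≤ ⌈100 * A⌉₊ := Nat.le_ceil _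
  have hn2 : (⌈100 * A⌉₊ : ℝ) ≤ 101 * A := by
    have := Nat.ceil_lt_add_one (show 0 ≤ 100 * A by linarith)
    linarith
  have hj0' : (1 : ℝ) ≤ j := by exact_mod_cast hj0
  have hjn' : (j : ℝ) ≤ 101 * A := le_trans (by exact_mod_cast hjn) hn2
  have hτ : |j * B + -k * A| ≤ 1 / 100 := by
    have h1 : j * B + -k * A = (j * (B / A) - k) * A := by field_simp; ring
    rw [h1, abs_mul, abs_of_pos hA0]
    calc _ ≤ 1 / ((⌈100 * A⌉₊ : ℝ) + 1) * A := by gcongr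
      _ ≤ 1 / (100 * A) * A := by gcongr; linarith
      _ = 1 / 100 := by field_simp
  have hτ' := abs_le.mp hτ
  have hk0 : (0 : ℝ) < k := by nlinarith
  have hkB : (k : ℝ) ≤ 102 * B := by nlinarith
  have hη : |j * δ + -k * ε| ≤ 1 / 100 := by
    calc |j * δ + -k * ε| ≤ |j * δ| + |-k * ε| := abs_add_le _ _
      _ = j * |δ| + k * |ε| := by
        rw [abs_mul, abs_mul, abs_neg, abs_of_pos hk0, abs_of_pos (by linarith : (0 : ℝ) < j)]
      _ ≤ (51 * B) * (1.1 * s) + (102 * B) * (1.1 * s) := by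
        have hj51 : (j : ℝ) ≤ 51 * B := by linarith
        have hB0 : 0 ≤ B := by linarith
        gcongr
      _ ≤ 1 / 100 := by nlinarith
  lift j to ℕ using hj0.le
  lift k to ℕ using (by exact_mod_cast hk0.le)
  push_cast at *
  obtain ⟨Q, hQ⟩ := hα.exists_polynomial_mul_eq x y
  obtain ⟨n, hn⟩ := hα.exists_int_eq_sum_aeval
    ((((z : Polynomial ℤ) - Polynomial.X * (w : Polynomial ℤ)) ^ j * Q ^ k) ^ 2)
  have hν1' : |(ν : ℝ)| = 1 := by exact_mod_cast hν1
  have hterm : ∀ i, Polynomial.aeval (α i)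
      ((((z : Polynomial ℤ) - Polynomial.X * (w : Polynomial ℤ)) ^ j * Q ^ k) ^ 2) =
      Real.exp (2 * logVec (j * B + -k * A) (j * δ + -k * ε) i) := by
    intro i
    have hQi : |Polynomial.aeval (α i) Q| = Real.exp (-logVec A ε i) := by
      have := congrArg abs (hQ i)
      rw [hν, hν1', abs_mul, hu] at this
      rw [Real.exp_neg]
      exact eq_inv_of_mul_eq_one_left this
    rw [map_pow, ← sq_abs, map_mul, abs_mul, map_pow, map_pow, abs_pow, abs_pow, hQi]
    simp only [map_sub, map_mul, Polynomial.aeval_X, map_intCast]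
    rw [hv, ← Real.exp_nat_mul, ← Real.exp_nat_mul, ← Real.exp_add, ← Real.exp_nat_mul,
      logVec_linear]
    congr 1
    push_cast
    ring
  simp_rw [hterm] at hn
  have h0 := logVec_eq_zero_of_sum_exp_eq_intCast hn hτ hη
  have e0 := h0 0
  have e1 := h0 1
  simp only [logVec, Matrix.cons_val_zero, Matrix.cons_val_one] at e0 e1
  have e2 : j * B = k * A := by linarith
  have e3 : j * δ = k * ε := by linarith
  have e4 : (2 : ℝ) * j ≤ k := by
    have : 2 * j * A ≤ k * A := by nlinarith
    exact le_of_mul_le_mul_right this hA0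
  have e5 : (j : ℝ) * |δ| = k * |ε| := by
    have := congrArg abs e3
    rwa [abs_mul, abs_mul, Nat.abs_cast, Nat.abs_cast] at this
  nlinarith

end IndependentUnits

end CubicThue

namespace CubicThue
open Finset

section ExponentialInterpolation

variable {n R k : ℕ}

lemma le_of_mem_blockNodes {t : ℕ} (ht : t ∈ blockNodes n R k) : t ≤ n * k + R - 1 := by
  have := mem_range.1 (mem_filter.1 ht).1
  omega

lemma div_le_of_mem_blockNodes {t : ℕ} (hR : R ≤ n) (ht : t ∈ blockNodes n R k) : t / n ≤ k := by
  have h := mem_range.1 (mem_filter.1 ht).1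
  have hn : 0 < n := by
    rcases Nat.eq_zero_or_pos n with rfl | hn
    · simp only [Nat.le_zero] at hR
      subst hR
      simp at h
    · exact hn
  rw [← Nat.lt_succ_iff, Nat.div_lt_iff_lt_mul hn, Nat.succ_mul]
  linarith [Nat.mul_comm n k]

/-- Integer coefficients for which the exponential sum over `blockNodes n R k` is small. -/
lemma exists_int_sum_exp_bounds (hR0 : 0 < R) (hR : R ≤ n) : ∃ C : ℕ → ℤ,
    (∀ t ∈ blockNodes n R k, |C t| ≤ 2 ^ ((n * k + n) * (2 * k + 1))) ∧
    ∀ κ : ℝ, 0 < κ → κ ^ (R * (k + 1) - 1) ≤ ∑ t ∈ blockNodes n R k, C t * Real.exp (t * κ) ∧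
      ∑ t ∈ blockNodes n R k, C t * Real.exp (t * κ) ≤
        2 ^ ((n * k + R) * k) * κ ^ (R * (k + 1) - 1) * Real.exp ((n * k + R) * κ) := by
  have hex : ∀ t, ∃ C : ℤ, t ∈ blockNodes n R k → (C : ℝ) =
      ((n * k + R - 1).factorial / (n - R).factorial ^ k : ℝ) *
        ddWeight ℝ (blockNodes n R k) t ∧ |C| ≤ 2 ^ ((n * k + n) * (2 * k + 1)) := by
    intro t
    by_cases ht : t ∈ blockNodes n R k
    · obtain ⟨C, hC⟩ := exists_int_eq_ddWeight_blockNodes hR0 hR ht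
      exact ⟨C, fun _ ↦ hC⟩
    · exact ⟨0, fun h ↦ absurd h ht⟩
  choose C hC using hex
  refine ⟨C, fun t ht ↦ (hC t ht).2, fun κ hκ ↦ ?_⟩
  set T := blockNodes n R k with hT
  have hcard : T.card = R * (k + 1) := card_blockNodes hR
  have hne : T.Nonempty := by rw [← card_pos, hcard]; positivity
  have hsum : ∑ t ∈ T, C t * Real.exp (t * κ) =
      ((n * k + R - 1).factorial / (n - R).factorial ^ k : ℝ) * ddExpReal T κ := by
    rw [ddExpReal, mul_sum]
    refine sum_congr rfl fun t ht ↦ ?_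
    rw [(hC t ht).1, mul_assoc]
  have hH : n * k + R - 1 = R * (k + 1) - 1 + k * (n - R) := by
    obtain ⟨m, rfl⟩ := Nat.exists_eq_add_of_le hR
    have h1 : (R + m) * k + R = R * (k + 1) + k * (R + m - R) := by
      rw [Nat.add_sub_cancel_left]; ring
    have h2 : 0 < R * (k + 1) := by positivity
    omega
  have hlow := pow_div_factorial_le_ddExpReal hκ.le hne
  have hup := norm_ddExp_le (fun t ht ↦ le_of_mem_blockNodes ht) hne (κ : ℂ)
  have hcast : ddExp T (κ : ℂ) = (ddExpReal T κ : ℝ) := by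
    simp [ddExp, ddExpReal, ddWeight_eq_inv_prod]
  rw [hcast, Complex.norm_real, Complex.norm_real, Real.norm_eq_abs, Real.norm_eq_abs,
    abs_of_pos hκ] at hup
  have hup := (le_abs_self _).trans hup
  rw [hcard] at hlow hup
  rw [hsum]
  have h1 := factorial_pow_mul_factorial_le (n - R) (R * (k + 1) - 1) k
  have h2 := factorial_add_mul_le (n - R) (R * (k + 1) - 1) k
  rw [← hH] at h1 h2
  have h1' : ((n - R).factorial : ℝ) ^ k * (R * (k + 1) - 1).factorial ≤
      (n * k + R - 1).factorial := by exact_mod_cast h1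
  have h2' : ((n * k + R - 1).factorial : ℝ) ≤ 2 ^ ((n * k + R - 1) * k) *
      ((n - R).factorial ^ k * (R * (k + 1) - 1).factorial) := by exact_mod_cast h2
  have p1 : (0 : ℝ) < (n - R).factorial := by positivity
  have p2 : (0 : ℝ) < (R * (k + 1) - 1).factorial := by positivity
  have p3 : (0 : ℝ) < (n * k + R - 1).factorial := by positivity
  generalize ((n - R).factorial : ℝ) = f1 at *
  generalize ((R * (k + 1) - 1).factorial : ℝ) = f2 at *
  generalize ((n * k + R - 1).factorial : ℝ) = f3 at *
  have p4 : 0 ≤ ddExpReal T κ := le_trans (by positivity) hlow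
  constructor
  · calc κ ^ (R * (k + 1) - 1) = (f1 ^ k * f2) / f1 ^ k * (κ ^ (R * (k + 1) - 1) / f2) := by
          field_simp
      _ ≤ f3 / f1 ^ k * ddExpReal T κ := by gcongr
  · calc f3 / f1 ^ k * ddExpReal T κ ≤ (2 ^ ((n * k + R - 1) * k) * (f1 ^ k * f2)) / f1 ^ k *
          (κ ^ (R * (k + 1) - 1) / f2 * Real.exp (((n * k + R - 1 : ℕ) : ℝ) * κ)) := by gcongr
      _ = 2 ^ ((n * k + R - 1) * k) * κ ^ (R * (k + 1) - 1) *
          Real.exp (((n * k + R - 1 : ℕ) : ℝ) * κ) := by field_simp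
      _ ≤ 2 ^ ((n * k + R) * k) * κ ^ (R * (k + 1) - 1) * Real.exp ((n * k + R) * κ) := by
          have h3 : ((n * k + R - 1 : ℕ) : ℝ) ≤ n * k + R := by
            exact_mod_cast Nat.sub_le (n * k + R) 1
          gcongr
          · norm_num
          · exact Nat.sub_le _ _

lemma abs_sum_exp_sub_le {C : ℕ → ℤ} {κ l K : ℝ} (hR : R ≤ n) (hκ : 0 < κ)
    (hC : ∀ t ∈ blockNodes n R k, |(C t : ℝ)| ≤ K) (hl : |l| * k ≤ 1) :
    |∑ t ∈ blockNodes n R k, C t * Real.exp (t * κ - (t / n : ℕ) * l) -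
      ∑ t ∈ blockNodes n R k, C t * Real.exp (t * κ)| ≤
      (R * (k + 1)) * (K * (Real.exp ((n * k + R) * κ) * (2 * (|l| * k)))) := by
  rw [← sum_sub_distrib]
  refine (abs_sum_le_sum_abs _ _).trans ?_
  have hcard : ((R * (k + 1) : ℕ) : ℝ) = (blockNodes n R k).card := by rw [card_blockNodes hR]
  push_cast at hcard
  rw [hcard, ← nsmul_eq_mul]
  refine sum_le_card_nsmul _ _ _ fun t ht ↦ ?_
  have hK : 0 ≤ K := (abs_nonneg _).trans (hC t ht)
  have ht1 : (t : ℝ) ≤ n * k + R := by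
    exact_mod_cast (le_of_mem_blockNodes ht).trans (Nat.sub_le _ _)
  have ht2 : ((t / n : ℕ) : ℝ) ≤ k := by exact_mod_cast div_le_of_mem_blockNodes hR ht
  have hx : |-((t / n : ℕ) * l)| ≤ |l| * k := by
    rw [abs_neg, abs_mul, Nat.abs_cast, mul_comm]
    gcongr
  rw [sub_eq_add_neg (t * κ), Real.exp_add,
    show C t * (Real.exp (t * κ) * Real.exp (-((t / n : ℕ) * l))) -
    C t * Real.exp (t * κ) = C t * (Real.exp (t * κ) * (Real.exp (-((t / n : ℕ) * l)) - 1)) by ring,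
    abs_mul, abs_mul, abs_of_pos (Real.exp_pos _)]
  have := Real.abs_exp_sub_one_le (hx.trans hl)
  gcongr
  · exact hC t ht
  · linarith

/-- A perturbed version of the exponential sum does not vanish. -/
lemma exists_int_sum_exp_perturbed (hR0 : 0 < R) (hR : R ≤ n) : ∃ C : ℕ → ℤ,
    (∀ t ∈ blockNodes n R k, |C t| ≤ 2 ^ ((n * k + n) * (2 * k + 1))) ∧
    ∀ κ l : ℝ, 0 < κ → |l| * k ≤ 1 →
      (R * (k + 1)) * (2 ^ ((n * k + n) * (2 * k + 1)) *
        (Real.exp ((n * k + R) * κ) * (2 * (|l| * k)))) ≤ κ ^ (R * (k + 1) - 1) / 2 →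
      0 < ∑ t ∈ blockNodes n R k, C t * Real.exp (t * κ - (t / n : ℕ) * l) ∧
      ∑ t ∈ blockNodes n R k, C t * Real.exp (t * κ - (t / n : ℕ) * l) ≤
        2 * (2 ^ ((n * k + R) * k) * κ ^ (R * (k + 1) - 1) * Real.exp ((n * k + R) * κ)) := by
  obtain ⟨C, hC, hsum⟩ := exists_int_sum_exp_bounds (k := k) hR0 hR
  refine ⟨C, hC, fun κ l hκ hl hsmall ↦ ?_⟩
  obtain ⟨h1, h2⟩ := hsum κ hκ
  have h3 := abs_le.mp ((abs_sum_exp_sub_le hR hκ (K := 2 ^ ((n * k + n) * (2 * k + 1)))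
    (fun t ht ↦ by exact_mod_cast hC t ht) hl).trans hsmall)
  have h4 : 0 < κ ^ (R * (k + 1) - 1) := by positivity
  constructor <;> linarith

end ExponentialInterpolation

end CubicThue

namespace CubicThue
open Finset

section Interpolation

variable {α : Fin 3 → ℝ} {x y z w ν μ : ℤ} {A B ε δ l : ℝ}

lemma div_eq_of_prod_eq_intCast {u : Fin 3 → ℝ} (h : ∏ i, u i = ν) (hν : |ν| = 1)
    (σ : Equiv.Perm (Fin 3)) : ν * u (σ 0) * u (σ 1) = (u (σ 2))⁻¹ := by
  have h1 : u (σ 0) * u (σ 1) * u (σ 2) = ν := by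
    rw [← h, ← Equiv.prod_comp σ, Fin.prod_univ_three]
  have h2 : (ν : ℝ) * ν = 1 := by
    rw [← Int.cast_mul, ← abs_mul_abs_self, hν]; norm_num
  apply eq_inv_of_mul_eq_one_left
  linear_combination ν * h1 + h2

/-- The integral lower bound for the exponential sums attached to two units. -/
lemma HasIntegralEsymm.one_le_abs_sum_mul_pow (hα : HasIntegralEsymm α)
    (hν : ∏ i, (x - α i * y) = ν) (hν1 : |ν| = 1) (hμ : ∏ i, (z - α i * w) = μ) (hμ1 : |μ| = 1)
    (hu : ∀ i, |x - α i * y| = Real.exp (logVec A ε i))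
    (hv : ∀ i, |z - α i * w| = Real.exp (logVec B δ i))
    (hq : x - α 1 * y = Real.exp ε * (x - α 2 * y))
    (hl : -((α 2 - α 0) * (z - α 1 * w)) = Real.exp l * ((α 0 - α 1) * (z - α 2 * w)))
    (ha1 : α 2 ≠ α 0) {a : ℝ} (ha0 : 0 ≤ a) (ha : ∀ i j, |α i - α j| ≤ Real.exp a) {n R k : ℕ}
    (hR0 : 0 < R) (hR : R ≤ n)
    {C : ℕ → ℤ} {K : ℝ} (hK : 1 ≤ K) (hC : ∀ t ∈ blockNodes n R k, |(C t : ℝ)| ≤ K)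
    (hS : 0 < ∑ t ∈ blockNodes n R k, C t * Real.exp (t * ε - (t / n : ℕ) * l)) :
    1 ≤ Real.exp (k * a) *
      (∑ t ∈ blockNodes n R k, C t * Real.exp (t * ε - (t / n : ℕ) * l)) *
      (R * (k + 1) * (K * Real.exp (R * (3 * |A| + |ε|) + k * (3 * |B - n * A| + |δ - n * ε|) +
        k * a))) ^ 5 := by
  set U : Fin 3 → MvPolynomial (Fin 3) ℤ := fun i ↦
    (x : MvPolynomial (Fin 3) ℤ) - MvPolynomial.X i * (y : MvPolynomial (Fin 3) ℤ) with hU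
  set V : Fin 3 → MvPolynomial (Fin 3) ℤ := fun i ↦
    (z : MvPolynomial (Fin 3) ℤ) - MvPolynomial.X i * (w : MvPolynomial (Fin 3) ℤ) with hV
  set P : MvPolynomial (Fin 3) ℤ := ∑ t ∈ blockNodes n R k, (C t : MvPolynomial (Fin 3) ℤ) *
    ((U 1 * ((ν : MvPolynomial (Fin 3) ℤ) * U 0 * U 1)) ^ t *
      (V 2 * ((μ : MvPolynomial (Fin 3) ℤ) * V 0 * V 2)) ^ (t / n) *
      ((MvPolynomial.X 1 - MvPolynomial.X 0) ^ (t / n) *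
        (MvPolynomial.X 2 - MvPolynomial.X 0) ^ (k - t / n))) with hP
  have hval : ∀ σ : Equiv.Perm (Fin 3), MvPolynomial.aeval (α ∘ σ) P =
      ∑ t ∈ blockNodes n R k, C t *
        (((x - α (σ 1) * y) * (x - α (σ 2) * y)⁻¹) ^ t *
          ((z - α (σ 2) * w) * (z - α (σ 1) * w)⁻¹) ^ (t / n) *
          ((α (σ 1) - α (σ 0)) ^ (t / n) * (α (σ 2) - α (σ 0)) ^ (k - t / n))) := by
    intro σ
    have h1 := div_eq_of_prod_eq_intCast hν hν1 σ
    have h2 := div_eq_of_prod_eq_intCast hμ hμ1 (σ * Equiv.swap 1 2)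
    have e0 : (Equiv.swap (1 : Fin 3) 2) 0 = 0 := by decide
    have e1 : (Equiv.swap (1 : Fin 3) 2) 1 = 2 := by decide
    have e2 : (Equiv.swap (1 : Fin 3) 2) 2 = 1 := by decide
    simp only [Equiv.Perm.mul_apply, e0, e1, e2] at h2
    simp only [hP, hU, hV, map_sum, map_mul, map_pow, map_sub, map_intCast, MvPolynomial.aeval_X,
      Function.comp_apply, h1, h2]
  have hu0 : ∀ i, x - α i * y ≠ 0 := fun i h ↦ by
    have := hu i; rw [h, abs_zero] at this; exact (Real.exp_ne_zero _) this.symm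
  have hv0 : ∀ i, z - α i * w ≠ 0 := fun i h ↦ by
    have := hv i; rw [h, abs_zero] at this; exact (Real.exp_ne_zero _) this.symm
  have hid : MvPolynomial.aeval α P = (α 2 - α 0) ^ k *
      ∑ t ∈ blockNodes n R k, C t * Real.exp (t * ε - (t / n : ℕ) * l) := by
    have h1 := hval 1
    simp only [Equiv.Perm.coe_one, Function.comp_id, id_eq] at h1
    rw [h1, mul_sum]
    refine sum_congr rfl fun t ht ↦ ?_
    have hk := div_le_of_mem_blockNodes hR ht
    generalize t / n = m at *
    have h2 : (x - α 1 * y) * (x - α 2 * y)⁻¹ = Real.exp ε := by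
      rw [hq, mul_inv_cancel_right₀ (hu0 2)]
    have h3 : (z - α 2 * w) * (z - α 1 * w)⁻¹ * (α 1 - α 0) = (α 2 - α 0) * (Real.exp l)⁻¹ := by
      have h4 := hv0 1
      have h5 := Real.exp_ne_zero l
      generalize (z - α 1 * w : ℝ) = v at *
      generalize (z - α 2 * w : ℝ) = v' at *
      field_simp
      linear_combination hl
    calc C t * (((x - α 1 * y) * (x - α 2 * y)⁻¹) ^ t * ((z - α 2 * w) * (z - α 1 * w)⁻¹) ^ m *
          ((α 1 - α 0) ^ m * (α 2 - α 0) ^ (k - m)))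
        = C t * (Real.exp ε ^ t * (((z - α 2 * w) * (z - α 1 * w)⁻¹ * (α 1 - α 0)) ^ m *
          (α 2 - α 0) ^ (k - m))) := by rw [h2, mul_pow _ (α 1 - α 0)]; ring
      _ = _ := by
        rw [h3, Real.exp_sub, Real.exp_nat_mul, Real.exp_nat_mul,
          show (α 2 - α 0) ^ k = (α 2 - α 0) ^ m * (α 2 - α 0) ^ (k - m) by
            rw [← pow_add, Nat.add_sub_cancel' hk], mul_pow, inv_pow]
        ring
  set E : ℝ := R * (3 * |A| + |ε|) + k * (3 * |B - n * A| + |δ - n * ε|) + k * a with hE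
  have hE0 : 0 ≤ E := by positivity
  have hbd : ∀ σ : Equiv.Perm (Fin 3), |MvPolynomial.aeval (α ∘ σ) P| ≤
      R * (k + 1) * (K * Real.exp E) := by
    intro σ
    rw [hval]
    refine (abs_sum_le_sum_abs _ _).trans ?_
    have hcard : (R * (k + 1) : ℝ) = ((blockNodes n R k).card : ℝ) := by
      rw [card_blockNodes hR]; push_cast; ring
    rw [hcard, ← nsmul_eq_mul]
    refine sum_le_card_nsmul _ _ _ fun t ht ↦ ?_
    rw [abs_mul]
    refine mul_le_mul (hC t ht) ?_ (abs_nonneg _) (by linarith)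
    have hk := div_le_of_mem_blockNodes hR ht
    have hmod : t % n < R := (mem_filter.1 ht).2
    have hdm : (t : ℝ) = n * (t / n : ℕ) + (t % n : ℕ) := by
      exact_mod_cast (Nat.div_add_mod t n).symm
    generalize t / n = m at *
    generalize t % n = r at *
    simp only [abs_mul, abs_pow, abs_inv, hu, hv]
    have h1 : ∀ j, |α (σ j) - α (σ 0)| ≤ Real.exp a := fun j ↦ ha _ _
    have h2 : |α (σ 1) - α (σ 0)| ^ m * |α (σ 2) - α (σ 0)| ^ (k - m) ≤ Real.exp (k * a) := by
      calc _ ≤ Real.exp a ^ m * Real.exp a ^ (k - m) := by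
            gcongr <;> exact h1 _
        _ = _ := by rw [← pow_add, Nat.add_sub_cancel' hk, Real.exp_nat_mul]
    refine (mul_le_mul_of_nonneg_left h2 (by positivity)).trans ?_
    rw [← Real.exp_neg, ← Real.exp_neg, ← Real.exp_add, ← Real.exp_add, ← Real.exp_nat_mul,
      ← Real.exp_nat_mul, ← Real.exp_add, ← Real.exp_add, Real.exp_le_exp, hE]
    have h3 := logVec_sub_logVec_le A ε (σ 1) (σ 2)
    have h4 := logVec_sub_logVec_le (B - n * A) (δ - n * ε) (σ 2) (σ 1)
    have h5 := logVec_linear (A := A) (B := B) (ε := ε) (δ := δ) (-(n : ℝ)) 1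
    have h6 : ∀ i, logVec (B - n * A) (δ - n * ε) i = logVec B δ i - n * logVec A ε i := by
      intro i
      have := h5 i
      rw [show -(n : ℝ) * A + 1 * B = B - n * A by ring,
        show -(n : ℝ) * ε + 1 * δ = δ - n * ε by ring] at this
      rw [this]; ring
    rw [h6, h6] at h4
    have h7 : (r : ℝ) ≤ R := by exact_mod_cast hmod.le
    have h8 : (m : ℝ) ≤ k := by exact_mod_cast hk
    have h9 : (r : ℝ) * (logVec A ε (σ 1) - logVec A ε (σ 2)) ≤ R * (3 * |A| + |ε|) :=
      (mul_le_mul_of_nonneg_left h3 (by positivity)).trans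
        (mul_le_mul_of_nonneg_right h7 (by positivity))
    have h10 := (mul_le_mul_of_nonneg_left h4 (Nat.cast_nonneg (α := ℝ) m)).trans
        (mul_le_mul_of_nonneg_right h8 (by positivity))
    rw [hdm]
    linarith
  have hRk : (1 : ℝ) ≤ R * (k + 1) := by
    exact_mod_cast Nat.mul_pos hR0 (Nat.succ_pos k)
  have h1 : 1 ≤ R * (k + 1) * (K * Real.exp E) :=
    one_le_mul_of_one_le_of_one_le hRk
      (one_le_mul_of_one_le_of_one_le hK (Real.one_le_exp hE0))
  have h2 : MvPolynomial.aeval α P ≠ 0 := by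
    rw [hid]
    exact mul_ne_zero (pow_ne_zero _ (sub_ne_zero.mpr ha1)) hS.ne'
  refine (hα.one_le_abs_aeval_mul_pow h1 h2 hbd).trans ?_
  rw [hid, abs_mul, abs_of_pos hS, abs_pow, Real.exp_nat_mul]
  gcongr
  exact ha 2 0

end Interpolation

end CubicThue

namespace CubicThue
open Finset

lemma two_pow_le_exp (m : ℕ) : (2 : ℝ) ^ m ≤ Real.exp m := by
  rw [show (m : ℝ) = m * 1 by ring, Real.exp_nat_mul]
  exact pow_le_pow_left₀ (by norm_num) (by have := Real.add_one_le_exp (1 : ℝ); linarith) m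

lemma exists_nat_quotients {A B : ℝ} (hA : 0 < A) (hAB : 10 ^ 10 * A ≤ B) :
    ∃ n R : ℕ, R ≤ n ∧ (10 ^ 5 : ℝ) ≤ R ∧ (10 ^ 5 : ℝ) * R ≤ n ∧ (n : ℝ) ≤ 100001 * R ∧
      n * A ≤ B ∧ B ≤ (n + 1) * A := by
  have h0 : 10 ^ 10 ≤ B / A := by rwa [le_div_iff₀ hA]
  have h1 : 10 ^ 10 ≤ ⌊B / A⌋₊ := Nat.le_floor (by exact_mod_cast h0)
  have h2 := Nat.floor_le (show 0 ≤ B / A by linarith)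
  have h3 := (Nat.lt_floor_add_one (B / A)).le
  rw [le_div_iff₀ hA] at h2
  rw [div_le_iff₀ hA] at h3
  generalize ⌊B / A⌋₊ = n at *
  refine ⟨n, n / 10 ^ 5, by omega, ?_, ?_, ?_, h2, h3⟩
  · exact_mod_cast (show 10 ^ 5 ≤ n / 10 ^ 5 by omega)
  · exact_mod_cast (show 10 ^ 5 * (n / 10 ^ 5) ≤ n by omega)
  · exact_mod_cast (show n ≤ 100001 * (n / 10 ^ 5) by omega)

section Interpolation

variable {α : Fin 3 → ℝ} {x y z w ν μ : ℤ} {A B ε δ l ℓ : ℝ}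

/-- Three close solutions are impossible: the sign-normalised version. -/
lemma HasIntegralEsymm.false_of_close_of_pos (hα : HasIntegralEsymm α)
    (hν : ∏ i, (x - α i * y) = ν) (hν1 : |ν| = 1) (hμ : ∏ i, (z - α i * w) = μ) (hμ1 : |μ| = 1)
    (hu : ∀ i, |x - α i * y| = Real.exp (logVec A ε i))
    (hv : ∀ i, |z - α i * w| = Real.exp (logVec B δ i))
    (hq : x - α 1 * y = Real.exp ε * (x - α 2 * y))
    (hl : -((α 2 - α 0) * (z - α 1 * w)) = Real.exp l * ((α 0 - α 1) * (z - α 2 * w)))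
    (ha1 : α 2 ≠ α 0) (ha : ∀ i j, |α i - α j| ≤ Real.exp (8 * ℓ))
    (hℓ : 10 ^ 14 ≤ ℓ) (hε : Real.exp (-22.5 * ℓ) ≤ ε) (hε' : ε ≤ Real.exp (-0.19 * ℓ))
    (hδ : |δ| ≤ 1) (hA : ℓ / 5 ≤ A) (hA' : A ≤ 7 * ℓ) (hB : 10 ^ 10 * A ≤ B)
    (hl3 : |l| ≤ Real.exp (-3 * B)) : False := by
  have hA0 : 0 < A := by linarith
  obtain ⟨n, R, hRn, hR5, hn, hn', hnB, hnB'⟩ := exists_nat_quotients hA0 hB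
  obtain ⟨k, hk⟩ : ∃ k : ℕ, k = 999 := ⟨_, rfl⟩
  have hkr : (k : ℝ) = 999 := by rw [hk]; norm_num
  have hR0 : 0 < R := by
    have : (0 : ℝ) < R := by linarith
    exact_mod_cast this
  have hε0 : 0 < ε := (Real.exp_pos _).trans_le hε
  have hε1 : ε ≤ 1 := hε'.trans (by rw [Real.exp_le_one_iff]; linarith)
  obtain ⟨C, hC, hsum⟩ := exists_int_sum_exp_perturbed (k := k) hR0 hRn
  set M : ℕ := R * (k + 1) - 1 with hM
  have hMr : (M : ℝ) = 1000 * R - 1 := by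
    rw [hM, Nat.cast_sub (Nat.mul_pos hR0 (Nat.succ_pos k))]
    push_cast
    rw [hkr]; ring
  set K : ℝ := 2 ^ ((n * k + n) * (2 * k + 1)) with hKdef
  have hK1 : 1 ≤ K := one_le_pow₀ (by norm_num)
  have hKe : K ≤ Real.exp (2 * 10 ^ 11 * R) := by
    refine (two_pow_le_exp _).trans (Real.exp_le_exp.mpr ?_)
    push_cast
    rw [hkr]
    linarith
  have hRℓ : 10 ^ 14 * R ≤ R * ℓ := by
    rw [mul_comm]; exact mul_le_mul_of_nonneg_left hℓ (by positivity)
  have hRℓ' : 10 ^ 5 * ℓ ≤ R * ℓ := mul_le_mul_of_nonneg_right hR5 (by linarith)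
  have hnA : 20000 * (R * ℓ) ≤ n * A := by
    calc 20000 * (R * ℓ) = (10 ^ 5 * R) * (ℓ / 5) := by ring
      _ ≤ n * A := mul_le_mul hn hA (by linarith) (by positivity)
  have hRexp : (R : ℝ) * (k + 1) ≤ Real.exp (1000 * R) := by
    rw [hkr]
    have := Real.add_one_le_exp (1000 * (R : ℝ))
    linarith
  have hεn : (n * k + R) * ε ≤ 10 ^ 9 * R := by
    rw [hkr]
    have : (0 : ℝ) ≤ n * 999 + R := by positivity
    calc _ ≤ (n * 999 + R : ℝ) * 1 := mul_le_mul_of_nonneg_left hε1 this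
      _ ≤ _ := by linarith
  have h1998 : (1998 : ℝ) ≤ Real.exp 1997 := by
    have := Real.add_one_le_exp (1997 : ℝ)
    linarith
  have hlk : 2 * (|l| * k) ≤ Real.exp (1997 - 60000 * (R * ℓ)) := by
    rw [hkr]
    calc 2 * (|l| * 999) = 1998 * |l| := by ring
      _ ≤ Real.exp 1997 * Real.exp (-3 * B) := by gcongr
      _ ≤ _ := by
        rw [← Real.exp_add, Real.exp_le_exp]; linarith
  have hlk1 : |l| * k ≤ 1 := by
    have : Real.exp (1997 - 60000 * (R * ℓ)) ≤ 1 := by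
      rw [Real.exp_le_one_iff]; linarith
    have h0 : 0 ≤ |l| * k := by positivity
    linarith
  have herr : (R * (k + 1)) * (K * (Real.exp ((n * k + R) * ε) * (2 * (|l| * k)))) ≤ ε ^ M / 2 := by
    have hlow : Real.exp (-22.5 * ℓ * M - 1) ≤ ε ^ M / 2 := by
      rw [sub_eq_add_neg, Real.exp_add, mul_comm (-22.5 * ℓ), Real.exp_nat_mul, div_eq_mul_inv]
      gcongr
      rw [Real.exp_neg]
      gcongr
      have := Real.add_one_le_exp (1 : ℝ)
      linarith
    refine le_trans ?_ hlow
    calc _ ≤ Real.exp (1000 * R) * (Real.exp (2 * 10 ^ 11 * R) * (Real.exp (10 ^ 9 * R) *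
          Real.exp (1997 - 60000 * (R * ℓ)))) := by gcongr
      _ ≤ _ := by
        rw [← Real.exp_add, ← Real.exp_add, ← Real.exp_add, Real.exp_le_exp, hMr]
        linarith
  obtain ⟨hS0, hS⟩ := hsum ε l hε0 hlk1 herr
  have hmain := hα.one_le_abs_sum_mul_pow hν hν1 hμ hμ1 hu hv hq hl ha1
    (a := 8 * ℓ) (by linarith) ha hR0 hRn hK1 (fun t ht ↦ by
      rw [hKdef]; exact_mod_cast hC t ht) hS0
  have hS' : ∑ t ∈ blockNodes n R k, C t * Real.exp (t * ε - (t / n : ℕ) * l) ≤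
      Real.exp (1 + 2 * 10 ^ 11 * R - 0.19 * ℓ * (1000 * R - 1) + 10 ^ 9 * R) := by
    refine hS.trans ?_
    have h1 : (2 : ℝ) ^ ((n * k + R) * k) ≤ Real.exp (2 * 10 ^ 11 * R) := by
      refine (two_pow_le_exp _).trans (Real.exp_le_exp.mpr ?_)
      push_cast
      rw [hkr]
      linarith
    have h2 : ε ^ M ≤ Real.exp (- 0.19 * ℓ * (1000 * R - 1)) := by
      rw [← hMr, mul_comm _ (M : ℝ), Real.exp_nat_mul]
      gcongr
    have h3 : (2 : ℝ) ≤ Real.exp 1 := by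
      have := Real.add_one_le_exp (1 : ℝ)
      linarith
    calc _ ≤ Real.exp 1 * (Real.exp (2 * 10 ^ 11 * R) * Real.exp (- 0.19 * ℓ * (1000 * R - 1)) *
          Real.exp (10 ^ 9 * R)) := by gcongr
      _ = _ := by
        rw [← Real.exp_add, ← Real.exp_add, ← Real.exp_add]
        ring_nf
  have hE : R * (3 * |A| + |ε|) + k * (3 * |B - n * A| + |δ - n * ε|) + k * (8 * ℓ) ≤
      21.5 * (R * ℓ) + 10 ^ 9 * R := by
    have h1 : |B - n * A| ≤ 7 * ℓ := by
      rw [abs_le]; constructor <;> linarith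
    have h2 : |δ - n * ε| ≤ 1 + n := by
      have h3 : (n : ℝ) * ε ≤ n * 1 := mul_le_mul_of_nonneg_left hε1 (by positivity)
      have h4 : 0 ≤ n * ε := by positivity
      rw [abs_le] at hδ ⊢
      constructor <;> linarith [hδ.1, hδ.2]
    have h5 : (R : ℝ) * (3 * |A| + |ε|) ≤ R * (21 * ℓ + 1) := by
      rw [abs_of_pos hA0, abs_of_pos hε0]
      exact mul_le_mul_of_nonneg_left (by linarith) (by positivity)
    rw [hkr]
    linarith
  have hP : (R * (k + 1) * (K * Real.exp (R * (3 * |A| + |ε|) + k * (3 * |B - n * A| +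
      |δ - n * ε|) + k * (8 * ℓ)))) ^ 5 ≤
      Real.exp (5 * (1000 * R + 2 * 10 ^ 11 * R + (21.5 * (R * ℓ) + 10 ^ 9 * R))) := by
    rw [show (5 : ℝ) = (5 : ℕ) by norm_num, Real.exp_nat_mul]
    refine pow_le_pow_left₀ (by positivity) ?_ 5
    rw [add_assoc (1000 * (R : ℝ)), Real.exp_add (1000 * (R : ℝ)),
      Real.exp_add (2 * 10 ^ 11 * (R : ℝ))]
    exact mul_le_mul hRexp (mul_le_mul hKe (Real.exp_le_exp.mpr hE) (Real.exp_nonneg _)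
      (Real.exp_nonneg _)) (by positivity) (Real.exp_nonneg _)
  have hfin : Real.exp (k * (8 * ℓ)) * Real.exp (1 + 2 * 10 ^ 11 * R - 0.19 * ℓ * (1000 * R - 1) +
      10 ^ 9 * R) * Real.exp (5 * (1000 * R + 2 * 10 ^ 11 * R + (21.5 * (R * ℓ) + 10 ^ 9 * R))) <
      1 := by
    rw [← Real.exp_add, ← Real.exp_add, Real.exp_lt_one_iff, hkr]
    linarith
  have h0 : (0 : ℝ) ≤ R * (k + 1) * (K * Real.exp (R * (3 * |A| + |ε|) + k * (3 * |B - n * A| +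
      |δ - n * ε|) + k * (8 * ℓ))) := by positivity
  refine absurd (hmain.trans ?_) (not_le.mpr hfin)
  gcongr

end Interpolation

end CubicThue

namespace CubicThue
open Finset

section Interpolation

variable {α : Fin 3 → ℝ} {x y z w ν μ : ℤ} {A B ε δ l ℓ : ℝ}

lemma HasIntegralEsymm.swap (hα : HasIntegralEsymm α) :
    HasIntegralEsymm (α ∘ Equiv.swap 1 2) := by
  obtain ⟨b, c, d, hb, hc, hd⟩ := hα
  have e0 : (Equiv.swap (1 : Fin 3) 2) 0 = 0 := by decide
  have e1 : (Equiv.swap (1 : Fin 3) 2) 1 = 2 := by decide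
  have e2 : (Equiv.swap (1 : Fin 3) 2) 2 = 1 := by decide
  refine ⟨b, c, d, ?_, ?_, ?_⟩ <;> simp only [Function.comp_apply, e0, e1, e2]
  · linarith
  · linarith
  · rw [← hd]; ring

lemma logVec_swap (A ε : ℝ) (i : Fin 3) :
    logVec A (-ε) i = logVec A ε (Equiv.swap 1 2 i) := by
  have e0 : (Equiv.swap (1 : Fin 3) 2) 0 = 0 := by decide
  have e1 : (Equiv.swap (1 : Fin 3) 2) 1 = 2 := by decide
  have e2 : (Equiv.swap (1 : Fin 3) 2) 2 = 1 := by decide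
  fin_cases i <;> simp [logVec, e0, e1, e2] <;> ring

lemma HasIntegralEsymm.false_of_close (hα : HasIntegralEsymm α)
    (hν : ∏ i, (x - α i * y) = ν) (hν1 : |ν| = 1) (hμ : ∏ i, (z - α i * w) = μ) (hμ1 : |μ| = 1)
    (hu : ∀ i, |x - α i * y| = Real.exp (logVec A ε i))
    (hv : ∀ i, |z - α i * w| = Real.exp (logVec B δ i))
    (hq : x - α 1 * y = Real.exp ε * (x - α 2 * y))
    (hl : -((α 2 - α 0) * (z - α 1 * w)) = Real.exp l * ((α 0 - α 1) * (z - α 2 * w)))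
    (ha1 : α 1 ≠ α 0) (ha2 : α 2 ≠ α 0) (ha : ∀ i j, |α i - α j| ≤ Real.exp (8 * ℓ))
    (hℓ : 10 ^ 14 ≤ ℓ) (hε : Real.exp (-22.5 * ℓ) ≤ |ε|) (hε' : |ε| ≤ Real.exp (-0.19 * ℓ))
    (hδ : |δ| ≤ 1) (hA : ℓ / 5 ≤ A) (hA' : A ≤ 7 * ℓ) (hB : 10 ^ 10 * A ≤ B)
    (hl3 : |l| ≤ Real.exp (-3 * B)) : False := by
  rcases le_total 0 ε with h | h
  · rw [abs_of_nonneg h] at hε hε'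
    exact hα.false_of_close_of_pos hν hν1 hμ hμ1 hu hv hq hl ha2 ha hℓ hε hε' hδ hA hA' hB hl3
  · rw [abs_of_nonpos h] at hε hε'
    have e0 : (Equiv.swap (1 : Fin 3) 2) 0 = 0 := by decide
    have e1 : (Equiv.swap (1 : Fin 3) 2) 1 = 2 := by decide
    have e2 : (Equiv.swap (1 : Fin 3) 2) 2 = 1 := by decide
    refine hα.swap.false_of_close_of_pos (x := x) (y := y) (z := z) (w := w) (ν := ν) (μ := μ)
      (A := A) (B := B) (ε := -ε) (δ := -δ) (l := -l) (ℓ := ℓ) ?_ hν1 ?_ hμ1 ?_ ?_ ?_ ?_ ?_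
      (fun i j ↦ ha _ _) hℓ hε hε' (by rwa [abs_neg]) hA hA' hB (by rwa [abs_neg])
    · rw [← hν, ← Equiv.prod_comp (Equiv.swap 1 2)]; rfl
    · rw [← hμ, ← Equiv.prod_comp (Equiv.swap 1 2)]; rfl
    · exact fun i ↦ by rw [logVec_swap, ← hu]; rfl
    · exact fun i ↦ by rw [logVec_swap, ← hv]; rfl
    · simp only [Function.comp_apply, e1, e2]
      rw [hq, ← mul_assoc, ← Real.exp_add]; simp
    · simp only [Function.comp_apply, e0, e1, e2]
      have : Real.exp (-l) * Real.exp l = 1 := by rw [← Real.exp_add]; simp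
      linear_combination (-Real.exp (-l)) * hl - (α 0 - α 1) * (z - α 2 * w) * this
    · simpa only [Function.comp_apply, e0, e2] using ha1

/-- The logarithm of the ratio of two nearby numbers is comparable to their relative distance. -/
lemma abs_log_div_bounds {X Y τ : ℝ} (h : 0 < X * Y) (hτ : 0 ≤ τ)
    (hXY : (X - Y) ^ 2 = τ ^ 2 * (X * Y)) :
    |Real.log (X / Y)| ≤ τ ∧ (τ ≤ 1 / 10 → τ / 1.1 ≤ |Real.log (X / Y)|) := by
  have hY : Y ≠ 0 := by rintro rfl; simp at h
  have hr : 0 < X / Y := by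
    rw [show X / Y = X * Y / (Y * Y) by field_simp]
    exact div_pos h (mul_self_pos.mpr hY)
  set t := Real.log (X / Y) / 2 with ht
  have hX : X = Real.exp t * Real.exp t * Y := by
    rw [← Real.exp_add, ht, add_halves, Real.exp_log hr]; field_simp
  have hsinh : 2 * Real.sinh |t| = τ := by
    have h1 : (2 * Real.sinh |t|) ^ 2 = τ ^ 2 := by
      have h2 : (Real.sinh |t|) ^ 2 = (Real.sinh t) ^ 2 := by
        rw [← Real.abs_sinh, sq_abs]
      have h3 : Real.exp t * Real.exp (-t) = 1 := by rw [← Real.exp_add]; simp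
      have h4 : Real.exp t * Y ≠ 0 := mul_ne_zero (Real.exp_ne_zero _) hY
      rw [mul_pow, h2, Real.sinh_eq]
      apply mul_right_cancel₀ (pow_ne_zero 2 h4)
      have h5 : (Real.exp t - Real.exp (-t)) * (Real.exp t * Y) = X - Y := by
        rw [hX]; linear_combination (-Y) * h3
      calc _ = ((Real.exp t - Real.exp (-t)) * (Real.exp t * Y)) ^ 2 := by ring
        _ = _ := by rw [h5, hXY, hX]; ring
    have h2 : 0 ≤ 2 * Real.sinh |t| := by
      have := Real.sinh_nonneg_iff.mpr (abs_nonneg t); linarith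
    exact (pow_left_inj₀ h2 hτ two_ne_zero).mp h1
  have hlog : |Real.log (X / Y)| = 2 * |t| := by
    rw [ht, abs_div]; norm_num; ring
  rw [hlog]
  have hle := Real.self_le_sinh_iff.mpr (abs_nonneg t)
  refine ⟨by linarith, fun h10 ↦ ?_⟩
  have h0 := abs_nonneg t
  have h1 := Real.exp_bound_div_one_sub_of_interval h0 (by linarith)
  have h2 := Real.add_one_le_exp (-|t|)
  have h3 : 1 / (1 - |t|) ≤ 1 + 1.1 * |t| := by
    rw [div_le_iff₀ (by linarith)]; nlinarith
  have h4 := h1.trans h3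
  rw [← hsinh, Real.sinh_eq, div_le_iff₀ (by norm_num)]
  linarith

end Interpolation

end CubicThue

namespace CubicThue
open Finset

section Interpolation

variable {α : Fin 3 → ℝ} {x y z w ν μ : ℤ} {ℓ : ℝ}

lemma log_abs_conj_eq_logVec {u : Fin 3 → ℝ} (h : ∏ i, u i = ν) (hν : |ν| = 1) (i : Fin 3) :
    |u i| = Real.exp (logVec ((Real.log (u 1) + Real.log (u 2)) / 2)
      (Real.log (u 1) - Real.log (u 2)) i) := by
  have hν0 : (ν : ℝ) ≠ 0 := by
    have : ν ≠ 0 := by rintro rfl; simp at hν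
    exact_mod_cast this
  have hu : ∀ i, u i ≠ 0 := fun i ↦ by
    rw [← h] at hν0
    exact prod_ne_zero_iff.mp hν0 i (mem_univ i)
  have hlog : Real.log (u 0) + Real.log (u 1) + Real.log (u 2) = 0 := by
    rw [← Real.log_mul (hu 0) (hu 1), ← Real.log_mul (mul_ne_zero (hu 0) (hu 1)) (hu 2),
      ← Fin.prod_univ_three, h, ← Real.log_abs, ← Int.cast_abs, hν]
    simp
  rw [← Real.exp_log_eq_abs (hu i), Real.exp_eq_exp]
  fin_cases i <;> simp [logVec] <;> linarith

lemma abs_le_of_mul_eq_of_abs_sub_le {X Y Q : ℝ} (h : X * Y = Q) (hQ : 0 ≤ Q) (hXY : |X - Y| ≤ 3) :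
    |X| ≤ Q + 3 := by
  by_contra! h1
  have h2 : |X| ^ 2 ≤ Q + 3 * |X| := by
    calc |X| ^ 2 = Q + X * (X - Y) := by rw [sq_abs, ← h]; ring
      _ ≤ Q + |X| * |X - Y| := by rw [← abs_mul]; gcongr; exact le_abs_self _
      _ ≤ Q + |X| * 3 := by gcongr
      _ = _ := by ring
  nlinarith

lemma exp_neg_three_mul_le {C : ℝ} (hC : 1 ≤ C) : Real.exp (-3 * C) ≤ 0.1 := by
  have h4 : Real.exp (-3 * C) ≤ Real.exp (-1) ^ 3 := by
    rw [← Real.exp_nat_mul, Real.exp_le_exp]; push_cast; linarith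
  have h5 : Real.exp (-1) ≤ 0.4 := by
    rw [Real.exp_neg, inv_le_comm₀ (Real.exp_pos _) (by norm_num)]
    have := Real.exp_one_gt_d9
    norm_num at this ⊢
    linarith
  have h6 : Real.exp (-1) ^ 3 ≤ 0.4 ^ 3 := pow_le_pow_left₀ (Real.exp_nonneg _) h5 3
  refine h4.trans (h6.trans ?_)
  norm_num

lemma mul_le_of_one_le_mul {A B s : ℝ} (hℓ : 10 ^ 14 ≤ ℓ) (hA : A ≤ 7 * ℓ) (hB : 0 ≤ B)
    (hs : s ≤ Real.exp (- ℓ / 4 + 1.5)) (h : 1 ≤ 10 ^ 5 * B * s) : 10 ^ 10 * A ≤ B := by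
  have h4 : Real.exp (ℓ / 4 - 1.5) ≤ 10 ^ 5 * B := by
    have h5 : Real.exp (- ℓ / 4 + 1.5) * Real.exp (ℓ / 4 - 1.5) = 1 := by
      rw [← Real.exp_add, show - ℓ / 4 + 1.5 + (ℓ / 4 - 1.5) = 0 by ring, Real.exp_zero]
    have h6 : 1 ≤ 10 ^ 5 * B * Real.exp (- ℓ / 4 + 1.5) :=
      h.trans (mul_le_mul_of_nonneg_left hs (by positivity))
    calc _ = 1 * Real.exp (ℓ / 4 - 1.5) := (one_mul _).symm
      _ ≤ (10 ^ 5 * B * Real.exp (- ℓ / 4 + 1.5)) * Real.exp (ℓ / 4 - 1.5) := by gcongr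
      _ = 10 ^ 5 * B := by rw [mul_assoc, h5, mul_one]
  have h5 := Real.pow_div_factorial_le_exp (ℓ / 4 - 1.5) (by linarith) 3
  have h6 : (10 ^ 13 : ℝ) ≤ ℓ / 4 - 1.5 := by linarith
  generalize ht : ℓ / 4 - 1.5 = t at h4 h5 h6
  have h7 : (10 ^ 13 : ℝ) ^ 2 ≤ t ^ 2 := by gcongr
  have h8 : (10 ^ 13 : ℝ) ^ 2 * t ≤ t ^ 3 := by
    calc _ ≤ t ^ 2 * t := by gcongr
      _ = _ := by ring
  norm_num [Nat.factorial] at h5 h8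
  linarith

set_option maxHeartbeats 1000000 in
/-- Three solutions close to the same real root, not too large compared to the discriminant. -/
lemma HasIntegralEsymm.false_of_three_close (hα : HasIntegralEsymm α)
    (hν : ∏ i, (x - α i * y) = ν) (hν1 : |ν| = 1) (hμ : ∏ i, (z - α i * w) = μ) (hμ1 : |μ| = 1)
    (hℓ : 10 ^ 14 ≤ ℓ)
    (hD : ((α 1 - α 2) * ((α 0 - α 1) * (α 0 - α 2))) ^ 2 = Real.exp ℓ) {Q₁ Q₂ Q₃ : ℝ}
    (hQ₁ : (α 0 - α 1) * (α 0 - α 2) = Q₁)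
    (hQ₂ : Q₁ * ((x - α 1 * y) * (x - α 2 * y)) = Q₂)
    (hQ₃ : Q₁ * ((z - α 1 * w) * (z - α 2 * w)) = Q₃)
    (h1 : 0.48 * Real.exp (ℓ / 2) ≤ Q₁) (h2 : 0.6 * Q₁ ^ 2 ≤ Q₂) (h2' : Q₂ ≤ Real.exp (14 * ℓ + 1))
    (h3 : 0.6 * Q₂ ^ 2 ≤ Q₃) : False := by
  have hQ₁0 : 0 < Q₁ := lt_of_lt_of_le (by positivity) h1
  have hQ₂0 : 0 < Q₂ := lt_of_lt_of_le (by positivity) h2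
  have hQ₃0 : 0 < Q₃ := lt_of_lt_of_le (by positivity) h3
  have hu := log_abs_conj_eq_logVec hν hν1
  have hv := log_abs_conj_eq_logVec hμ hμ1
  have hu12 : 0 < (x - α 1 * y) * (x - α 2 * y) := by
    rw [← hQ₂] at hQ₂0; exact (mul_pos_iff_of_pos_left hQ₁0).mp hQ₂0
  have hv12 : 0 < (z - α 1 * w) * (z - α 2 * w) := by
    rw [← hQ₃] at hQ₃0; exact (mul_pos_iff_of_pos_left hQ₁0).mp hQ₃0
  have hu1 : (x - α 1 * y : ℝ) ≠ 0 := left_ne_zero_of_mul hu12.ne'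
  have hu2 : (x - α 2 * y : ℝ) ≠ 0 := right_ne_zero_of_mul hu12.ne'
  have hv1 : (z - α 1 * w : ℝ) ≠ 0 := left_ne_zero_of_mul hv12.ne'
  have hv2 : (z - α 2 * w : ℝ) ≠ 0 := right_ne_zero_of_mul hv12.ne'
  have ha1 : α 0 - α 1 ≠ 0 := by rintro h; rw [h] at hQ₁; simp at hQ₁; linarith
  have ha2 : α 0 - α 2 ≠ 0 := by rintro h; rw [h] at hQ₁; simp at hQ₁; linarith
  set A := (Real.log (x - α 1 * y) + Real.log (x - α 2 * y)) / 2 with hA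
  set ε := Real.log (x - α 1 * y) - Real.log (x - α 2 * y) with hε
  set B := (Real.log (z - α 1 * w) + Real.log (z - α 2 * w)) / 2 with hB
  set δ := Real.log (z - α 1 * w) - Real.log (z - α 2 * w) with hδ
  set g := Real.log Q₁ with hg
  have hQ₁e : Q₁ = Real.exp g := (Real.exp_log hQ₁0).symm
  have hQ₂e : Q₂ = Real.exp (g + 2 * A) := by
    rw [Real.exp_add, ← hQ₁e, ← hQ₂, hA, mul_div_cancel₀ _ two_ne_zero, ← Real.log_mul hu1 hu2,
      Real.exp_log hu12]
  have hQ₃e : Q₃ = Real.exp (g + 2 * B) := by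
    rw [Real.exp_add, ← hQ₁e, ← hQ₃, hB, mul_div_cancel₀ _ two_ne_zero, ← Real.log_mul hv1 hv2,
      Real.exp_log hv12]
  have hexp : Real.exp (-1) ≤ 0.48 := by
    rw [Real.exp_neg, inv_le_comm₀ (Real.exp_pos _) (by norm_num)]
    have := Real.exp_one_gt_d9
    norm_num at this ⊢
    linarith
  have hgℓ : ℓ / 2 - 1 ≤ g := by
    rw [← Real.exp_le_exp, ← hQ₁e]
    refine le_trans ?_ h1
    rw [sub_eq_neg_add, Real.exp_add]
    gcongr
  have hAg : 2 * g - 1 ≤ g + 2 * A := by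
    rw [← Real.exp_le_exp, ← hQ₂e]
    refine le_trans ?_ h2
    rw [sub_eq_neg_add, Real.exp_add, show 2 * g = (2 : ℕ) * g by norm_num, Real.exp_nat_mul,
      ← hQ₁e]
    gcongr
    linarith
  have hAℓ : g + 2 * A ≤ 14 * ℓ + 1 := by rwa [← Real.exp_le_exp, ← hQ₂e]
  have hBA : 2 * (g + 2 * A) - 1 ≤ g + 2 * B := by
    rw [← Real.exp_le_exp, ← hQ₃e]
    refine le_trans ?_ h3
    rw [sub_eq_neg_add, Real.exp_add, show 2 * (g + 2 * A) = (2 : ℕ) * (g + 2 * A) by norm_num,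
      Real.exp_nat_mul, ← hQ₂e]
    gcongr
    linarith
  have hT : |α 1 - α 2| = Real.exp (ℓ / 2 - g) := by
    rw [hQ₁, mul_pow] at hD
    rw [← pow_left_inj₀ (abs_nonneg _) (Real.exp_nonneg _) two_ne_zero, sq_abs, ← Real.exp_nat_mul]
    apply mul_right_cancel₀ (pow_ne_zero 2 hQ₁0.ne')
    rw [hD, hQ₁e, ← Real.exp_nat_mul, ← Real.exp_add]
    congr 1; push_cast; ring
  have hu0 : |x - α 0 * y| = Real.exp (-2 * A) := hu 0
  have hv0 : |z - α 0 * w| = Real.exp (-2 * B) := hv 0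
  have hτ : ∀ (X Y t C : ℝ), X * Y = Real.exp (g + 2 * C) → X - Y = (α 1 - α 2) * t →
      |t| = Real.exp (-2 * C) →
      (X - Y) ^ 2 = Real.exp (ℓ / 2 - 3 * g / 2 - 3 * C) ^ 2 * (X * Y) := by
    intro X Y t C h h' ht
    rw [h', ← sq_abs, abs_mul, hT, ht, h, ← Real.exp_add, ← Real.exp_nat_mul, ← Real.exp_nat_mul,
      ← Real.exp_add]
    congr 1; push_cast; ring
  set s := Real.exp (ℓ / 2 - 3 * g / 2) with hs
  have hsC : ∀ C, Real.exp (ℓ / 2 - 3 * g / 2 - 3 * C) = s * Real.exp (-3 * C) := fun C ↦ by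
    rw [hs, ← Real.exp_add]; congr 1; ring
  have hs1 : s ≤ Real.exp (- ℓ / 4 + 1.5) := by
    rw [hs, Real.exp_le_exp]; linarith
  have hs100 : s ≤ 1 / 100 := by
    have h4 := Real.add_one_le_exp (ℓ / 4 - 1.5)
    have h5 : Real.exp (- ℓ / 4 + 1.5) * Real.exp (ℓ / 4 - 1.5) = 1 := by
      rw [← Real.exp_add, show - ℓ / 4 + 1.5 + (ℓ / 4 - 1.5) = 0 by ring, Real.exp_zero]
    nlinarith only [Real.exp_pos (- ℓ / 4 + 1.5), h4, h5, hs1, hℓ]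
  have hs0 : 0 < s := Real.exp_pos _
  have e1 : (α 0 - α 2) * (α 0 - α 1) = Real.exp (g + 2 * 0) := by
    rw [mul_comm, hQ₁, hQ₁e]; simp
  have e2 : ((α 0 - α 2) * (x - α 1 * y)) * ((α 0 - α 1) * (x - α 2 * y)) =
      Real.exp (g + 2 * A) := by
    rw [← hQ₂e, ← hQ₂, ← hQ₁]; ring
  have e3 : ((α 0 - α 2) * (z - α 1 * w)) * ((α 0 - α 1) * (z - α 2 * w)) =
      Real.exp (g + 2 * B) := by
    rw [← hQ₃e, ← hQ₃, ← hQ₁]; ring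
  have t1 := hτ _ _ 1 0 e1 (by ring) (by simp)
  have t2 := hτ _ _ _ A e2 (by ring) hu0
  have t3 := hτ _ _ _ B e3 (by ring) hv0
  rw [hsC] at t1 t2 t3
  simp only [mul_zero, Real.exp_zero, mul_one] at t1
  have b1 := abs_log_div_bounds (by rw [e1]; positivity) hs0.le t1
  have b2 := abs_log_div_bounds (by rw [e2]; positivity) (by positivity) t2
  have b3 := abs_log_div_bounds (by rw [e3]; positivity) (by positivity) t3
  have hA1 : 1 ≤ A := by linarith
  have hB1 : 1 ≤ B := by linarith
  have hlow := b1.2 (by linarith)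
  have hup := b1.1
  have k2 := b2.1.trans (mul_le_mul_of_nonneg_left (exp_neg_three_mul_le hA1) hs0.le)
  have k3 := b3.1.trans (mul_le_mul_of_nonneg_left (exp_neg_three_mul_le hB1) hs0.le)
  have hlog : ∀ p q : ℝ, p ≠ 0 → q ≠ 0 → Real.log (((α 0 - α 2) * p) / ((α 0 - α 1) * q)) =
      Real.log ((α 0 - α 2) / (α 0 - α 1)) + (Real.log p - Real.log q) := by
    intro p q hp hq
    rw [Real.log_div (mul_ne_zero ha2 hp) (mul_ne_zero ha1 hq), Real.log_mul ha2 hp,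
      Real.log_mul ha1 hq, Real.log_div ha2 ha1]
    ring
  rw [hlog _ _ hu1 hu2, ← hε] at k2
  rw [hlog _ _ hv1 hv2, ← hδ] at k3
  have hε1 : |ε| ≤ 1.1 * s := by
    rw [abs_le] at *; constructor <;> linarith [hup.1, hup.2, k2.1, k2.2]
  have hδ1 : |δ| ≤ 1.1 * s := by
    rw [abs_le] at *; constructor <;> linarith [hup.1, hup.2, k3.1, k3.2]
  have hε2 : 0.7 * s ≤ |ε| := by
    have h4 := abs_sub_abs_le_abs_sub (Real.log ((α 0 - α 2) / (α 0 - α 1)))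
      (Real.log ((α 0 - α 2) / (α 0 - α 1)) + ε)
    rw [sub_add_cancel_left, abs_neg] at h4
    have h5 : 0.9 * s ≤ s / 1.1 := by
      rw [le_div_iff₀ (by norm_num)]; linarith
    linarith
  have hP := hα.one_le_mul_of_close hν hν1 hu hv hA1 (by linarith) hs0 hε1 hε2 hδ1
  have hBbig := mul_le_of_one_le_mul (A := A) hℓ (by linarith) (by linarith) hs1 hP
  have hab : ∀ X Y : ℝ, X * Y = Q₁ → |X - Y| ≤ 3 → |X| ≤ Real.exp (8 * ℓ) := by
    intro X Y h h'
    refine (abs_le_of_mul_eq_of_abs_sub_le h hQ₁0.le h').trans ?_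
    have h4 : Q₁ ≤ Real.exp (7.5 * ℓ) := by rw [hQ₁e, Real.exp_le_exp]; linarith only [hAℓ, hAg, hℓ]
    have h5 := Real.add_one_le_exp (7.5 * ℓ)
    have h6 := Real.add_one_le_exp (0.5 * ℓ)
    have h7 : Real.exp (8 * ℓ) = Real.exp (7.5 * ℓ) * Real.exp (0.5 * ℓ) := by
      rw [← Real.exp_add]; congr 1; linarith only
    have h8 : Real.exp (7.5 * ℓ) * 2 ≤ Real.exp (7.5 * ℓ) * Real.exp (0.5 * ℓ) :=
      mul_le_mul_of_nonneg_left (by linarith only [h6, hℓ]) (Real.exp_nonneg _)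
    rw [h7]
    linarith only [h4, h5, h8, hℓ]
  have hT3 : |α 1 - α 2| ≤ 3 := by
    rw [hT]
    have := Real.exp_one_lt_d9
    have h4 : Real.exp (ℓ / 2 - g) ≤ Real.exp 1 := by rw [Real.exp_le_exp]; linarith
    linarith
  have h01 : |α 0 - α 1| ≤ Real.exp (8 * ℓ) :=
    hab _ _ hQ₁ (by rwa [show α 0 - α 1 - (α 0 - α 2) = -(α 1 - α 2) by ring, abs_neg])
  have h02 : |α 0 - α 2| ≤ Real.exp (8 * ℓ) :=
    hab _ (α 0 - α 1) (by rw [mul_comm, hQ₁])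
      (by rwa [show α 0 - α 2 - (α 0 - α 1) = α 1 - α 2 by ring])
  have h12 : |α 1 - α 2| ≤ Real.exp (8 * ℓ) := by
    have := Real.add_one_le_exp (8 * ℓ)
    linarith
  have hexp0 := Real.exp_nonneg (8 * ℓ)
  refine hα.false_of_close (l := Real.log (((α 0 - α 2) * (z - α 1 * w)) /
    ((α 0 - α 1) * (z - α 2 * w)))) hν hν1 hμ hμ1 hu hv ?_ ?_ (sub_ne_zero.mp ha1).symm
    (sub_ne_zero.mp ha2).symm ?_ hℓ ?_ ?_ ?_ ?_ ?_ hBbig ?_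
  · rw [hε, ← Real.log_div hu1 hu2, Real.exp_log, div_mul_cancel₀ _ hu2]
    rw [show (x - α 1 * y : ℝ) / (x - α 2 * y) = ((x - α 1 * y) * (x - α 2 * y)) /
      ((x - α 2 * y) * (x - α 2 * y)) by field_simp]
    exact div_pos hu12 (mul_self_pos.mpr hu2)
  · rw [Real.exp_log, div_mul_cancel₀ _ (mul_ne_zero ha1 hv2)]
    · ring
    · rw [← mul_div_mul_right _ _ (mul_ne_zero ha1 hv2)]
      rw [e3]
      exact div_pos (Real.exp_pos _) (mul_self_pos.mpr (mul_ne_zero ha1 hv2))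
  · intro i j
    fin_cases i <;> fin_cases j <;> simp <;> first | assumption | (rw [abs_sub_comm]; assumption)
  · refine le_trans ?_ hε2
    rw [hs]
    have h4 : Real.exp (-1) ≤ 0.7 := by linarith
    calc _ ≤ Real.exp (-1) * Real.exp (ℓ / 2 - 3 * g / 2) := by
          rw [← Real.exp_add, Real.exp_le_exp]; linarith
      _ ≤ _ := by gcongr
  · refine hε1.trans ?_
    have h4 := Real.add_one_le_exp (1 : ℝ)
    calc _ ≤ Real.exp 1 * Real.exp (- ℓ / 4 + 1.5) := by gcongr; linarith
      _ ≤ _ := by rw [← Real.exp_add, Real.exp_le_exp]; linarith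
  · linarith
  · linarith
  · linarith
  · refine b3.1.trans ?_
    have := Real.exp_nonneg (-3 * B)
    exact mul_le_of_le_one_left this (by linarith only [hs100])

end Interpolation

end CubicThue

namespace CubicThue

/-- A real linear factor `l * x + k * y` of an integral binary cubic form, with cofactor
`A * x ^ 2 + B * x * y + C * y ^ 2`. -/
structure LinearFactor (a b c d : ℤ) where
  (l k A B C : ℝ)
  ha : a = l * A
  hb : b = l * B + k * A
  hc : c = l * C + k * B
  hd : d = k * C

namespace LinearFactor

variable {a b c d : ℤ} (f : LinearFactor a b c d)

/-- The value of the linear factor. -/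
def lin (s : ℤ × ℤ) : ℝ := f.l * s.1 + f.k * s.2

/-- The value of the quadratic cofactor. -/
def quad (s : ℤ × ℤ) : ℝ := f.A * s.1 ^ 2 + f.B * s.1 * s.2 + f.C * s.2 ^ 2

/-- Half the Jacobian of the linear factor and its cofactor. -/
noncomputable def jac (s : ℤ × ℤ) : ℝ :=
  ((f.l * f.B - 2 * f.k * f.A) * s.1 + (2 * f.l * f.C - f.k * f.B) * s.2) / 2

/-- The discriminant of the quadratic cofactor. -/
def quadDisc : ℝ := f.B ^ 2 - 4 * f.A * f.C

/-- The resultant of the linear factor and its cofactor. -/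
def res : ℝ := f.A * f.k ^ 2 - f.B * f.l * f.k + f.C * f.l ^ 2

lemma lin_mul_quad (s : ℤ × ℤ) : f.lin s * f.quad s = cubicFormVal a b c d s := by
  simp only [lin, quad, cubicFormVal]
  push_cast
  rw [f.ha, f.hb, f.hc, f.hd]
  ring

lemma jac_sq_sub (s : ℤ × ℤ) :
    f.jac s ^ 2 - f.quadDisc / 4 * f.lin s ^ 2 = f.res * f.quad s := by
  simp only [lin, quad, jac, quadDisc, res]
  ring

lemma cubicDisc_eq : (cubicDisc a b c d : ℝ) = f.quadDisc * f.res ^ 2 := by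
  simp only [cubicDisc, quadDisc, res]
  push_cast
  rw [f.ha, f.hb, f.hc, f.hd]
  ring

lemma jac_mul_lin_sub (s t : ℤ × ℤ) :
    f.jac s * f.lin t - f.jac t * f.lin s = -f.res * (s.1 * t.2 - t.1 * s.2 : ℤ) := by
  simp only [lin, jac, res]
  push_cast
  ring

end LinearFactor

lemma isCoprime_of_abs_cubicFormVal_eq_one {a b c d : ℤ} {s : ℤ × ℤ}
    (h : |cubicFormVal a b c d s| = 1) : IsCoprime s.1 s.2 := by
  have h1 : cubicFormVal a b c d s * cubicFormVal a b c d s = 1 := by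
    rw [← abs_mul_abs_self, h, one_mul]
  refine ⟨cubicFormVal a b c d s * (a * s.1 ^ 2 + b * s.1 * s.2 + c * s.2 ^ 2),
    cubicFormVal a b c d s * (d * s.2 ^ 2), ?_⟩
  have h2 : cubicFormVal a b c d s =
    a * s.1 ^ 3 + b * s.1 ^ 2 * s.2 + c * s.1 * s.2 ^ 2 + d * s.2 ^ 3 := rfl
  generalize cubicFormVal a b c d s = v at h1 h2
  linear_combination h1 - v * h2

/-- An integral change of variables moves a solution to `(1, 0)`. -/
lemma LinearFactor.exists_monic {a b c d : ℤ} (f : LinearFactor a b c d) {s₁ : ℤ × ℤ}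
    (hs₁ : |cubicFormVal a b c d s₁| = 1) :
    ∃ (ν b' c' d' : ℤ) (α p q : ℝ), ν = cubicFormVal a b c d s₁ ∧
      (b' : ℝ) = p - α ∧ (c' : ℝ) = q - p * α ∧ (d' : ℝ) = -q * α ∧
      α ^ 2 + p * α + q = ν * f.res / f.lin s₁ ∧
      p ^ 2 - 4 * q = f.quadDisc * f.lin s₁ ^ 2 ∧ (p + 2 * α) / 2 = ν * f.jac s₁ ∧
      ∀ s, ∃ X Y : ℤ, cubicFormVal 1 b' c' d' (X, Y) = ν * cubicFormVal a b c d s ∧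
        X - α * Y = f.lin s / f.lin s₁ ∧
        ((p + 2 * α) * X + (2 * q + p * α) * Y) / 2 = ν * f.jac s := by
  obtain ⟨e, g, heg⟩ := isCoprime_of_abs_cubicFormVal_eq_one hs₁
  obtain ⟨x, y⟩ := s₁
  simp only at heg
  set ν := cubicFormVal a b c d (x, y) with hν
  have hν2 : (ν : ℝ) * ν = 1 := by
    rw [← Int.cast_mul, ← abs_mul_abs_self, hs₁]; norm_num
  have hF := f.lin_mul_quad (x, y)
  rw [← hν] at hF
  have hegr : (e : ℝ) * x + g * y = 1 := by exact_mod_cast heg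
  have hl0 : f.lin (x, y) ≠ 0 := fun h ↦ by
    rw [h, zero_mul] at hF; rw [← hF] at hν2; simp at hν2
  have hq : f.quad (x, y) = ν / f.lin (x, y) := by rw [eq_div_iff hl0, mul_comm, hF]
  obtain ⟨r, hr⟩ : ∃ r, r = 1 / f.lin (x, y) := ⟨_, rfl⟩
  have hlr : f.lin (x, y) * r = 1 := by rw [hr]; field_simp
  rw [div_eq_mul_one_div, ← hr] at hq
  obtain ⟨k', hk'⟩ : ∃ k', k' = f.lin (-g, e) := ⟨_, rfl⟩
  obtain ⟨C', hC'⟩ : ∃ C', C' = f.quad (-g, e) := ⟨_, rfl⟩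
  obtain ⟨B', hB'⟩ : ∃ B', B' = -2 * f.A * x * g + f.B * (x * e - y * g) + 2 * f.C * y * e :=
    ⟨_, rfl⟩
  obtain ⟨m, hm⟩ : ∃ m, m = f.lin (x, y) := ⟨_, rfl⟩
  obtain ⟨A', hA'⟩ : ∃ A', A' = f.quad (x, y) := ⟨_, rfl⟩
  have hres : f.res = A' * k' ^ 2 - B' * m * k' + C' * m ^ 2 := by
    have : A' * k' ^ 2 - B' * m * k' + C' * m ^ 2 = f.res * ((e : ℝ) * x + g * y) ^ 2 := by
      rw [hA', hk', hB', hm, hC', res]; simp only [lin, quad]; push_cast; ring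
    rw [this, hegr]; ring
  have hqd : f.quadDisc = B' ^ 2 - 4 * A' * C' := by
    have : B' ^ 2 - 4 * A' * C' = f.quadDisc * ((e : ℝ) * x + g * y) ^ 2 := by
      rw [hA', hB', hC', quadDisc]; simp only [quad]; push_cast; ring
    rw [this, hegr]; ring
  have hj : f.jac (x, y) = (m * B' - 2 * k' * A') / 2 := by
    have : (m * B' - 2 * k' * A') / 2 = f.jac (x, y) * ((e : ℝ) * x + g * y) := by
      rw [hA', hk', hB', hm, jac]; simp only [lin, quad]; push_cast; ring
    rw [this, hegr]; ring
  have hbs : (ν * (-3 * a * x ^ 2 * g + b * (x ^ 2 * e - 2 * x * g * y) +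
      c * (2 * x * y * e - g * y ^ 2) + 3 * d * y ^ 2 * e) : ℝ) = ν * (m * B' + k' * A') := by
    rw [hA', hk', hB', hm, f.ha, f.hb, f.hc, f.hd]; simp only [lin, quad]; push_cast; ring
  have hcs : (ν * (3 * a * g ^ 2 * x + b * (g ^ 2 * y - 2 * g * x * e) +
      c * (-2 * g * e * y + x * e ^ 2) + 3 * d * e ^ 2 * y) : ℝ) = ν * (m * C' + k' * B') := by
    rw [hC', hk', hB', hm, f.ha, f.hb, f.hc, f.hd]; simp only [lin, quad]; push_cast; ring
  have hds : (ν * cubicFormVal a b c d (-g, e) : ℝ) = ν * (k' * C') := by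
    rw [hk', hC', f.lin_mul_quad (-g, e)]
  rw [← hm] at hl0 hlr hr
  rw [← hA'] at hq
  have hform : ∀ s : ℤ × ℤ, (m * (s.1 * e + s.2 * g) + k' * (x * s.2 - y * s.1) : ℝ) = f.lin s ∧
      (A' * (s.1 * e + s.2 * g) ^ 2 + B' * (s.1 * e + s.2 * g) * (x * s.2 - y * s.1) +
        C' * (x * s.2 - y * s.1) ^ 2 : ℝ) = f.quad s ∧
      ((m * B' - 2 * k' * A') * (s.1 * e + s.2 * g) +
        (2 * m * C' - k' * B') * (x * s.2 - y * s.1)) / 2 = f.jac s := by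
    intro s
    refine ⟨?_, ?_, ?_⟩
    · have : (m * (s.1 * e + s.2 * g) + k' * (x * s.2 - y * s.1) : ℝ) =
          f.lin s * ((e : ℝ) * x + g * y) := by
        rw [hk', hm]; simp only [lin]; push_cast; ring
      rw [this, hegr, mul_one]
    · have : (A' * (s.1 * e + s.2 * g) ^ 2 + B' * (s.1 * e + s.2 * g) * (x * s.2 - y * s.1) +
          C' * (x * s.2 - y * s.1) ^ 2 : ℝ) = f.quad s * ((e : ℝ) * x + g * y) ^ 2 := by
        rw [hA', hB', hC']; simp only [quad]; push_cast; ring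
      rw [this, hegr]; ring
    · have : ((m * B' - 2 * k' * A') * (s.1 * e + s.2 * g) +
          (2 * m * C' - k' * B') * (x * s.2 - y * s.1)) / 2 =
          f.jac s * ((e : ℝ) * x + g * y) ^ 2 := by
        rw [hA', hB', hC', hk', hm]; simp only [lin, quad, jac]; push_cast; ring
      rw [this, hegr]; ring
  rw [← hm]
  have hb₁ : (ν * (m * B' + k' * A') : ℝ) = ν * m * B' - -k' * r := by
    rw [hq]; linear_combination k' * r * hν2
  have hc₁ : (ν * (m * C' + k' * B') : ℝ) = ν * m * C' - ν * m * B' * (-k' * r) := by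
    linear_combination -ν * k' * B' * hlr
  have hd₁ : (ν * (k' * C') : ℝ) = -(ν * m * C') * (-k' * r) := by
    linear_combination -ν * k' * C' * hlr
  refine ⟨ν, ν * (-3 * a * x ^ 2 * g + b * (x ^ 2 * e - 2 * x * g * y) +
      c * (2 * x * y * e - g * y ^ 2) + 3 * d * y ^ 2 * e),
    ν * (3 * a * g ^ 2 * x + b * (g ^ 2 * y - 2 * g * x * e) +
      c * (-2 * g * e * y + x * e ^ 2) + 3 * d * e ^ 2 * y),
    ν * cubicFormVal a b c d (-g, e), -k' * r, ν * m * B', ν * m * C', rfl, ?_, ?_, ?_, ?_, ?_,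
    ?_, ?_⟩
  · push_cast; rw [hbs, hb₁]
  · push_cast; rw [hcs, hc₁]
  · push_cast; rw [hds, hd₁]
  · rw [hres, div_eq_mul_one_div, ← hr, hq]
    linear_combination -k' ^ 2 * r ^ 2 * hν2 - ν * C' * m * hlr
  · rw [hqd, hq]
    linear_combination (m ^ 2 * B' ^ 2) * hν2 + 4 * ν * m * C' * hlr
  · rw [hj, hq]
    linear_combination k' * r * hν2
  intro s
  obtain ⟨h₁, h₂, h₃⟩ := hform s
  refine ⟨s.1 * e + s.2 * g, x * s.2 - y * s.1, ?_, ?_, ?_⟩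
  · rw [← @Int.cast_inj ℝ]
    have hFs := f.lin_mul_quad s
    rw [← h₁, ← h₂] at hFs
    simp only [cubicFormVal] at hds hFs ⊢
    push_cast at hds hFs ⊢
    rw [hbs, hcs, hds, ← hFs, hq]
    generalize (s.1 * e + s.2 * g : ℝ) = X at *
    generalize (x * s.2 - y * s.1 : ℝ) = Y at *
    linear_combination (-X ^ 3 * m * r) * hν2 - X ^ 3 * hlr
  · rw [← h₁]
    push_cast
    field_simp
    rw [hr]
    field_simp
    ring
  · rw [← h₃, hq]
    push_cast
    generalize (s.1 * e + s.2 * g : ℝ) = X at *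
    generalize (x * s.2 - y * s.1 : ℝ) = Y at *
    linear_combination k' * r * X * hν2 - ν * k' * B' / 2 * Y * hlr

end CubicThue

namespace CubicThue

lemma cubicDisc_sq_of_monic {b c d : ℤ} {α p q : ℝ} (hb : (b : ℝ) = p - α)
    (hc : (c : ℝ) = q - p * α) (hd : (d : ℝ) = -q * α) {a' b' c' d' ν : ℤ}
    (f : LinearFactor a' b' c' d') (hν : |ν| = 1) {L : ℝ} (hL : L ≠ 0)
    (hQ : α ^ 2 + p * α + q = ν * f.res / L) (hE : p ^ 2 - 4 * q = f.quadDisc * L ^ 2) :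
    cubicDisc 1 b c d = cubicDisc a' b' c' d' := by
  rw [← @Int.cast_inj ℝ, cubicDisc_eq_mul_sq hb hc hd, hQ, hE, f.cubicDisc_eq]
  have hν2 : (ν : ℝ) ^ 2 = 1 := by
    rw [← sq_abs, ← Int.cast_abs, hν]; norm_num
  field_simp
  linear_combination f.quadDisc * f.res ^ 2 * hν2

namespace LinearFactor

variable {a b c d : ℤ} (f : LinearFactor a b c d)

/-- The absolute value of the cofactor, scaled by the resultant. -/
noncomputable def height (s : ℤ × ℤ) : ℝ := |f.res * f.quad s|

/-- A pair is close to a linear factor if the latter is small at it. -/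
def Close (s : ℤ × ℤ) : Prop := |f.quadDisc| * f.lin s ^ 2 ≤ 4

variable {f} {s s₁ s₂ : ℤ × ℤ}

lemma abs_lin_mul_height (hs : |cubicFormVal a b c d s| = 1) :
    |f.lin s| * f.height s = |f.res| := by
  have h : |f.lin s| * |f.quad s| = 1 := by
    rw [← abs_mul, f.lin_mul_quad, ← Int.cast_abs, hs, Int.cast_one]
  rw [height, abs_mul]
  linear_combination |f.res| * h

lemma abs_lin_pos (hs : |cubicFormVal a b c d s| = 1) : 0 < |f.lin s| := by
  have h : |f.lin s| * |f.quad s| = 1 := by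
    rw [← abs_mul, f.lin_mul_quad, ← Int.cast_abs, hs, Int.cast_one]
  rcases (abs_nonneg (f.lin s)).eq_or_lt with h0 | h0
  · rw [← h0, zero_mul] at h; norm_num at h
  · exact h0

lemma abs_jac_sq_sub_le (hc : f.Close s) : |f.jac s ^ 2 - f.res * f.quad s| ≤ 1 := by
  have h := f.jac_sq_sub s
  have : f.jac s ^ 2 - f.res * f.quad s = f.quadDisc / 4 * f.lin s ^ 2 := by linarith
  rw [this, abs_mul, abs_div, abs_of_nonneg (sq_nonneg (f.lin s))]
  have := hc
  simp only [Close] at this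
  norm_num
  linarith

lemma jac_sq_le (hc : f.Close s) : f.jac s ^ 2 ≤ f.height s + 1 := by
  have h1 := abs_le.1 (abs_jac_sq_sub_le hc)
  have h2 := le_abs_self (f.res * f.quad s)
  rw [height]
  linarith

lemma height_le_jac_sq (hc : f.Close s) : f.height s ≤ f.jac s ^ 2 + 1 := by
  have h1 := abs_le.1 (abs_jac_sq_sub_le hc)
  rw [height, abs_le]
  constructor <;> nlinarith [sq_nonneg (f.jac s)]

/-- A solution close to a linear factor cannot have a much larger successor when it is itself
larger than a power of the discriminant. -/
lemma false_of_disc_pow_le (hs₁ : |cubicFormVal a b c d s₁| = 1)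
    (hs₂ : |cubicFormVal a b c d s₂| = 1) (hD : Real.exp 1000 ≤ |(cubicDisc a b c d : ℝ)|)
    (hc₁ : f.Close s₁) (hc₂ : f.Close s₂)
    (h1 : 2 * |(cubicDisc a b c d : ℝ)| ^ 14 ≤ f.height s₁)
    (h2 : 0.81 * f.height s₁ ^ 2 ≤ f.height s₂) : False := by
  obtain ⟨ν, b', c', d', α, p, q, hν₁, hb, hc, hd, hQ, hE, hj₁, hform⟩ := f.exists_monic hs₁
  have hν : |ν| = 1 := by rw [hν₁, hs₁]
  obtain ⟨X, Y, hF, hlin, hjac⟩ := hform s₂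
  have hl₁ := abs_lin_pos (f := f) hs₁
  have hl₂ := abs_lin_pos (f := f) hs₂
  have hl0 : f.lin s₁ ≠ 0 := abs_pos.1 hl₁
  have hdisc := cubicDisc_sq_of_monic hb hc hd f hν hl0 hQ hE
  have hν1 : |(ν : ℝ)| = 1 := by rw [← Int.cast_abs, hν, Int.cast_one]
  have hν2 : (ν : ℝ) ^ 2 = 1 := by rw [← sq_abs, hν1, one_pow]
  have hR₁ := abs_lin_mul_height (f := f) hs₁
  have hR₂ := abs_lin_mul_height (f := f) hs₂
  have hQabs : |α ^ 2 + p * α + q| = f.height s₁ := by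
    rw [hQ, abs_div, abs_mul, hν1, one_mul, ← hR₁]
    field_simp
  have ha := jac_sq_le hc₁
  have hb₁ := height_le_jac_sq hc₁
  have ha' := jac_sq_le hc₂
  have hb' := height_le_jac_sq hc₂
  have hexp : (1000 : ℝ) ≤ Real.exp 1000 := by linarith [Real.add_one_le_exp (1000 : ℝ)]
  have hX : (1000 : ℝ) ≤ |(cubicDisc a b c d : ℝ)| := hexp.trans hD
  have hX14 : (1000 : ℝ) ≤ |(cubicDisc a b c d : ℝ)| ^ 14 :=
    hX.trans (le_self_pow₀ (by linarith) (by norm_num))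
  refine not_solution_of_pow_seven_le (x := X) (y := Y) hb hc hd (by rwa [hdisc]) ?_ ?_ ?_ ?_ ?_
  · rw [hF, abs_mul, hν, hs₂, one_mul]
  · rw [hj₁, hQabs, mul_pow, hν2]
    linarith
  · rw [hlin, hjac, hQabs, mul_pow, hν2, abs_div, div_mul_eq_mul_div, div_le_iff₀ hl₁]
    have : f.jac s₂ ^ 2 ≤ 1.1 * f.height s₂ := by nlinarith only [ha', h2, h1, hX14]
    nlinarith only [mul_le_mul_of_nonneg_left this hl₂.le, hR₁, hR₂]
  · rw [hdisc, hj₁, abs_mul, hν1, one_mul]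
    apply le_of_sq_le_sq _ (abs_nonneg _)
    rw [← pow_mul, sq_abs]
    norm_num
    linarith
  · rw [hjac, hj₁, abs_mul, hν1, one_mul, mul_pow, hν2, one_mul]
    apply le_of_sq_le_sq _ (abs_nonneg _)
    rw [sq_abs]
    have h3 : 0.8 * f.jac s₁ ^ 2 ≤ 0.8 * (f.height s₁ + 1) := by linarith
    have h4 : (0.8 * f.jac s₁ ^ 2) ^ 2 ≤ (0.8 * (f.height s₁ + 1)) ^ 2 :=
      pow_le_pow_left₀ (by positivity) h3 2
    nlinarith only [h4, hb', h2, h1, hX14]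

/-- The gap principle for two solutions close to the same linear factor. -/
lemma height_sq_le (hs₁ : |cubicFormVal a b c d s₁| = 1) (hs₂ : |cubicFormVal a b c d s₂| = 1)
    (hc₁ : f.Close s₁) (hc₂ : f.Close s₂) (hdet : s₁.1 * s₂.2 - s₂.1 * s₁.2 ≠ 0)
    (h1 : 10 ^ 10 ≤ f.height s₁) (h12 : f.height s₁ ≤ f.height s₂) :
    0.81 * f.height s₁ ^ 2 ≤ f.height s₂ := by
  have hR₁ := abs_lin_mul_height (f := f) hs₁
  have hR₂ := abs_lin_mul_height (f := f) hs₂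
  have hl₁ := abs_lin_pos (f := f) hs₁
  have hl₂ := abs_lin_pos (f := f) hs₂
  have hj := f.jac_mul_lin_sub s₁ s₂
  have hd : (1 : ℝ) ≤ |((s₁.1 * s₂.2 - s₂.1 * s₁.2 : ℤ) : ℝ)| := by
    exact_mod_cast Int.one_le_abs hdet
  have hR : |f.res| ≤ |f.jac s₁| * |f.lin s₂| + |f.jac s₂| * |f.lin s₁| := by
    rw [← abs_mul, ← abs_mul]
    refine le_trans ?_ (abs_sub _ _)
    rw [hj, abs_mul, abs_neg]
    exact le_mul_of_one_le_right (abs_nonneg _) hd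
  have ha := jac_sq_le hc₁
  have ha' := jac_sq_le hc₂
  rw [← sq_abs] at ha ha'
  have hRpos : 0 < |f.res| := by rw [← hR₁]; nlinarith
  have e1 : |f.lin s₁| = |f.res| / f.height s₁ := by
    rw [← hR₁]; have : f.height s₁ ≠ 0 := by linarith
    field_simp
  have e2 : |f.lin s₂| = |f.res| / f.height s₂ := by
    rw [← hR₂]; have : f.height s₂ ≠ 0 := by linarith
    field_simp
  rw [e1, e2] at hR
  generalize f.height s₁ = n₁ at *
  generalize f.height s₂ = n₂ at *
  have hm₁ := abs_nonneg (f.jac s₁)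
  have hm₂ := abs_nonneg (f.jac s₂)
  generalize |f.jac s₁| = m₁ at *
  generalize |f.jac s₂| = m₂ at *
  generalize |f.res| = R at *
  have hR2 : n₁ * n₂ ≤ m₁ * n₁ + m₂ * n₂ := by
    have h5 : m₁ * (R / n₂) + m₂ * (R / n₁) = R * ((m₁ * n₁ + m₂ * n₂) / (n₁ * n₂)) := by
      have : n₁ ≠ 0 := by linarith
      have : n₂ ≠ 0 := by linarith
      field_simp
    rw [h5] at hR
    have h6 : 1 ≤ (m₁ * n₁ + m₂ * n₂) / (n₁ * n₂) := by
      by_contra! h; nlinarith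
    rwa [one_le_div (by nlinarith)] at h6
  have h7 : m₁ ≤ 0.001 * n₁ := by
    apply le_of_sq_le_sq _ (by linarith)
    nlinarith only [ha, h1]
  have h8 : m₁ * n₁ ≤ 0.001 * n₁ * n₂ :=
    mul_le_mul h7 h12 (by linarith) (by linarith)
  have h9 : 0.999 * n₁ ≤ m₂ := by
    by_contra! h
    nlinarith only [mul_lt_mul_of_pos_right h (show 0 < n₂ by linarith), h8, hR2]
  have h10 : (0.999 * n₁) ^ 2 ≤ m₂ ^ 2 := pow_le_pow_left₀ (by linarith) h9 2
  nlinarith only [h10, ha', h1]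

end LinearFactor

end CubicThue

namespace CubicThue

namespace LinearFactor

variable {a b c d : ℤ} {f : LinearFactor a b c d} {s s₁ s₂ s₃ : ℤ × ℤ}

lemma abs_disc_le_height_sq (hs : |cubicFormVal a b c d s| = 1) (hc : f.Close s) :
    |(cubicDisc a b c d : ℝ)| ≤ 4 * f.height s ^ 2 := by
  have hR := abs_lin_mul_height (f := f) hs
  rw [f.cubicDisc_eq, abs_mul, abs_pow, ← hR]
  have := hc
  simp only [Close] at this
  rw [mul_pow, sq_abs]
  nlinarith [mul_le_mul_of_nonneg_right this (sq_nonneg (f.height s))]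

lemma exp_half_le_height {ℓ : ℝ} (hs : |cubicFormVal a b c d s| = 1) (hc : f.Close s)
    (hD : |(cubicDisc a b c d : ℝ)| = Real.exp ℓ) : 0.5 * Real.exp (ℓ / 2) ≤ f.height s := by
  have h := abs_disc_le_height_sq hs hc
  rw [hD, show ℓ = ℓ / 2 + ℓ / 2 by ring, Real.exp_add] at h
  apply le_of_sq_le_sq _ (abs_nonneg _)
  nlinarith

lemma res_mul_quad_eq_height (hc : f.Close s) (h : 1 < f.height s) :
    f.res * f.quad s = f.height s := by
  have h1 := abs_le.1 (abs_jac_sq_sub_le hc)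
  rw [height] at h ⊢
  rcases lt_abs.1 h with h2 | h2
  · rw [abs_of_pos (by linarith)]
  · nlinarith [sq_nonneg (f.jac s)]

/-- There are no three solutions of moderate size close to the same linear factor. -/
lemma false_of_three_close {ℓ : ℝ} (hs₁ : |cubicFormVal a b c d s₁| = 1)
    (hs₂ : |cubicFormVal a b c d s₂| = 1) (hs₃ : |cubicFormVal a b c d s₃| = 1)
    (hc₁ : f.Close s₁) (hc₂ : f.Close s₂) (hc₃ : f.Close s₃) (hℓ : 10 ^ 14 ≤ ℓ)
    (hD : (cubicDisc a b c d : ℝ) = Real.exp ℓ)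
    (h2 : 0.81 * f.height s₁ ^ 2 ≤ f.height s₂) (h2' : f.height s₂ ≤ Real.exp (14 * ℓ + 1))
    (h3 : 0.81 * f.height s₂ ^ 2 ≤ f.height s₃) : False := by
  obtain ⟨ν, b', c', d', α, p, q, hν₁, hb, hc, hd, hQ, hE, hj₁, hform⟩ := f.exists_monic hs₁
  have hν : |ν| = 1 := by rw [hν₁, hs₁]
  obtain ⟨x, y, hF₂, hlin₂, -⟩ := hform s₂
  obtain ⟨z, w, hF₃, hlin₃, -⟩ := hform s₃
  have hl₁ := abs_pos.1 (abs_lin_pos (f := f) hs₁)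
  have hdisc := cubicDisc_sq_of_monic hb hc hd f hν hl₁ hQ hE
  have hDabs : |(cubicDisc a b c d : ℝ)| = Real.exp ℓ := by
    rw [hD, abs_of_pos (Real.exp_pos _)]
  have hν2 : (ν : ℝ) ^ 2 = 1 := by
    rw [← sq_abs, ← Int.cast_abs, hν, Int.cast_one, one_pow]
  have hbig : (100 : ℝ) ≤ Real.exp (ℓ / 2) := by
    linarith only [Real.add_one_le_exp (ℓ / 2), hℓ]
  have hn₁ := exp_half_le_height hs₁ hc₁ hDabs
  have hn₂ := exp_half_le_height hs₂ hc₂ hDabs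
  have hn₃ := exp_half_le_height hs₃ hc₃ hDabs
  have hq₁ := res_mul_quad_eq_height hc₁ (by linarith only [hn₁, hbig])
  have hq₂ := res_mul_quad_eq_height hc₂ (by linarith only [hn₂, hbig])
  have hq₃ := res_mul_quad_eq_height hc₃ (by linarith only [hn₃, hbig])
  have hE0 : 0 ≤ p ^ 2 - 4 * q := by
    have h4 : 0 < f.quadDisc * f.res ^ 2 := by
      rw [← f.cubicDisc_eq, hD]; exact Real.exp_pos _
    rw [hE]
    exact mul_nonneg (pos_of_mul_pos_left h4 (sq_nonneg _)).le (sq_nonneg _)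
  obtain ⟨δ, hδ⟩ : ∃ δ, δ = √(p ^ 2 - 4 * q) := ⟨_, rfl⟩
  have hδ2 : δ ^ 2 = p ^ 2 - 4 * q := by rw [hδ, Real.sq_sqrt hE0]
  have hfac : ∀ X Y : ℤ, ((X : ℝ) - (-p + δ) / 2 * Y) * (X - (-p - δ) / 2 * Y) =
      X ^ 2 + p * X * Y + q * Y ^ 2 := fun X Y ↦ by
    linear_combination (-(Y : ℝ) ^ 2 / 4) * hδ2
  have hval : ∀ X Y : ℤ, (X - α * Y) * ((X : ℝ) ^ 2 + p * X * Y + q * Y ^ 2) =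
      cubicFormVal 1 b' c' d' (X, Y) := fun X Y ↦ by
    simp only [cubicFormVal]
    push_cast
    rw [hb, hc, hd]
    ring
  have hquad : ∀ (X Y : ℤ) (t : ℤ × ℤ), |cubicFormVal a b c d t| = 1 →
      cubicFormVal 1 b' c' d' (X, Y) = ν * cubicFormVal a b c d t →
      X - α * Y = f.lin t / f.lin s₁ → (α ^ 2 + p * α + q) *
        ((X : ℝ) ^ 2 + p * X * Y + q * Y ^ 2) = f.res * f.quad t := by
    intro X Y t ht hF hl
    have hlt := abs_pos.1 (abs_lin_pos (f := f) ht)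
    have h5 := hval X Y
    rw [hF, Int.cast_mul, ← f.lin_mul_quad, hl] at h5
    have h6 : (X : ℝ) ^ 2 + p * X * Y + q * Y ^ 2 = ν * f.lin s₁ * f.quad t := by
      field_simp at h5
      linear_combination h5
    rw [h6, hQ]
    field_simp
    linear_combination f.res * f.quad t * hν2
  have hQ' : α ^ 2 + p * α + q = f.height s₁ := by
    have h5 := f.lin_mul_quad s₁
    rw [← hν₁] at h5
    rw [hQ, ← hq₁, ← h5]
    field_simp
  have hα : HasIntegralEsymm ![α, (-p + δ) / 2, (-p - δ) / 2] := by
    refine ⟨-b', c', -d', ?_, ?_, ?_⟩ <;> simp only [Matrix.cons_val] <;> push_cast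
    · rw [hb]; ring
    · rw [hc]; linear_combination (-1 / 4) * hδ2
    · rw [hd]; linear_combination (-α / 4) * hδ2
  refine hα.false_of_three_close (x := x) (y := y) (z := z) (w := w)
    (ν := cubicFormVal 1 b' c' d' (x, y)) (μ := cubicFormVal 1 b' c' d' (z, w))
    (Q₁ := f.height s₁) (Q₂ := f.height s₂) (Q₃ := f.height s₃)
    ?_ ?_ ?_ ?_ hℓ ?_ ?_ ?_ ?_ ?_ ?_ h2' ?_
  · simp only [Fin.prod_univ_three, Matrix.cons_val]
    rw [mul_assoc, hfac, hval]
  · rw [hF₂, abs_mul, hν, hs₂, one_mul]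
  · simp only [Fin.prod_univ_three, Matrix.cons_val]
    rw [mul_assoc, hfac, hval]
  · rw [hF₃, abs_mul, hν, hs₃, one_mul]
  · simp only [Matrix.cons_val]
    rw [show (α - (-p + δ) / 2) * (α - (-p - δ) / 2) = α ^ 2 + p * α + q by
        linear_combination (-1 / 4) * hδ2,
      show (-p + δ) / 2 - (-p - δ) / 2 = δ by ring, mul_pow, hδ2, ← hD, ← hdisc,
      cubicDisc_eq_mul_sq hb hc hd]
  · simp only [Matrix.cons_val]
    rw [← hQ']
    linear_combination (-1 / 4) * hδ2
  · simp only [Matrix.cons_val]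
    rw [hfac, ← hQ', hquad x y s₂ hs₂ hF₂ hlin₂, hq₂]
  · simp only [Matrix.cons_val]
    rw [hfac, ← hQ', hquad z w s₃ hs₃ hF₃ hlin₃, hq₃]
  · linarith only [hn₁, hbig]
  · nlinarith only [h2, hn₁, hbig]
  · nlinarith only [h3, hn₁, hbig]

end LinearFactor

end CubicThue

namespace CubicThue

/-- A family of pairwise nonproportional solutions. -/
structure IsSolutionFamily (a b c d : ℤ) {n : ℕ} (s : Fin n → ℤ × ℤ) : Prop where
  abs_eq_one : ∀ i, |cubicFormVal a b c d (s i)| = 1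
  det_ne_zero : ∀ i j, i ≠ j → (s i).1 * (s j).2 - (s j).1 * (s i).2 ≠ 0

lemma IsSolutionFamily.comp {a b c d : ℤ} {m n : ℕ} {s : Fin n → ℤ × ℤ}
    (h : IsSolutionFamily a b c d s) {g : Fin m → Fin n} (hg : Function.Injective g) :
    IsSolutionFamily a b c d (s ∘ g) :=
  ⟨fun i ↦ h.abs_eq_one (g i), fun _ _ hij ↦ h.det_ne_zero _ _ fun he ↦ hij (hg he)⟩

namespace LinearFactor

variable {a b c d : ℤ} {f : LinearFactor a b c d}

lemma height_sq_le_of_family {ℓ : ℝ} {n : ℕ} {s : Fin n → ℤ × ℤ}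
    (hs : IsSolutionFamily a b c d s) (hc : ∀ i, f.Close (s i)) (hℓ : 10 ^ 14 ≤ ℓ)
    (hD : |(cubicDisc a b c d : ℝ)| = Real.exp ℓ) (hm : Monotone (f.height ∘ s))
    {i j : Fin n} (hij : i < j) : 0.81 * f.height (s i) ^ 2 ≤ f.height (s j) := by
  refine height_sq_le (hs.abs_eq_one i) (hs.abs_eq_one j) (hc i) (hc j)
    (hs.det_ne_zero i j hij.ne) ?_ (hm hij.le)
  have h1 := exp_half_le_height (hs.abs_eq_one i) (hc i) hD
  linarith [Real.add_one_le_exp (ℓ / 2)]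

lemma false_of_family_of_disc_pow_le {ℓ : ℝ} {n : ℕ} {s : Fin n → ℤ × ℤ}
    (hs : IsSolutionFamily a b c d s) (hc : ∀ i, f.Close (s i)) (hℓ : 10 ^ 14 ≤ ℓ)
    (hD : |(cubicDisc a b c d : ℝ)| = Real.exp ℓ) (hm : Monotone (f.height ∘ s))
    {i j : Fin n} (hij : i < j) (h : 2 * Real.exp (14 * ℓ) ≤ f.height (s i)) : False := by
  refine false_of_disc_pow_le (hs.abs_eq_one i) (hs.abs_eq_one j) ?_ (hc i) (hc j) ?_
    (height_sq_le_of_family hs hc hℓ hD hm hij)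
  · rw [hD]; exact Real.exp_le_exp.2 (by linarith)
  · rw [hD, ← Real.exp_nat_mul]; exact_mod_cast h

/-- With positive discriminant, at most two solutions are close to a given linear factor. -/
lemma false_of_family_three {ℓ : ℝ} {s : Fin 3 → ℤ × ℤ} (hs : IsSolutionFamily a b c d s)
    (hc : ∀ i, f.Close (s i)) (hℓ : 10 ^ 14 ≤ ℓ) (hD : (cubicDisc a b c d : ℝ) = Real.exp ℓ) :
    False := by
  wlog hm : Monotone (f.height ∘ s) generalizing s
  · exact this (hs.comp (Tuple.sort (f.height ∘ s)).injective) (fun i ↦ hc _)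
      (Tuple.monotone_sort (f.height ∘ s))
  have hD' : |(cubicDisc a b c d : ℝ)| = Real.exp ℓ := by rw [hD, abs_of_pos (Real.exp_pos _)]
  rcases le_or_gt (f.height (s 1)) (Real.exp (14 * ℓ + 1)) with h | h
  · exact false_of_three_close (hs.abs_eq_one 0) (hs.abs_eq_one 1) (hs.abs_eq_one 2) (hc 0) (hc 1)
      (hc 2) hℓ hD (height_sq_le_of_family hs hc hℓ hD' hm (by decide)) h
      (height_sq_le_of_family hs hc hℓ hD' hm (by decide))
  · refine false_of_family_of_disc_pow_le hs hc hℓ hD' hm (i := 1) (j := 2) (by decide) ?_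
    rw [Real.exp_add] at h
    nlinarith [Real.exp_pos (14 * ℓ), Real.add_one_le_exp (1 : ℝ)]

/-- At most six solutions are close to a given linear factor. -/
lemma false_of_family_seven {ℓ : ℝ} {s : Fin 7 → ℤ × ℤ} (hs : IsSolutionFamily a b c d s)
    (hc : ∀ i, f.Close (s i)) (hℓ : 10 ^ 14 ≤ ℓ)
    (hD : |(cubicDisc a b c d : ℝ)| = Real.exp ℓ) : False := by
  wlog hm : Monotone (f.height ∘ s) generalizing s
  · exact this (hs.comp (Tuple.sort (f.height ∘ s)).injective) (fun i ↦ hc _)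
      (Tuple.monotone_sort (f.height ∘ s))
  refine false_of_family_of_disc_pow_le hs hc hℓ hD hm (i := 5) (j := 6) (by decide) ?_
  have h0 := exp_half_le_height (hs.abs_eq_one 0) (hc 0) hD
  have step : ∀ {i j : Fin 7} {k : ℕ}, i < j →
      (0.4 * Real.exp (ℓ / 2)) ^ k ≤ 0.81 * f.height (s i) →
      (0.4 * Real.exp (ℓ / 2)) ^ (k * 2) ≤ 0.81 * f.height (s j) := by
    intro i j k hij h
    have h1 := height_sq_le_of_family hs hc hℓ hD hm hij
    rw [pow_mul]
    calc _ ≤ (0.81 * f.height (s i)) ^ 2 := pow_le_pow_left₀ (by positivity) h 2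
      _ ≤ _ := by linarith
  have h1 : (0.4 * Real.exp (ℓ / 2)) ^ 1 ≤ 0.81 * f.height (s 0) := by
    linarith [Real.exp_pos (ℓ / 2)]
  have h5 := step (j := 5) (by decide) (step (j := 4) (by decide) (step (j := 3) (by decide)
    (step (j := 2) (by decide) (step (j := 1) (by decide) h1))))
  have hT : (10 : ℝ) ^ 13 ≤ Real.exp (ℓ / 2) := by linarith [Real.add_one_le_exp (ℓ / 2)]
  rw [show 14 * ℓ = (28 : ℕ) * (ℓ / 2) by push_cast; ring, Real.exp_nat_mul]
  generalize Real.exp (ℓ / 2) = T at *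
  norm_num at h5
  rw [mul_pow] at h5
  have hT4 : ((10 : ℝ) ^ 13) ^ 4 ≤ T ^ 4 := pow_le_pow_left₀ (by positivity) hT 4
  have : T ^ 32 = T ^ 28 * T ^ 4 := by ring
  rw [this] at h5
  have h6 : (0 : ℝ) ≤ T ^ 28 := by positivity
  have := mul_le_mul_of_nonneg_left hT4 h6
  norm_num at h5 this
  linarith

end LinearFactor

end CubicThue

namespace CubicThue

namespace LinearFactor

variable {a b c d : ℤ} (f : LinearFactor a b c d)

lemma close_or_close_of_quadDisc_neg (hE : f.quadDisc < 0) {s t : ℤ × ℤ}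
    (hs : |cubicFormVal a b c d s| = 1) (ht : |cubicFormVal a b c d t| = 1)
    (hdet : s.1 * t.2 - t.1 * s.2 ≠ 0) : f.Close s ∨ f.Close t := by
  by_contra! h
  simp only [Close, not_le, abs_of_neg hE] at h
  obtain ⟨e, he⟩ : ∃ e, e = -f.quadDisc / 4 := ⟨_, rfl⟩
  have he0 : 0 < e := by rw [he]; linarith
  have key : ∀ t : ℤ × ℤ, |cubicFormVal a b c d t| = 1 → 4 < -f.quadDisc * f.lin t ^ 2 →
      0 ≤ f.jac t ^ 2 + e * f.lin t ^ 2 ∧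
        (f.jac t ^ 2 + e * f.lin t ^ 2) ^ 2 < f.res ^ 2 * e := by
    intro t ht hct
    have h1 := f.jac_sq_sub t
    have h2 := f.lin_mul_quad t
    have h3 : (cubicFormVal a b c d t : ℝ) ^ 2 = 1 := by
      rw [← sq_abs, ← Int.cast_abs, ht]; norm_num
    rw [← h2] at h3
    have h4 : f.jac t ^ 2 + e * f.lin t ^ 2 = f.res * f.quad t := by rw [he]; linarith
    refine ⟨by positivity, ?_⟩
    have h5 : 1 < e * f.lin t ^ 2 := by rw [he]; linarith
    have hR : f.res ≠ 0 := by
      intro hR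
      rw [hR] at h4
      nlinarith [sq_nonneg (f.jac t)]
    have hq : 0 < f.quad t ^ 2 := by
      have : f.quad t ≠ 0 := by rintro h; rw [h] at h3; norm_num at h3
      positivity
    have h6 : f.quad t ^ 2 < e := by nlinarith
    rw [h4, mul_pow]
    exact mul_lt_mul_of_pos_left h6 (by positivity)
  obtain ⟨hs0, hs1⟩ := key s hs h.1
  obtain ⟨ht0, ht1⟩ := key t ht h.2
  have hj := f.jac_mul_lin_sub s t
  have hd : (1 : ℝ) ≤ ((s.1 * t.2 - t.1 * s.2 : ℤ) : ℝ) ^ 2 := by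
    rw [← sq_abs, ← Int.cast_abs]
    exact one_le_pow₀ (by exact_mod_cast Int.one_le_abs hdet)
  have h7 : f.res ^ 2 ≤ (f.jac s * f.lin t - f.jac t * f.lin s) ^ 2 := by
    rw [hj, mul_pow, neg_sq]
    exact le_mul_of_one_le_right (sq_nonneg _) hd
  have h8 : f.res ^ 2 * e ≤
      (f.jac s ^ 2 + e * f.lin s ^ 2) * (f.jac t ^ 2 + e * f.lin t ^ 2) := by
    nlinarith [sq_nonneg (f.jac s * f.jac t + e * f.lin s * f.lin t)]
  generalize f.jac s ^ 2 + e * f.lin s ^ 2 = N₁ at *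
  generalize f.jac t ^ 2 + e * f.lin t ^ 2 = N₂ at *
  nlinarith [sq_nonneg (N₁ - N₂)]

end LinearFactor

/-- Every integral binary cubic form has a real linear factor. -/
lemma nonempty_linearFactor (a b c d : ℤ) : Nonempty (LinearFactor a b c d) := by
  rcases eq_or_ne a 0 with rfl | ha
  · exact ⟨⟨0, 1, b, c, d, by simp, by simp, by simp, by simp⟩⟩
  obtain ⟨r, hr⟩ : ∃ r : ℝ, a * r ^ 3 + b * r ^ 2 + c * r + d = 0 := by
    set M : ℝ := 1 + |(a * b : ℝ)| + |(a * c : ℝ)| + |(a * d : ℝ)| with hM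
    have ha2 : (1 : ℝ) ≤ (a : ℝ) ^ 2 := by
      exact_mod_cast Int.one_le_abs (pow_ne_zero 2 ha) |>.trans_eq (abs_of_nonneg (sq_nonneg a))
    have hb := neg_abs_le (a * b : ℝ)
    have hb' := le_abs_self (a * b : ℝ)
    have hc := neg_abs_le (a * c : ℝ)
    have hc' := le_abs_self (a * c : ℝ)
    have hd := neg_abs_le (a * d : ℝ)
    have hd' := le_abs_self (a * d : ℝ)
    have hb0 := abs_nonneg (a * b : ℝ)
    have hc0 := abs_nonneg (a * c : ℝ)
    have hd0 := abs_nonneg (a * d : ℝ)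
    have hM1 : 1 ≤ M := by linarith
    have hM2 : M ≤ M ^ 2 := by nlinarith
    have hM3 : 0 ≤ M ^ 3 := by positivity
    have h1 : |(a * b : ℝ)| * M ^ 2 + |(a * c : ℝ)| * M + |(a * d : ℝ)| ≤ (M - 1) * M ^ 2 := by
      have e1 : M - 1 = |(a * b : ℝ)| + |(a * c : ℝ)| + |(a * d : ℝ)| := by rw [hM]; ring
      rw [e1]
      nlinarith [mul_le_mul_of_nonneg_left hM2 hc0,
        mul_le_mul_of_nonneg_left (hM1.trans hM2) hd0]
    have hcont : Continuous fun r : ℝ ↦ a * (a * r ^ 3 + b * r ^ 2 + c * r + d) := by fun_prop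
    have h2 := mul_le_mul_of_nonneg_right ha2 hM3
    have hbm := mul_le_mul_of_nonneg_right hb (sq_nonneg M)
    have hbm' := mul_le_mul_of_nonneg_right hb' (sq_nonneg M)
    have hcm := mul_le_mul_of_nonneg_right hc (zero_le_one.trans hM1)
    have hcm' := mul_le_mul_of_nonneg_right hc' (zero_le_one.trans hM1)
    obtain ⟨r, -, hr⟩ := intermediate_value_Icc (show -M ≤ M by linarith) hcont.continuousOn
      (show (0 : ℝ) ∈ Set.Icc _ _ from ⟨by nlinarith only [h1, h2, hbm', hcm, hd', hM2, hM1],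
        by nlinarith only [h1, h2, hbm, hcm, hd, hM2, hM1]⟩)
    exact ⟨r, (mul_eq_zero.1 hr).resolve_left (by exact_mod_cast ha)⟩
  exact ⟨⟨1, -r, a, b + r * a, c + r * (b + r * a), by ring, by ring, by ring,
    by linear_combination hr⟩⟩

/-- A factorization of an integral binary cubic form into real linear factors. -/
structure Splitting (a b c d : ℤ) where
  (l k : Fin 3 → ℝ)
  ha : a = l 0 * l 1 * l 2
  hb : b = l 0 * l 1 * k 2 + l 0 * k 1 * l 2 + k 0 * l 1 * l 2
  hc : c = l 0 * k 1 * k 2 + k 0 * l 1 * k 2 + k 0 * k 1 * l 2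
  hd : d = k 0 * k 1 * k 2

lemma LinearFactor.nonempty_splitting {a b c d : ℤ} (f : LinearFactor a b c d)
    (hE : 0 < f.quadDisc) : Nonempty (Splitting a b c d) := by
  suffices h : ∃ l₁ k₁ l₂ k₂, f.A = l₁ * l₂ ∧ f.B = l₁ * k₂ + k₁ * l₂ ∧ f.C = k₁ * k₂ by
    obtain ⟨l₁, k₁, l₂, k₂, hA, hB, hC⟩ := h
    refine ⟨⟨![f.l, l₁, l₂], ![f.k, k₁, k₂], ?_, ?_, ?_, ?_⟩⟩ <;> simp only [Matrix.cons_val]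
    · rw [f.ha, hA]; ring
    · rw [f.hb, hA, hB]; ring
    · rw [f.hc, hB, hC]; ring
    · rw [f.hd, hC]; ring
  rcases eq_or_ne f.A 0 with hA | hA
  · exact ⟨0, 1, f.B, f.C, by simp [hA], by simp, by simp⟩
  · have hδ := Real.sq_sqrt hE.le
    refine ⟨f.A, (f.B - √f.quadDisc) / 2, 1, (f.B + √f.quadDisc) / (2 * f.A), by ring, ?_, ?_⟩
    · field_simp; ring
    · field_simp
      generalize √f.quadDisc = δ at *
      rw [quadDisc] at hδ
      linear_combination hδ

namespace Splitting

variable {a b c d : ℤ} (g : Splitting a b c d)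

/-- The linear factor of index `i`. -/
def factor (i : Fin 3) : LinearFactor a b c d where
  l := g.l i
  k := g.k i
  A := g.l (i + 1) * g.l (i + 2)
  B := g.l (i + 1) * g.k (i + 2) + g.k (i + 1) * g.l (i + 2)
  C := g.k (i + 1) * g.k (i + 2)
  ha := by rw [g.ha]; fin_cases i <;> simp <;> ring
  hb := by rw [g.hb]; fin_cases i <;> simp <;> ring
  hc := by rw [g.hc]; fin_cases i <;> simp <;> ring
  hd := by rw [g.hd]; fin_cases i <;> simp <;> ring

end Splitting

lemma sq_add_mul_add_sq_lt {x y : ℝ} (hx : 2 < x) (hy : 2 < y) :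
    x ^ 2 + x * y + y ^ 2 < 0.75 * (x * y * (x + y)) := by
  nlinarith [mul_pos (sub_pos.2 hx) (sub_pos.2 hy), sq_nonneg (x - y)]

lemma sq_add_mul_add_sq_lt_abs {x y z : ℝ} (h : x + y + z = 0) (hx : 2 < |x|) (hy : 2 < |y|)
    (hz : 2 < |z|) : x ^ 2 + x * y + y ^ 2 < 0.75 * |x * y * z| := by
  have hz' : z = -(x + y) := by linarith
  have key : ∀ {u v : ℝ}, 2 < u → 2 < v → (u ^ 2 + u * v + v ^ 2 = x ^ 2 + x * y + y ^ 2) →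
      (u * v * (u + v) = x * y * z ∨ u * v * (u + v) = -(x * y * z)) →
      x ^ 2 + x * y + y ^ 2 < 0.75 * |x * y * z| := by
    intro u v hu hv h1 h2
    have h3 := sq_add_mul_add_sq_lt hu hv
    rw [h1] at h3
    rcases h2 with h2 | h2
    · rw [h2] at h3; linarith [le_abs_self (x * y * z)]
    · rw [h2] at h3; linarith [neg_abs_le (x * y * z)]
  rcases lt_abs.1 hx with h1 | h1 <;> rcases lt_abs.1 hy with h2 | h2
  · exact key h1 h2 rfl (.inr (by rw [hz']; ring))
  · rcases lt_abs.1 hz with h3 | h3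
    · exact key h1 h3 (by rw [hz']; ring) (.inr (by rw [hz']; ring))
    · exact key h2 h3 (by rw [hz']; ring) (.inl (by rw [hz']; ring))
  · rcases lt_abs.1 hz with h3 | h3
    · exact key h2 h3 (by rw [hz']; ring) (.inr (by rw [hz']; ring))
    · exact key h1 h3 (by rw [hz']; ring) (.inl (by rw [hz']; ring))
  · exact key h1 h2 (by ring) (.inl (by rw [hz']; ring))

/-- All solutions but one are close to some linear factor. -/
lemma Splitting.exists_close_or_exists_close {a b c d : ℤ} (g : Splitting a b c d)
    (hD : cubicDisc a b c d ≠ 0) {s t : ℤ × ℤ}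
    (hs : |cubicFormVal a b c d s| = 1) (ht : |cubicFormVal a b c d t| = 1)
    (hdet : s.1 * t.2 - t.1 * s.2 ≠ 0) :
    (∃ i, (g.factor i).Close s) ∨ ∃ i, (g.factor i).Close t := by
  by_contra! h
  obtain ⟨w, hw⟩ : ∃ w : Fin 3 → ℝ, w = fun i ↦ g.l (i + 1) * g.k (i + 2) -
      g.l (i + 2) * g.k (i + 1) := ⟨_, rfl⟩
  obtain ⟨W, hW⟩ : ∃ W, W = w 0 * w 1 * w 2 := ⟨_, rfl⟩
  have hDW : (cubicDisc a b c d : ℝ) = W ^ 2 := by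
    rw [hW, hw]
    simp only [cubicDisc]
    push_cast
    rw [g.ha, g.hb, g.hc, g.hd]
    ring
  have hW0 : 0 < |W| := by
    rw [abs_pos]
    rintro rfl
    exact hD (by exact_mod_cast hDW.trans (zero_pow two_ne_zero))
  obtain ⟨L, hL⟩ : ∃ L : Fin 3 → ℤ × ℤ → ℝ, L = fun i s ↦ w i * (g.l i * s.1 + g.k i * s.2) :=
    ⟨_, rfl⟩
  have key : ∀ t : ℤ × ℤ, |cubicFormVal a b c d t| = 1 → (∀ i, ¬ (g.factor i).Close t) →
      L 0 t ^ 2 + L 0 t * L 1 t + L 1 t ^ 2 < 0.75 * |W| := by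
    intro t ht hct
    have h1 : ∀ i, 2 < |L i t| := by
      intro i
      have h2 := hct i
      have h3 : (g.factor i).quadDisc = w i ^ 2 := by
        rw [hw]
        simp only [LinearFactor.quadDisc, factor]
        ring
      have h4 : (g.factor i).lin t = g.l i * t.1 + g.k i * t.2 := rfl
      rw [LinearFactor.Close, not_le, h3, abs_of_nonneg (sq_nonneg _), ← mul_pow, h4] at h2
      rw [hL]
      exact lt_of_pow_lt_pow_left₀ 2 (abs_nonneg _) (by rw [sq_abs]; linarith)
    have h5 : |L 0 t * L 1 t * L 2 t| = |W| := by
      have : L 0 t * L 1 t * L 2 t = W * cubicFormVal a b c d t := by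
        rw [hW, hL]
        simp only [cubicFormVal]
        push_cast
        rw [g.ha, g.hb, g.hc, g.hd]
        ring
      rw [this, abs_mul, ← Int.cast_abs, ht, Int.cast_one, mul_one]
    rw [← h5]
    exact sq_add_mul_add_sq_lt_abs (by rw [hL, hw]; simp; ring) (h1 0) (h1 1) (h1 2)
  have hs' := key s hs h.1
  have ht' := key t ht h.2
  have hd : (1 : ℝ) ≤ ((s.1 * t.2 - t.1 * s.2 : ℤ) : ℝ) ^ 2 := by
    rw [← sq_abs, ← Int.cast_abs]
    exact one_le_pow₀ (by exact_mod_cast Int.one_le_abs hdet)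
  have h6 : L 0 s * L 1 t - L 1 s * L 0 t = W * ((s.1 * t.2 - t.1 * s.2 : ℤ) : ℝ) := by
    rw [hW, hL, hw]
    push_cast
    ring
  have h7 : |W| ^ 2 ≤ (L 0 s * L 1 t - L 1 s * L 0 t) ^ 2 := by
    rw [h6, mul_pow, sq_abs]
    exact le_mul_of_one_le_right (sq_nonneg _) hd
  generalize L 0 s = x at *
  generalize L 1 s = y at *
  generalize L 0 t = x' at *
  generalize L 1 t = y' at *
  have h8 : 0.75 * (x * y' - y * x') ^ 2 ≤
      (x ^ 2 + x * y + y ^ 2) * (x' ^ 2 + x' * y' + y' ^ 2) := by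
    nlinarith only [sq_nonneg (x * x' + (x * y' + y * x') / 2 + y * y')]
  have h9 : (x ^ 2 + x * y + y ^ 2) * (x' ^ 2 + x' * y' + y' ^ 2) ≤
      (0.75 * |W|) * (0.75 * |W|) :=
    mul_le_mul hs'.le ht'.le (by nlinarith only [sq_nonneg (x' + y'), sq_nonneg x', sq_nonneg y'])
      (by positivity)
  nlinarith only [h7, h8, h9, hW0]

end CubicThue

namespace CubicThue

lemma eq_or_eq_neg_of_det_eq_zero {a b c d : ℤ} {s t : ℤ × ℤ}
    (hs : |cubicFormVal a b c d s| = 1) (ht : |cubicFormVal a b c d t| = 1)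
    (h : s.1 * t.2 - t.1 * s.2 = 0) : t = s ∨ t = -s := by
  obtain ⟨e, g, heg⟩ := isCoprime_of_abs_cubicFormVal_eq_one hs
  obtain ⟨k, hk⟩ : ∃ k, k = e * t.1 + g * t.2 := ⟨_, rfl⟩
  have h1 : t.1 = k * s.1 := by rw [hk]; linear_combination -t.1 * heg - g * h
  have h2 : t.2 = k * s.2 := by rw [hk]; linear_combination -t.2 * heg + e * h
  have h3 : cubicFormVal a b c d t = k ^ 3 * cubicFormVal a b c d s := by
    simp only [cubicFormVal, h1, h2]; ring
  rw [h3, abs_mul, hs, mul_one, abs_pow] at ht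
  have h4 : |k| = 1 := (pow_eq_one_iff_of_nonneg (abs_nonneg k) (by norm_num)).1 ht
  rcases eq_or_eq_neg_of_abs_eq h4 with rfl | rfl
  · left; ext <;> simp [h1, h2]
  · right; ext <;> simp [h1, h2]

lemma exists_injective_forall_of_or {n : ℕ} {P : Fin (n + 1) → Prop}
    (h : ∀ i j, i ≠ j → P i ∨ P j) :
    ∃ g : Fin n → Fin (n + 1), Function.Injective g ∧ ∀ i, P (g i) := by
  by_cases hP : ∀ i, P i
  · exact ⟨Fin.castSucc, Fin.castSucc_injective n, fun i ↦ hP _⟩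
  · push Not at hP
    obtain ⟨j, hj⟩ := hP
    exact ⟨j.succAbove, Fin.succAbove_right_injective,
      fun i ↦ (h _ _ (Fin.succAbove_ne j i)).resolve_right hj⟩

/-- There are no eight pairwise nonproportional solutions if the discriminant is large. -/
lemma IsSolutionFamily.false_of_eight {a b c d : ℤ} {s : Fin 8 → ℤ × ℤ}
    (hs : IsSolutionFamily a b c d s) {ℓ : ℝ} (hℓ : 10 ^ 14 ≤ ℓ)
    (hD : |(cubicDisc a b c d : ℝ)| = Real.exp ℓ) : False := by
  obtain ⟨f⟩ := nonempty_linearFactor a b c d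
  have hD0 : (cubicDisc a b c d : ℝ) ≠ 0 := by
    rw [← abs_pos, hD]; exact Real.exp_pos ℓ
  have hfD := f.cubicDisc_eq
  have hR : 0 ≤ f.res ^ 2 := sq_nonneg _
  rcases lt_trichotomy f.quadDisc 0 with hE | hE | hE
  · obtain ⟨g, hg, hc⟩ := exists_injective_forall_of_or (P := fun i ↦ f.Close (s i))
      fun i j hij ↦ f.close_or_close_of_quadDisc_neg hE (hs.abs_eq_one i) (hs.abs_eq_one j)
        (hs.det_ne_zero i j hij)
    exact LinearFactor.false_of_family_seven (hs.comp hg) hc hℓ hD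
  · exact hD0 (by rw [hfD, hE, zero_mul])
  · obtain ⟨F⟩ := f.nonempty_splitting hE
    rw [abs_of_nonneg (by rw [hfD]; positivity)] at hD
    obtain ⟨g, hg, hc⟩ := exists_injective_forall_of_or
      (P := fun i ↦ ∃ r, (F.factor r).Close (s i))
      fun i j hij ↦ F.exists_close_or_exists_close (by exact_mod_cast hD0) (hs.abs_eq_one i)
        (hs.abs_eq_one j) (hs.det_ne_zero i j hij)
    choose r hr using hc
    obtain ⟨y, hy⟩ := Fintype.exists_lt_card_fiber_of_mul_lt_card r (n := 2) (by simp)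
    have hmem := Finset.orderEmbOfCardLe_mem _ (Nat.succ_le_of_lt hy)
    refine LinearFactor.false_of_family_three (f := F.factor y)
      ((hs.comp hg).comp (Finset.orderEmbOfCardLe _ (Nat.succ_le_of_lt hy)).injective)
      (fun i ↦ ?_) hℓ hD
    have h1 := (Finset.mem_filter.1 (hmem i)).2
    have h2 := hr (Finset.orderEmbOfCardLe _ (Nat.succ_le_of_lt hy) i)
    rwa [h1] at h2

lemma exists_injective_fin_of_not_finite_and_card_le {α : Type*} {n : ℕ}
    (h : ¬ (Finite α ∧ Nat.card α ≤ n)) : ∃ g : Fin (n + 1) → α, Function.Injective g := by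
  by_cases hf : Finite α
  · have hn : n + 1 ≤ Nat.card α := by
      by_contra! hlt
      exact h ⟨hf, by omega⟩
    exact ⟨(Finite.equivFin α).symm ∘ Fin.castLE hn,
      (Finite.equivFin α).symm.injective.comp (Fin.castLE_injective hn)⟩
  · have := not_finite_iff_infinite.1 hf
    exact ⟨Infinite.natEmbedding α ∘ Fin.val,
      (Infinite.natEmbedding α).injective.comp Fin.val_injective⟩

end CubicThue

/-- There is a constant `N` such that every cubic Thue equation `F(U,V) = ±1`, with `F`
irreducible over `ℚ` of discriminant of absolute value at least `N`, has at most `7`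
integer solutions (counting `(u,v)` and `(-u,-v)` as one solution). -/
theorem cubic_thue_eq_large_disc_at_most_seven_solutions :
    ∃ N : ℕ, ∀ a b c d : ℤ,
      Irreducible
        (MvPolynomial.C (a : ℚ) * MvPolynomial.X 0 ^ 3 +
          MvPolynomial.C (b : ℚ) * MvPolynomial.X 0 ^ 2 * MvPolynomial.X 1 +
          MvPolynomial.C (c : ℚ) * MvPolynomial.X 0 * MvPolynomial.X 1 ^ 2 +
          MvPolynomial.C (d : ℚ) * MvPolynomial.X 1 ^ 3 : MvPolynomial (Fin 2) ℚ) →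
      (N : ℤ) ≤ |cubicDisc a b c d| →
      Finite (Quot (pmRelCubic a b c d)) ∧ Nat.card (Quot (pmRelCubic a b c d)) ≤ 7 := by
  refine ⟨⌈Real.exp (10 ^ 14)⌉₊, fun a b c d _ hN ↦ ?_⟩
  by_contra h
  obtain ⟨g, hg⟩ := CubicThue.exists_injective_fin_of_not_finite_and_card_le h
  have hD : Real.exp (10 ^ 14) ≤ |(cubicDisc a b c d : ℝ)| := by
    refine (Nat.le_ceil _).trans ?_
    exact_mod_cast hN
  have hpos : 0 < |(cubicDisc a b c d : ℝ)| := (Real.exp_pos _).trans_le hD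
  have habs : ∀ i, |cubicFormVal a b c d (g i).out.1| = 1 := fun i ↦
    (abs_eq zero_le_one).2 (g i).out.2
  refine CubicThue.IsSolutionFamily.false_of_eight (s := fun i ↦ (g i).out.1)
    ⟨habs, fun i j hij h0 ↦ ?_⟩
    ((Real.le_log_iff_exp_le hpos).2 hD) (Real.exp_log hpos).symm
  have h1 : pmRelCubic a b c d (g j).out (g i).out :=
    CubicThue.eq_or_eq_neg_of_det_eq_zero (habs i) (habs j) h0
  have h2 := Quot.sound h1
  rw [Quot.out_eq, Quot.out_eq] at h2
  exact hij (hg h2).symm
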